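/- Let W be a vector space over ℂ. If S is a pseudo-local subset of ℰ(W), then the nonlocal vertex algebra ⟨S⟩ generated by S (the smallest closed quasi compatible subspace of ℰ(W) containing S ∪ {1_W}) is also pseudo-local. If S is an 𝒮-local subset of ℰ(W), then ⟨S⟩ is 𝒮-local. -/

import Mathlib

noncomputable section

open Classical

namespace NVA

/-! ### The space ℰ(W) = Hom(W, W((x))), coefficient-indexed by modes:
`a w n` is the mode `a_n` applied to `w`, where `a(x)w = ∑ (a_n w) x^{-n-1}`.
Lower truncation of `a(x)w` in powers of `x` means `a_n w = 0` for `n` large. -/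

variable (W : Type*) [AddCommGroup W] [Module ℂ W]

/-- `ℰ(W) = Hom(W, W((x)))` as a submodule of `Hom(W, W[[x^{±1}]])`. -/
def EWsub : Submodule ℂ (W →ₗ[ℂ] (ℤ → W)) where
  carrier := {a | ∀ w : W, ∃ N : ℤ, ∀ n : ℤ, N ≤ n → a w n = 0}
  add_mem' := by
    intro a b ha hb w
    obtain ⟨N, hN⟩ := ha w
    obtain ⟨M, hM⟩ := hb w
    refine ⟨max N M, fun n hn => ?_⟩
    simp only [LinearMap.add_apply, Pi.add_apply,
      hN n (le_trans (le_max_left _ _) hn), hM n (le_trans (le_max_right _ _) hn), add_zero]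
  zero_mem' := by intro w; exact ⟨0, fun n _ => rfl⟩
  smul_mem' := by
    intro c a ha w
    obtain ⟨N, hN⟩ := ha w
    exact ⟨N, fun n hn => by
      simp only [LinearMap.smul_apply, Pi.smul_apply, hN n hn, smul_zero]⟩

/-- The type `ℰ(W)`. -/
abbrev EW := ↥(EWsub W)

variable {W}

/-- The mode function of an element of `ℰ(W)`. -/
def mf (a : EW W) : W → ℤ → W := fun w n => (a : W →ₗ[ℂ] (ℤ → W)) w n

/-- The identity operator `1_W`, as an element of `ℰ(W)`. -/
def oneE : EW W :=
  ⟨{ toFun := fun w n => if n = -1 then w else 0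
     map_add' := by
       intro w w'; funext n; by_cases h : n = -1 <;> simp [h]
     map_smul' := by
       intro c w; funext n; by_cases h : n = -1 <;> simp [h] },
   fun w => ⟨0, fun n hn => if_neg (by omega)⟩⟩

/-- The generalized binomial coefficient `C(m, j)` for `m ∈ ℤ`, as a complex number. -/
def binom (m : ℤ) (j : ℕ) : ℂ :=
  (∏ i ∈ Finset.range j, ((m : ℂ) - (i : ℂ))) / (j.factorial : ℂ)

/-- The coefficient of `x₁^m x₂^t` in `a(x₁) b(x₂) w`. -/
def Fab (a b : EW W) (w : W) (m t : ℤ) : W := mf a (mf b w (-t - 1)) (-m - 1)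

/-- Multiplication of a two-variable family by a polynomial `p(x₁,x₂)`. -/
def mulPoly (p : MvPolynomial (Fin 2) ℂ) (F : ℤ → ℤ → W) : ℤ → ℤ → W :=
  fun m t => ∑ d ∈ p.support, MvPolynomial.coeff d p • F (m - d 0) (t - d 1)

/-- A two-variable family lies in `W((x₁,x₂))` (jointly lower truncated). -/
def IsLaurent2 (F : ℤ → ℤ → W) : Prop :=
  ∃ N : ℤ, ∀ m t : ℤ, (m < N ∨ t < N) → F m t = 0

/-- Quasi compatibility of an ordered pair `(a(x), b(x))` in `ℰ(W)`:
`p(x₁,x₂) a(x₁) b(x₂) ∈ Hom(W, W((x₁,x₂)))` for some nonzero polynomial `p`. -/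
def QCPair (a b : EW W) : Prop :=
  ∃ p : MvPolynomial (Fin 2) ℂ, p ≠ 0 ∧ ∀ w, IsLaurent2 (mulPoly p (Fab a b w))

/-! ### Sequences -/

/-- The coefficient of `x₁^{k 1} ⋯ x_r^{k r}` in `ψ₁(x₁) ⋯ ψ_r(x_r) w`. -/
def seqCoeff : {r : ℕ} → (Fin r → EW W) → W → (Fin r → ℤ) → W
  | 0, _, w, _ => w
  | _ + 1, ψ, w, k => mf (ψ 0) (seqCoeff (Fin.tail ψ) w (Fin.tail k)) (-(k 0) - 1)

/-- The polynomial `∏_{1 ≤ i < j ≤ r} p(x_i, x_j)`. -/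
def pairPoly (p : MvPolynomial (Fin 2) ℂ) (r : ℕ) : MvPolynomial (Fin r) ℂ :=
  ∏ ij ∈ Finset.univ.filter (fun ij : Fin r × Fin r => ij.1 < ij.2),
    MvPolynomial.rename ![ij.1, ij.2] p

/-- Multiplication of an `r`-variable family by a polynomial in `r` variables. -/
def mulPolyN {r : ℕ} (P : MvPolynomial (Fin r) ℂ) (F : (Fin r → ℤ) → W) :
    (Fin r → ℤ) → W :=
  fun k => ∑ d ∈ P.support, MvPolynomial.coeff d P • F (fun i => k i - d i)

/-- An `r`-variable family lies in `W((x₁,…,x_r))`. -/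
def IsLaurentN {r : ℕ} (F : (Fin r → ℤ) → W) : Prop :=
  ∃ N : ℤ, ∀ k : Fin r → ℤ, (∃ i, k i < N) → F k = 0

/-- Quasi compatibility of an ordered sequence in `ℰ(W)`. -/
def QCSeq {r : ℕ} (ψ : Fin r → EW W) : Prop :=
  ∃ p : MvPolynomial (Fin 2) ℂ, p ≠ 0 ∧
    ∀ w, IsLaurentN (mulPolyN (pairPoly p r) (seqCoeff ψ w))

/-- Quasi compatibility of a subset of `ℰ(W)`. -/
def QCSet (S : Set (EW W)) : Prop :=
  ∀ (r : ℕ) (ψ : Fin r → EW W), (∀ i, ψ i ∈ S) → QCSeq ψ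

/-! ### The vertex operation `Y_ℰ^{(α)}` -/

/-- `ℂ((x))`. -/
abbrev LC : Type := LaurentSeries ℂ

/-- An iterated Laurent series field, e.g. `ℂ((x))((x₀))` (outer variable the second one). -/
abbrev K2 : Type := HahnSeries ℤ LC

/-- The outer variable of `K2`. -/
def xOuter : K2 := HahnSeries.single 1 1

/-- The inner variable of `K2`. -/
def xInner : K2 := HahnSeries.single 0 (HahnSeries.single 1 1)

/-- `α` times the inner variable of `K2`. -/
def xInnerC (c : ℂ) : K2 := HahnSeries.single 0 (HahnSeries.single 1 c)

/-- The polynomial `p(x₀ + α x, x)` as an element of `ℂ((x))((x₀))`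
(outer variable `x₀`). -/
def qK (p : MvPolynomial (Fin 2) ℂ) (α : ℂ) : K2 :=
  MvPolynomial.aeval ![xOuter + xInnerC α, xInner] p

/-- The expansion `ι_{x,x₀} (p(x₀ + α x, x)^{-1}) ∈ ℂ((x))((x₀))`. -/
def qInv (p : MvPolynomial (Fin 2) ℂ) (α : ℂ) : K2 := (qK p α)⁻¹

/-- The coefficient of `x₀^j x^t` in `(p(x₁,x) a(x₁) b(x) w)|_{x₁ = αx + x₀}`,
expanding via `(αx+x₀)^m = ∑_{j≥0} C(m,j) α^{m-j} x^{m-j} x₀^j`. -/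
def substYE (α : ℂ) (p : MvPolynomial (Fin 2) ℂ) (a b : EW W) (w : W)
    (j : ℕ) (t : ℤ) : W :=
  ∑ᶠ m : ℤ, (binom m j * α ^ (m - (j : ℤ))) • mulPoly p (Fab a b w) m (t - m + j)

/-- The coefficient of `x₀^J x^T` in
`ι_{x,x₀}(p(x₀+αx,x)^{-1}) ⬝ (p(x₁,x)a(x₁)b(x)w)|_{x₁ = αx+x₀}`. -/
def fullYE (α : ℂ) (p : MvPolynomial (Fin 2) ℂ) (a b : EW W) (w : W)
    (J T : ℤ) : W :=
  ∑ᶠ s : ℤ × ℤ, (((qInv p α).coeff s.1).coeff s.2) •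
    (if 0 ≤ J - s.1 then substYE α p a b w (J - s.1).toNat (T - s.2) else 0)

/-- The raw mode family of `Y_ℰ^{(α)}(a(x), x₀) b(x)`; `rawYE α a b n w m` is the mode
`m` of the element `a(x)_{(α,n)} b(x)` applied to `w`.  (Defined using a choice of
polynomial from quasi compatibility; by the general theory the value does not depend
on the choice.) -/
def rawYE (α : ℂ) (a b : EW W) (n : ℤ) (w : W) (m : ℤ) : W :=
  if h : QCPair a b then fullYE α h.choose a b w (-n - 1) (-m - 1) else 0

/-- `a(x)_{(α,n)} b(x)`, as an element of `ℰ(W)` whenever the raw family is realized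
by one (which is the case for any quasi compatible pair). -/
def YEa (α : ℂˣ) (a b : EW W) (n : ℤ) : EW W :=
  if h : ∃ c : EW W, ∀ w m, mf c w m = rawYE (α : ℂ) a b n w m then h.choose else 0

/-- `a(x)_n b(x) = a(x)_{(1,n)} b(x)`. -/
def YE (a b : EW W) (n : ℤ) : EW W := YEa 1 a b n

end NVA

namespace NVA

variable {W : Type*} [AddCommGroup W] [Module ℂ W]

/-- Submodules of `ℰ(W)` are `ℂ`-vector spaces (registered explicitly to assist
instance resolution). -/
noncomputable instance (V : Submodule ℂ (EW W)) : AddCommGroup ↥V :=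
  @Submodule.addCommGroup ℂ (EW W) _ inferInstance inferInstance V

noncomputable instance (V : Submodule ℂ (EW W)) : Module ℂ ↥V :=
  @Submodule.module ℂ (EW W) _ inferInstance inferInstance V

/-! ### Derivative and scaling operators on ℰ(W) -/

/-- `D = d/dx` on `ℰ(W)`: `(Da)_m = -m • a_{m-1}`. -/
def Dop (a : EW W) : EW W :=
  ⟨{ toFun := fun w m => (-m : ℂ) • mf a w (m - 1)
     map_add' := by intro w w'; funext m; simp [mf, map_add]
     map_smul' := by
       intro c w; funext m
       simp only [mf, map_smul, Pi.smul_apply, RingHom.id_apply]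
       exact smul_comm _ _ _ },
   by
     intro w
     obtain ⟨N, hN⟩ := a.2 w
     exact ⟨N + 1, fun m hm => by
       have : (a : W →ₗ[ℂ] (ℤ → W)) w (m - 1) = 0 := hN _ (by omega)
       simp [mf, this]⟩⟩

/-- `R_α : a(x) ↦ a(αx)`, on modes `(R_α a)_m = α^{-m-1} a_m`. -/
def RaE (α : ℂˣ) (a : EW W) : EW W :=
  ⟨{ toFun := fun w m => ((α : ℂ) ^ (-m - 1 : ℤ)) • mf a w m
     map_add' := by intro w w'; funext m; simp [mf, map_add]
     map_smul' := by
       intro c w; funext m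
       simp only [mf, map_smul, Pi.smul_apply, RingHom.id_apply]
       exact smul_comm _ _ _ },
   by
     intro w
     obtain ⟨N, hN⟩ := a.2 w
     exact ⟨N, fun m hm => by simp [mf, hN m hm]⟩⟩

/-! ### Nonlocal vertex algebras, modules and quasi modules -/

/-- The coefficient of `x₀^a x₂^b` in `Y₁(u, x₀+x₂) (Y₂(v,x₂) w)`, where
`(x₀+x₂)^m` is expanded in nonnegative powers of `x₂`. -/
def prodCE {V : Type*} (Yo Yi : V → W → ℤ → W) (u v : V) (w : W) (a b : ℤ) : W :=
  ∑ᶠ m : ℤ, if a ≤ m then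
    binom m (m - a).toNat • Yo u (Yi v w (-(b - (m - a)) - 1)) (-m - 1) else 0

/-- The coefficient of `x₀^a x₂^b` in `Y₂(Y₁(u,x₀)v, x₂) w`. -/
def assocCE {V : Type*} (Y1 : V → V → ℤ → V) (Y2 : V → W → ℤ → W)
    (u v : V) (w : W) (a b : ℤ) : W :=
  Y2 (Y1 u v (-a - 1)) w (-b - 1)

/-- Multiplication of a two-variable family (in `x₀, x₂`) by `f(x₀+x₂, x₂)` for a
polynomial `f`, expanding `(x₀+x₂)^d` in nonnegative powers of `x₂`. -/
def mulSubPoly (f : MvPolynomial (Fin 2) ℂ) (A : ℤ → ℤ → W) (a b : ℤ) : W :=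
  ∑ d ∈ f.support, ∑ i ∈ Finset.range (d 0 + 1),
    (MvPolynomial.coeff d f * ((d 0).choose i : ℂ)) •
      A (a - ((d 0 : ℤ) - i)) (b - i - (d 1 : ℤ))

/-- A nonlocal vertex algebra structure on a ℂ-vector space `V`:
a linear map `Y : V → ℰ(V) = Hom(V, V((x)))` and a vacuum vector `1` such that
`Y(1,x)v = v`, `Y(v,x)1 ∈ V[[x]]` with constant term `v`, and weak associativity
holds. -/
structure NLVA (V : Type*) [AddCommGroup V] [Module ℂ V] where
  Y : V →ₗ[ℂ] EW V
  one : V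
  vac : ∀ (v : V) (n : ℤ), mf (Y one) v n = if n = -1 then v else 0
  creation0 : ∀ (v : V) (n : ℤ), 0 ≤ n → mf (Y v) one n = 0
  creation1 : ∀ v : V, mf (Y v) one (-1) = v
  wassoc : ∀ u v w : V, ∃ l : ℕ, ∀ a b : ℤ,
    mulSubPoly (MvPolynomial.X 0 ^ l)
      (prodCE (fun x => mf (Y x)) (fun x => mf (Y x)) u v w) a b =
    mulSubPoly (MvPolynomial.X 0 ^ l)
      (assocCE (fun x y n => mf (Y x) y n) (fun x => mf (Y x)) u v w) a b

/-- The mode maps of a nonlocal vertex algebra: `Yf A u v n = u_n v`. -/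
def Yf {V : Type*} [AddCommGroup V] [Module ℂ V] (A : NLVA V) : V → V → ℤ → V :=
  fun u v n => mf (A.Y u) v n

/-- Mode maps of a linear map `V → ℰ(W)`. -/
def YWf {V : Type*} [AddCommGroup V] [Module ℂ V] (YW : V →ₗ[ℂ] EW W) :
    V → W → ℤ → W := fun v w n => mf (YW v) w n

/-- `(W, Y_W)` is a quasi module for the nonlocal vertex algebra `A` on `V`. -/
def IsQuasiModule {V : Type*} [AddCommGroup V] [Module ℂ V] (A : NLVA V)
    (YW : V →ₗ[ℂ] EW W) : Prop :=
  (∀ (w : W) (n : ℤ), mf (YW A.one) w n = if n = -1 then w else 0) ∧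
  ∀ (u v : V) (w : W), ∃ f : MvPolynomial (Fin 2) ℂ, f ≠ 0 ∧ ∀ a b : ℤ,
    mulSubPoly f (prodCE (YWf YW) (YWf YW) u v w) a b =
    mulSubPoly f (assocCE (Yf A) (YWf YW) u v w) a b

/-- `(W, Y_W)` is a module for the nonlocal vertex algebra `A` on `V`. -/
def IsModule {V : Type*} [AddCommGroup V] [Module ℂ V] (A : NLVA V)
    (YW : V →ₗ[ℂ] EW W) : Prop :=
  (∀ (w : W) (n : ℤ), mf (YW A.one) w n = if n = -1 then w else 0) ∧
  ∀ (u v : V) (w : W), ∃ l : ℕ, ∀ a b : ℤ,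
    mulSubPoly (MvPolynomial.X 0 ^ l) (prodCE (YWf YW) (YWf YW) u v w) a b =
    mulSubPoly (MvPolynomial.X 0 ^ l) (assocCE (Yf A) (YWf YW) u v w) a b

end NVA

namespace NVA

variable {W : Type*} [AddCommGroup W] [Module ℂ W]
variable {V : Type*} [AddCommGroup V] [Module ℂ V]

/-! ### Pseudo-locality -/

/-- A power series `∑ f n x^n` as a Laurent series. -/
def psN (f : ℕ → ℂ) : LC := HahnSeries.ofPowerSeries ℤ ℂ (PowerSeries.mk f)

/-- `ι_{x₂,x₁}` of a formal power series `F(x₁,x₂) ∈ ℂ[[x₁,x₂]]`, given by its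
coefficient function, as an element of `ℂ((x₂))((x₁))` (outer variable `x₁`). -/
def psEmbed (F : ℕ → ℕ → ℂ) : K2 :=
  HahnSeries.ofPowerSeries ℤ LC (PowerSeries.mk (fun m => psN (F m)))

/-- The coefficient function of a polynomial in two variables. -/
def polyCoeffFun (g : MvPolynomial (Fin 2) ℂ) : ℕ → ℕ → ℂ :=
  fun m t => MvPolynomial.coeff (Finsupp.single 0 m + Finsupp.single 1 t) g

/-- `ι_{x₂,x₁}` of a polynomial in two variables. -/
def polyEmbed (g : MvPolynomial (Fin 2) ℂ) : K2 := psEmbed (polyCoeffFun g)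

/-- The coefficient function of an element of `ℂ((x₂))((x₁))`:
`k2Fun x m t` is the coefficient of `x₁^m x₂^t`. -/
def k2Fun (x : K2) : ℤ → ℤ → ℂ := fun m t => (x.coeff m).coeff t

/-- Multiplication of a two-variable family by a scalar-valued two-variable series. -/
def smulFam (c : ℤ → ℤ → ℂ) (G : ℤ → ℤ → W) : ℤ → ℤ → W :=
  fun m t => ∑ᶠ s : ℤ × ℤ, c s.1 s.2 • G (m - s.1) (t - s.2)

/-- Multiplication of a two-variable family by a Laurent polynomial
`p ∈ ℂ[x₁^{±1}, x₂^{±1}]` (recorded by its finitely supported coefficients). -/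
def mulLPoly (p : (ℤ × ℤ) →₀ ℂ) (G : ℤ → ℤ → W) : ℤ → ℤ → W :=
  fun m t => ∑ d ∈ p.support, p d • G (m - d.1) (t - d.2)

/-- A subset `S ⊆ ℰ(W)` is pseudo-local. -/
def PseudoLocal (S : Set (EW W)) : Prop :=
  ∀ a ∈ S, ∀ b ∈ S, ∃ p : (ℤ × ℤ) →₀ ℂ, p ≠ 0 ∧
    ∃ (r : ℕ) (F : Fin r → (ℕ → ℕ → ℂ)) (g : Fin r → MvPolynomial (Fin 2) ℂ)
      (u v : Fin r → EW W),
      (∀ i, g i ≠ 0) ∧ (∀ i, u i ∈ S) ∧ (∀ i, v i ∈ S) ∧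
      ∀ (w : W) (m t : ℤ),
        mulLPoly p (Fab a b w) m t =
          ∑ i, smulFam (k2Fun (psEmbed (F i) * (polyEmbed (g i))⁻¹))
            (fun m' t' => Fab (u i) (v i) w t' m') m t

/-- The coefficient of `x₁^m x₂^t` in `ι_{x₂,x₁} f(x₂ - x₁)`, for `f(x) ∈ ℂ((x))`. -/
def expandSub (f : LC) : ℤ → ℤ → ℂ :=
  fun m t => if 0 ≤ m then
    ((-1 : ℂ) ^ m.toNat * binom (t + m) m.toNat) * f.coeff (t + m) else 0

/-- A subset `S ⊆ ℰ(W)` is `𝒮`-local. -/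
def SLocal (S : Set (EW W)) : Prop :=
  ∀ a ∈ S, ∀ b ∈ S, ∃ (k : ℕ) (r : ℕ) (f : Fin r → LC) (u v : Fin r → EW W),
    (∀ i, u i ∈ S) ∧ (∀ i, v i ∈ S) ∧
    ∀ (w : W) (m t : ℤ),
      mulPoly ((MvPolynomial.X 0 - MvPolynomial.X 1) ^ k) (Fab a b w) m t =
        ∑ i, mulPoly ((MvPolynomial.X 0 - MvPolynomial.X 1) ^ k)
          (smulFam (expandSub (f i)) (fun m' t' => Fab (u i) (v i) w t' m')) m t

/-- `U` is the nonlocal vertex algebra `⟨S⟩` generated by `S`: the smallest closed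
quasi compatible subspace of `ℰ(W)` containing `S ∪ {1_W}`. -/
def IsGenVA (S : Set (EW W)) (U : Submodule ℂ (EW W)) : Prop :=
  QCSet (U : Set (EW W)) ∧ (∀ a ∈ U, ∀ b ∈ U, ∀ n : ℤ, YE a b n ∈ U) ∧
  oneE ∈ U ∧ S ⊆ U ∧
  ∀ U' : Submodule ℂ (EW W),
    (QCSet (U' : Set (EW W)) ∧ (∀ a ∈ U', ∀ b ∈ U', ∀ n : ℤ, YE a b n ∈ U') ∧
      oneE ∈ U' ∧ S ⊆ (U' : Set (EW W))) → U ≤ U'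

/-! ### 𝒮-locality for maps and weak quantum vertex algebras -/

/-- The `𝒮`-locality identity
`(x₁-x₂)^k Y(u,x₁)Y(v,x₂) = ∑ᵢ (x₁-x₂)^k ι_{x₂,x₁}(fᵢ(x₂-x₁)) Y(vᵢ,x₂)Y(uᵢ,x₁)`
at the level of coefficient families, for mode maps `Ym`. -/
def sLocPair {V : Type*} (Ym : V → W → ℤ → W) (k : ℕ) (u v : V) {r : ℕ}
    (f : Fin r → LC) (vi ui : Fin r → V) : Prop :=
  ∀ (w : W) (m t : ℤ),
    mulPoly ((MvPolynomial.X 0 - MvPolynomial.X 1) ^ k)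
      (fun m' t' => Ym u (Ym v w (-t' - 1)) (-m' - 1)) m t =
    ∑ i, mulPoly ((MvPolynomial.X 0 - MvPolynomial.X 1) ^ k)
      (smulFam (expandSub (f i))
        (fun m' t' => Ym (vi i) (Ym (ui i) w (-m' - 1)) (-t' - 1))) m t

/-- A weak quantum vertex algebra: a nonlocal vertex algebra whose vertex operators
form an `𝒮`-local subspace of `ℰ(V)`. -/
def IsWeakQVA (A : NLVA V) : Prop :=
  ∀ u v : V, ∃ (k : ℕ) (r : ℕ) (f : Fin r → LC) (vi ui : Fin r → V),
    sLocPair (Yf A) k u v f vi ui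

end NVA

namespace NVA

variable {W : Type*} [AddCommGroup W] [Module ℂ W]

/-! ### Families truncated as in `W((x₂))((x₁))` -/

section HahnCoefficients

theorem finite_hahn_conv {R V : Type*} [Zero R] [Zero V] (x : HahnSeries ℤ R)
    (y : HahnSeries ℤ V) (m : ℤ) :
    {i : ℤ | x.coeff i ≠ 0 ∧ y.coeff (m - i) ≠ 0}.Finite := by
  have h := Set.AddAntidiagonal.finite_of_isPWO x.isPWO_support y.isPWO_support m
  refine (h.image Prod.fst).subset ?_
  rintro i ⟨h1, h2⟩
  exact ⟨(i, m - i), ⟨h1, h2, by simp⟩, rfl⟩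

variable {R V : Type*} [Ring R] [AddCommGroup V] [Module R V]

theorem hahnModule_coeff_smul (x : HahnSeries ℤ R) (y : HahnModule ℤ R V) (m : ℤ) :
    ((HahnModule.of R).symm (x • y)).coeff m =
      ∑ᶠ i : ℤ, x.coeff i • ((HahnModule.of R).symm y).coeff (m - i) := by
  rw [HahnModule.coeff_smul]
  have hfin := finite_hahn_conv x ((HahnModule.of R).symm y) m
  rw [finsum_eq_sum_of_support_subset (s := hfin.toFinset)]
  · refine Finset.sum_bij' (fun ij _ => ij.1) (fun i _ => (i, m - i)) ?_ ?_ ?_ ?_ ?_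
    · rintro ⟨i, j⟩ hij
      simp only [Finset.mem_vaddAntidiagonal, HahnSeries.mem_support, vadd_eq_add] at hij
      obtain ⟨h1, h2, rfl⟩ := hij
      simpa using ⟨h1, h2⟩
    · intro i hi
      simpa [Finset.mem_vaddAntidiagonal] using hi
    · rintro ⟨i, j⟩ hij
      simp only [Finset.mem_vaddAntidiagonal, HahnSeries.mem_support, vadd_eq_add] at hij
      obtain ⟨h1, h2, rfl⟩ := hij
      simp
    · intro i hi; rfl
    · rintro ⟨i, j⟩ hij
      simp only [Finset.mem_vaddAntidiagonal, HahnSeries.mem_support, vadd_eq_add] at hij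
      obtain ⟨h1, h2, rfl⟩ := hij
      simp
  · intro i hi
    simp only [Function.mem_support] at hi
    simp only [Set.Finite.coe_toFinset]
    exact ⟨fun h => hi (by simp [h]), fun h => hi (by simp [h])⟩

theorem hahnSeries_coeff_mul (x y : HahnSeries ℤ R) (m : ℤ) :
    (x * y).coeff m = ∑ᶠ i : ℤ, x.coeff i * y.coeff (m - i) := by
  have := hahnModule_coeff_smul x (HahnModule.of R y) m
  rwa [HahnSeries.of_symm_smul_of_eq_mul] at this

end HahnCoefficients

variable (W) in
/-- The vector space `W((x₂))((x₁))` over the field `ℂ((x₂))((x₁))`. -/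
abbrev HM2 : Type _ := HahnModule ℤ LC (HahnModule ℤ ℂ W)

/-- The coefficient of `x₁^m x₂^t`. -/
def toFam (M : HM2 W) (m t : ℤ) : W :=
  ((HahnModule.of ℂ).symm (((HahnModule.of LC).symm M).coeff m)).coeff t

theorem toFam_injective {M M' : HM2 W} (h : ∀ m t, toFam M m t = toFam M' m t) : M = M' := by
  apply HahnModule.ext
  funext m
  apply HahnModule.ext
  funext t
  exact h m t

@[simp] theorem toFam_zero (m t : ℤ) : toFam (0 : HM2 W) m t = 0 := rfl
@[simp] theorem toFam_add (M M' : HM2 W) (m t : ℤ) :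
    toFam (M + M') m t = toFam M m t + toFam M' m t := rfl

/-- Lower truncation in `x₁`, and in `x₂` for every fixed power of `x₁`. -/
def Tr21 (F : ℤ → ℤ → W) : Prop :=
  (∃ N : ℤ, ∀ m t, F m t ≠ 0 → N ≤ m) ∧ ∀ m, ∃ N : ℤ, ∀ t, F m t ≠ 0 → N ≤ t

theorem exists_le_of_isPWO {s : Set ℤ} (hs : s.IsPWO) : ∃ N, ∀ m ∈ s, N ≤ m := by
  rcases s.eq_empty_or_nonempty with h | h
  · exact ⟨0, by simp [h]⟩
  · exact ⟨hs.isWF.min h, fun m hm => hs.isWF.min_le h hm⟩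

theorem isPWO_of_forall_le {s : Set ℤ} {N : ℤ} (h : ∀ m ∈ s, N ≤ m) : s.IsPWO := by
  apply Set.IsWF.isPWO
  exact BddBelow.wellFoundedOn_lt ⟨N, h⟩

theorem tr21_toFam (M : HM2 W) : Tr21 (toFam M) := by
  constructor
  · obtain ⟨N, hN⟩ := exists_le_of_isPWO ((HahnModule.of LC).symm M).isPWO_support
    refine ⟨N, fun m t h => hN m ?_⟩
    rw [HahnSeries.mem_support]
    intro h0
    apply h
    rw [toFam, h0]
    rfl
  · intro m
    obtain ⟨N, hN⟩ := exists_le_of_isPWO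
      ((HahnModule.of ℂ).symm (((HahnModule.of LC).symm M).coeff m)).isPWO_support
    exact ⟨N, fun t h => hN t h⟩

/-- The element of `W((x₂))((x₁))` with given coefficients. -/
def ofFam (F : ℤ → ℤ → W) (h : Tr21 F) : HM2 W :=
  HahnModule.of LC
    { coeff := fun m => HahnModule.of ℂ
        { coeff := F m
          isPWO_support' := isPWO_of_forall_le (h.2 m).choose_spec }
      isPWO_support' := by
        refine isPWO_of_forall_le (N := h.1.choose) ?_
        intro m hm
        by_contra hlt
        apply hm
        apply HahnModule.ext
        funext t
        by_contra ht
        exact hlt (h.1.choose_spec m t ht) }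

@[simp] theorem toFam_ofFam (F : ℤ → ℤ → W) (h : Tr21 F) (m t : ℤ) :
    toFam (ofFam F h) m t = F m t := rfl

/-- Finiteness of the sums computing the product of two families. -/
def FinPair (f : ℤ → ℤ → ℂ) (F : ℤ → ℤ → W) : Prop :=
  ∀ m t, {s : ℤ × ℤ | f s.1 s.2 ≠ 0 ∧ F (m - s.1) (t - s.2) ≠ 0}.Finite

theorem finPair_k2Fun (q : K2) (M : HM2 W) : FinPair (k2Fun q) (toFam M) := by
  intro m t
  have h1 := finite_hahn_conv q ((HahnModule.of LC).symm M) m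
  refine ((h1.biUnion (t := fun i => (fun j => (i, j)) '' {j : ℤ | (q.coeff i).coeff j ≠ 0 ∧
    ((HahnModule.of ℂ).symm (((HahnModule.of LC).symm M).coeff (m - i))).coeff (t - j) ≠ 0})
    fun i _ => (finite_hahn_conv _ _ t).image _)).subset ?_
  rintro ⟨i, j⟩ ⟨hi, hj⟩
  simp only [Set.mem_iUnion]
  refine ⟨i, ⟨fun h => hi ?_, fun h => hj ?_⟩, j, ⟨hi, hj⟩, rfl⟩
  · simp [k2Fun, h]
  · simp only [toFam, h]; rfl

theorem FinPair.finite_support {f : ℤ → ℤ → ℂ} {F : ℤ → ℤ → W} (h : FinPair f F) (m t : ℤ) :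
    (Function.support fun s : ℤ × ℤ => f s.1 s.2 • F (m - s.1) (t - s.2)).Finite := by
  refine (h m t).subset fun s hs => ?_
  rw [Function.mem_support] at hs
  exact ⟨fun h => hs (by simp [h]), fun h => hs (by simp [h])⟩

theorem smulFam_toFam (q : K2) (M : HM2 W) (m t : ℤ) :
    smulFam (k2Fun q) (toFam M) m t = toFam (q • M) m t := by
  rw [smulFam, finsum_curry _ ((finPair_k2Fun q M).finite_support m t), toFam]
  erw [hahnModule_coeff_smul (R := LC) (V := HahnModule ℤ ℂ W) q M m]
  have h1 := finite_hahn_conv q ((HahnModule.of LC).symm M) m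
  have hsub : (Function.support fun i : ℤ => q.coeff i •
      ((HahnModule.of LC).symm M).coeff (m - i)) ⊆ h1.toFinset := by
    intro i hi
    simp only [Function.mem_support] at hi
    simp only [Set.Finite.coe_toFinset]
    exact ⟨fun h => hi (by simp [h]), fun h => hi (by simp [h])⟩
  have hsub2 : (Function.support fun i : ℤ => ∑ᶠ j : ℤ, k2Fun q i j •
      toFam M (m - i) (t - j)) ⊆ h1.toFinset := by
    intro i hi
    simp only [Function.mem_support] at hi
    simp only [Set.Finite.coe_toFinset]
    constructor
    · intro h
      apply hi
      simp [k2Fun, h]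
    · intro h
      apply hi
      rw [finsum_eq_zero_of_forall_eq_zero]
      intro j
      simp only [toFam, h]
      exact smul_zero _
  rw [finsum_eq_sum_of_support_subset _ hsub, finsum_eq_sum_of_support_subset _ hsub2]
  have hev : ∀ (s : Finset ℤ) (g : ℤ → HahnModule ℤ ℂ W),
      ((HahnModule.of ℂ).symm (∑ i ∈ s, g i)).coeff t =
        ∑ i ∈ s, ((HahnModule.of ℂ).symm (g i)).coeff t := by
    intro s g
    induction s using Finset.induction_on with
    | empty => rfl
    | insert a s ha ih => rw [Finset.sum_insert ha, Finset.sum_insert ha, ← ih]; rfl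
  rw [hev]
  refine Finset.sum_congr rfl fun i _ => ?_
  rw [hahnModule_coeff_smul]
  rfl

/-! ### The `ℂ((x₂))((x₁))`-module structure -/

variable (W) in
/-- The scalar action as a module structure over the field `ℂ((x₂))((x₁))`. -/
abbrev hm2Module : Module K2 (HM2 W) := inferInstance

theorem k2_mul_smul (x y : K2) (M : HM2 W) : (x * y) • M = x • y • M :=
  (hm2Module W).mul_smul x y M

theorem k2_one_smul (M : HM2 W) : (1 : K2) • M = M := (hm2Module W).one_smul M

theorem k2_smul_add (x : K2) (M N : HM2 W) : x • (M + N) = x • M + x • N :=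
  (hm2Module W).smul_add x M N

theorem k2_smul_zero (x : K2) : x • (0 : HM2 W) = 0 := (hm2Module W).smul_zero x

theorem k2_inv_mul_cancel {x : K2} (h : x ≠ 0) : x⁻¹ * x = 1 := inv_mul_cancel₀ (G₀ := K2) h

theorem k2_smul_left_cancel {x : K2} (h : x ≠ 0) {M N : HM2 W} (hMN : x • M = x • N) :
    M = N := by
  rw [← k2_one_smul M, ← k2_one_smul N, ← k2_inv_mul_cancel h, k2_mul_smul, k2_mul_smul, hMN]

end NVA

namespace NVA

variable {W : Type*} [AddCommGroup W] [Module ℂ W]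

/-! ### Polynomials acting on families -/

theorem k2Fun_injective {q q' : K2} (h : ∀ m t, k2Fun q m t = k2Fun q' m t) : q = q' := by
  ext m t
  exact h m t

@[simp] theorem k2Fun_zero (m t : ℤ) : k2Fun 0 m t = 0 := rfl

@[simp] theorem k2Fun_add (q q' : K2) (m t : ℤ) :
    k2Fun (q + q') m t = k2Fun q m t + k2Fun q' m t := rfl

theorem coeff_ofPowerSeries {R : Type*} [Semiring R] (f : ℕ → R) (m : ℤ) :
    (HahnSeries.ofPowerSeries ℤ R (PowerSeries.mk f)).coeff m =
      if 0 ≤ m then f m.toNat else 0 := by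
  rw [PowerSeries.coeff_coe]
  by_cases h : 0 ≤ m
  · rw [if_neg (by omega), if_pos h, PowerSeries.coeff_mk]
    congr 1
    omega
  · rw [if_pos (by omega), if_neg h]

theorem k2Fun_psEmbed (F : ℕ → ℕ → ℂ) (m t : ℤ) :
    k2Fun (psEmbed F) m t = if 0 ≤ m ∧ 0 ≤ t then F m.toNat t.toNat else 0 := by
  rw [k2Fun, psEmbed, coeff_ofPowerSeries]
  by_cases hm : 0 ≤ m
  · rw [if_pos hm, psN, coeff_ofPowerSeries]
    simp [hm]
  · rw [if_neg hm, if_neg (by tauto)]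
    rfl

theorem k2Fun_single_single (a b : ℤ) (c : ℂ) (m t : ℤ) :
    k2Fun (HahnSeries.single a (HahnSeries.single b c)) m t = if m = a ∧ t = b then c else 0 := by
  rw [k2Fun, HahnSeries.coeff_single]
  by_cases hm : m = a
  · rw [if_pos hm, HahnSeries.coeff_single]
    simp [hm]
  · rw [if_neg hm, if_neg (by tauto)]
    rfl

theorem xOuter_pow_mul_xInner_pow (a b : ℕ) :
    xOuter ^ a * xInner ^ b = HahnSeries.single (a : ℤ) (HahnSeries.single (b : ℤ) (1 : ℂ)) := by
  rw [xOuter, xInner, HahnSeries.single_pow, HahnSeries.single_pow, HahnSeries.single_mul_single,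
    HahnSeries.single_pow]
  simp

/-- Constants in `ℂ((x₂))((x₁))`. -/
def constK2 : ℂ →+* K2 := (HahnSeries.C : LC →+* K2).comp (HahnSeries.C : ℂ →+* LC)

theorem constK2_apply (c : ℂ) :
    constK2 c = HahnSeries.single 0 (HahnSeries.single 0 c) := rfl

/-- Evaluation of polynomials at two elements of `ℂ((x₂))((x₁))`. -/
def evalK2 (a b : K2) : MvPolynomial (Fin 2) ℂ →+* K2 :=
  MvPolynomial.eval₂Hom constK2 ![a, b]

theorem evalK2_X0 (a b : K2) : evalK2 a b (MvPolynomial.X 0) = a := by simp [evalK2]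
theorem evalK2_X1 (a b : K2) : evalK2 a b (MvPolynomial.X 1) = b := by simp [evalK2]
theorem evalK2_C (a b : K2) (c : ℂ) : evalK2 a b (MvPolynomial.C c) = constK2 c := by
  simp [evalK2]

theorem evalK2_monomial (d : Fin 2 →₀ ℕ) (c : ℂ) :
    evalK2 xOuter xInner (MvPolynomial.monomial d c) =
      HahnSeries.single (d 0 : ℤ) (HahnSeries.single (d 1 : ℤ) c) := by
  rw [evalK2, MvPolynomial.coe_eval₂Hom, MvPolynomial.eval₂_monomial,
    Finsupp.prod_fintype _ _ (by simp)]
  simp only [Fin.prod_univ_two, Matrix.cons_val_zero, Matrix.cons_val_one]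
  rw [xOuter_pow_mul_xInner_pow, constK2_apply, HahnSeries.single_mul_single,
    HahnSeries.single_mul_single]
  simp

theorem single_add_single_eq_iff (d : Fin 2 →₀ ℕ) (m t : ℕ) :
    (Finsupp.single 0 m + Finsupp.single 1 t = d) ↔ (d 0 = m ∧ d 1 = t) := by
  constructor
  · rintro rfl
    simp
  · rintro ⟨rfl, rfl⟩
    ext i
    fin_cases i <;> simp

theorem polyEmbed_add (P Q : MvPolynomial (Fin 2) ℂ) :
    polyEmbed (P + Q) = polyEmbed P + polyEmbed Q := by
  apply k2Fun_injective
  intro m t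
  rw [k2Fun_add]
  simp only [polyEmbed, k2Fun_psEmbed, polyCoeffFun, MvPolynomial.coeff_add]
  split_ifs <;> simp

theorem polyEmbed_monomial (d : Fin 2 →₀ ℕ) (c : ℂ) :
    polyEmbed (MvPolynomial.monomial d c) =
      HahnSeries.single (d 0 : ℤ) (HahnSeries.single (d 1 : ℤ) c) := by
  apply k2Fun_injective
  intro m t
  rw [polyEmbed, k2Fun_psEmbed, k2Fun_single_single]
  simp only [polyCoeffFun, MvPolynomial.coeff_monomial]
  have : (d = Finsupp.single 0 m.toNat + Finsupp.single 1 t.toNat) ↔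
      (d 0 = m.toNat ∧ d 1 = t.toNat) := by rw [← single_add_single_eq_iff, eq_comm]
  simp only [this]
  split_ifs <;> first | rfl | omega

theorem polyEmbed_eq_evalK2 (P : MvPolynomial (Fin 2) ℂ) :
    polyEmbed P = evalK2 xOuter xInner P := by
  induction P using MvPolynomial.induction_on' with
  | monomial d c => rw [polyEmbed_monomial, evalK2_monomial]
  | add P Q hP hQ => rw [polyEmbed_add, hP, hQ, map_add]

theorem polyEmbed_mul (P Q : MvPolynomial (Fin 2) ℂ) :
    polyEmbed (P * Q) = polyEmbed P * polyEmbed Q := by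
  simp only [polyEmbed_eq_evalK2, map_mul]

theorem polyEmbed_one : polyEmbed 1 = 1 := by
  rw [polyEmbed_eq_evalK2, map_one]

theorem polyEmbed_zero : polyEmbed 0 = 0 := by
  rw [polyEmbed_eq_evalK2, map_zero]

theorem polyEmbed_ne_zero {P : MvPolynomial (Fin 2) ℂ} (h : P ≠ 0) : polyEmbed P ≠ 0 := by
  intro h0
  apply h
  ext d
  have := congrArg (fun q => k2Fun q (d 0) (d 1)) h0
  simp only [polyEmbed, k2Fun_psEmbed, polyCoeffFun, k2Fun_zero] at this
  rw [if_pos (by omega), Int.toNat_natCast, Int.toNat_natCast,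
    (single_add_single_eq_iff d _ _).2 ⟨rfl, rfl⟩] at this
  simpa using this

theorem mulPoly_eq_sum (P : MvPolynomial (Fin 2) ℂ) (F : ℤ → ℤ → W) (m t : ℤ) :
    mulPoly P F m t = Finsupp.sum (AddMonoidAlgebra.coeff P)
      (fun d c => c • F (m - d 0) (t - d 1)) := rfl

theorem mulPoly_add_left (P Q : MvPolynomial (Fin 2) ℂ) (F : ℤ → ℤ → W) (m t : ℤ) :
    mulPoly (P + Q) F m t = mulPoly P F m t + mulPoly Q F m t := by
  simp only [mulPoly_eq_sum]
  exact Finsupp.sum_add_index' (by simp) (by intros; rw [add_smul])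

theorem mulPoly_monomial (d : Fin 2 →₀ ℕ) (c : ℂ) (F : ℤ → ℤ → W) (m t : ℤ) :
    mulPoly (MvPolynomial.monomial d c) F m t = c • F (m - d 0) (t - d 1) := by
  rw [mulPoly_eq_sum]
  exact Finsupp.sum_single_index (by simp)

theorem mulPoly_add (P : MvPolynomial (Fin 2) ℂ) (F G : ℤ → ℤ → W) (m t : ℤ) :
    mulPoly P (fun m t => F m t + G m t) m t = mulPoly P F m t + mulPoly P G m t := by
  simp only [mulPoly, smul_add, Finset.sum_add_distrib]

theorem mulPoly_smul (P : MvPolynomial (Fin 2) ℂ) (c : ℂ) (F : ℤ → ℤ → W) (m t : ℤ) :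
    mulPoly P (fun m t => c • F m t) m t = c • mulPoly P F m t := by
  simp only [mulPoly, Finset.smul_sum]
  exact Finset.sum_congr rfl fun d _ => smul_comm _ _ _

theorem mulPoly_zero (P : MvPolynomial (Fin 2) ℂ) (m t : ℤ) :
    mulPoly P (fun _ _ => (0 : W)) m t = 0 := by
  simp [mulPoly]

theorem mulPoly_sum {ι : Type*} (P : MvPolynomial (Fin 2) ℂ) (s : Finset ι)
    (F : ι → ℤ → ℤ → W) (m t : ℤ) :
    mulPoly P (fun m t => ∑ i ∈ s, F i m t) m t = ∑ i ∈ s, mulPoly P (F i) m t := by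
  simp only [mulPoly, Finset.smul_sum]
  exact Finset.sum_comm

theorem mulPoly_mul (P Q : MvPolynomial (Fin 2) ℂ) (F : ℤ → ℤ → W) (m t : ℤ) :
    mulPoly (P * Q) F m t = mulPoly P (mulPoly Q F) m t := by
  induction P using MvPolynomial.induction_on' generalizing m t with
  | add P P' hP hP' => rw [add_mul, mulPoly_add_left, mulPoly_add_left, hP, hP']
  | monomial d c =>
    rw [mulPoly_monomial]
    induction Q using MvPolynomial.induction_on' generalizing m t with
    | add Q Q' hQ hQ' =>
      rw [mul_add, mulPoly_add_left, mulPoly_add_left, hQ, hQ', smul_add]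
    | monomial e c' =>
      rw [MvPolynomial.monomial_mul, mulPoly_monomial, mulPoly_monomial, mul_smul]
      simp only [Finsupp.add_apply, Nat.cast_add, sub_sub]

theorem mulPoly_one (F : ℤ → ℤ → W) (m t : ℤ) : mulPoly 1 F m t = F m t := by
  rw [← MvPolynomial.C_1, ← MvPolynomial.monomial_zero', mulPoly_monomial]
  simp

theorem mulPoly_comm (P Q : MvPolynomial (Fin 2) ℂ) (F : ℤ → ℤ → W) (m t : ℤ) :
    mulPoly P (mulPoly Q F) m t = mulPoly Q (mulPoly P F) m t := by
  rw [← mulPoly_mul, mul_comm, mulPoly_mul]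

theorem k2Fun_polyEmbed_support (P : MvPolynomial (Fin 2) ℂ) :
    {s : ℤ × ℤ | k2Fun (polyEmbed P) s.1 s.2 ≠ 0}.Finite := by
  refine ((P.support.finite_toSet).image (fun d => ((d 0 : ℤ), (d 1 : ℤ)))).subset ?_
  rintro ⟨m, t⟩ h
  simp only [Set.mem_ofPred_eq, polyEmbed, k2Fun_psEmbed, polyCoeffFun] at h
  by_cases hmt : 0 ≤ m ∧ 0 ≤ t
  · rw [if_pos hmt] at h
    refine ⟨Finsupp.single 0 m.toNat + Finsupp.single 1 t.toNat, ?_, ?_⟩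
    · simpa using h
    · simp [hmt.1, hmt.2]
  · exact absurd (if_neg hmt) h

theorem mulPoly_eq_smulFam (P : MvPolynomial (Fin 2) ℂ) (F : ℤ → ℤ → W) (m t : ℤ) :
    mulPoly P F m t = smulFam (k2Fun (polyEmbed P)) F m t := by
  have hfin : ∀ P : MvPolynomial (Fin 2) ℂ, (Function.support fun s : ℤ × ℤ =>
      k2Fun (polyEmbed P) s.1 s.2 • F (m - s.1) (t - s.2)).Finite := fun P =>
    (k2Fun_polyEmbed_support P).subset fun s hs h => hs (by simp [h])
  induction P using MvPolynomial.induction_on' with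
  | add P Q hP hQ =>
    rw [mulPoly_add_left, hP, hQ, smulFam, smulFam, smulFam, ← finsum_add_distrib (hfin P) (hfin Q)]
    simp only [polyEmbed_add, k2Fun_add, add_smul]
  | monomial d c =>
    rw [mulPoly_monomial, smulFam, finsum_eq_single _ ((d 0 : ℤ), (d 1 : ℤ))]
    · rw [polyEmbed_monomial, k2Fun_single_single, if_pos ⟨rfl, rfl⟩]
    · rintro ⟨a, b⟩ h
      rw [polyEmbed_monomial, k2Fun_single_single, if_neg, zero_smul]
      simpa using h

theorem mulPoly_toFam (P : MvPolynomial (Fin 2) ℂ) (M : HM2 W) (m t : ℤ) :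
    mulPoly P (toFam M) m t = toFam (polyEmbed P • M) m t := by
  rw [mulPoly_eq_smulFam, smulFam_toFam]

end NVA

namespace NVA

variable {W : Type*} [AddCommGroup W] [Module ℂ W]

/-! ### Binomial coefficients -/

theorem binom_eq_choose (m : ℤ) (j : ℕ) : binom m j = Ring.choose (m : ℂ) j := by
  rw [Ring.choose_eq_smul, binom, smul_eq_mul, div_eq_inv_mul]
  congr 1
  rw [← descPochhammer_eval_eq_prod_range, ← Polynomial.aeval_eq_smeval,
    ← descPochhammer_map (Int.castRingHom ℂ), Polynomial.aeval_def, Polynomial.eval_map]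
  rfl

theorem binom_add (a b : ℤ) (j : ℕ) :
    binom (a + b) j =
      ∑ ik ∈ Finset.HasAntidiagonal.antidiagonal j, binom a ik.1 * binom b ik.2 := by
  simp only [binom_eq_choose, Int.cast_add]
  exact Ring.add_choose_eq j (Commute.all _ _)

@[simp] theorem binom_zero_right (m : ℤ) : binom m 0 = 1 := by simp [binom]

theorem binom_succ_left (m : ℤ) (j : ℕ) :
    binom (m + 1) (j + 1) = binom m (j + 1) + binom m j := by
  simp only [binom_eq_choose, Int.cast_add, Int.cast_one]
  rw [Ring.choose_succ_succ, add_comm]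

theorem binom_mul_sub (m : ℤ) (j : ℕ) :
    binom m (j + 1) * (j + 1) = binom m j * (m - j) := by
  rw [binom, binom, Finset.prod_range_succ, Nat.factorial_succ]
  have : (j.factorial : ℂ) ≠ 0 := by exact_mod_cast j.factorial_ne_zero
  have h2 : (j : ℂ) + 1 ≠ 0 := by exact_mod_cast j.succ_ne_zero
  push_cast
  field_simp

theorem binom_natCast (n k : ℕ) : binom n k = (n.choose k : ℂ) := by
  rw [binom_eq_choose]
  exact_mod_cast Ring.choose_natCast (R := ℂ) n k

/-! ### Taylor coefficients on the diagonal -/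

/-- The coefficient families of `(1/j!) ∂^j/∂y^j G(y, x) |_{y = x}`. -/
def taylor (j : ℕ) (G : ℤ → ℤ → W) (t : ℤ) : W :=
  ∑ᶠ m : ℤ, binom m j • G m (t + j - m)

/-- The divided derivative `(1/k!) ∂^k/∂x₁^k`. -/
def dd (k : ℕ) (f : ℤ → ℤ → ℂ) (α β : ℤ) : ℂ := binom (α + k) k * f (α + k) β

/-- The finiteness making the diagonal restriction of a three-variable family meaningful. -/
def LinesFin (H : ℤ → ℤ → ℤ → W) : Prop := ∀ t s, {m : ℤ | H m (t - m) s ≠ 0}.Finite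

/-- Diagonal Taylor coefficients in the first two of three variables `y, x, z`. -/
def taylor3 (j : ℕ) (H : ℤ → ℤ → ℤ → W) (t s : ℤ) : W := taylor j (fun m t => H m t s) t

/-- Multiplication of a three-variable family by a series in the first and third variables. -/
def mul13 (f : ℤ → ℤ → ℂ) (H : ℤ → ℤ → ℤ → W) (m t s : ℤ) : W :=
  smulFam f (fun m s => H m t s) m s

/-- Multiplication of a three-variable family by a series in the last two variables. -/
def mul23 (f : ℤ → ℤ → ℂ) (H : ℤ → ℤ → ℤ → W) (m t s : ℤ) : W :=
  smulFam f (fun t s => H m t s) t s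

/-- Multiplication of a three-variable family by a polynomial in the first two variables. -/
def mul12 (p : MvPolynomial (Fin 2) ℂ) (H : ℤ → ℤ → ℤ → W) (m t s : ℤ) : W :=
  mulPoly p (fun m t => H m t s) m t

/-- Finiteness for the Leibniz rule for `mul13`. -/
def Fin13 (f : ℤ → ℤ → ℂ) (H : ℤ → ℤ → ℤ → W) : Prop :=
  ∀ t s, {a : ℤ × (ℤ × ℤ) | f a.2.1 a.2.2 ≠ 0 ∧ H (a.1 - a.2.1) (t - a.1) (s - a.2.2) ≠ 0}.Finite

/-- Finiteness for the linearity of `taylor3` over series in the last two variables. -/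
def Fin23 (f : ℤ → ℤ → ℂ) (H : ℤ → ℤ → ℤ → W) : Prop :=
  ∀ t s, {a : ℤ × (ℤ × ℤ) | f a.2.1 a.2.2 ≠ 0 ∧ H a.1 (t - a.1 - a.2.1) (s - a.2.2) ≠ 0}.Finite

theorem finsum_comm_of_finite {α β M : Type*} [AddCommMonoid M] (F : α → β → M)
    (h : (Function.support fun a : α × β => F a.1 a.2).Finite) :
    ∑ᶠ a, ∑ᶠ b, F a b = ∑ᶠ b, ∑ᶠ a, F a b := by
  rw [← finsum_curry (fun a : α × β => F a.1 a.2) h,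
    ← finsum_comp_equiv (Equiv.prodComm β α)]
  refine finsum_curry (fun a : β × α => F a.2 a.1) ?_
  exact (h.preimage (Equiv.prodComm β α).injective.injOn)

theorem taylor3_mul23 {f : ℤ → ℤ → ℂ} {H : ℤ → ℤ → ℤ → W} (h : Fin23 f H) (j : ℕ) (t s : ℤ) :
    taylor3 j (mul23 f H) t s = smulFam f (taylor3 j H) t s := by
  simp only [taylor3, taylor, mul23, smulFam, smul_finsum]
  rw [finsum_comm_of_finite]
  · refine finsum_congr fun a => finsum_congr fun m => ?_
    rw [smul_comm, show t + j - m - a.1 = t - a.1 + j - m by ring]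
  · refine (h (t + j) s).subset ?_
    rintro ⟨m, a⟩ ha
    simp only [Function.mem_support] at ha
    exact ⟨fun h => ha (by simp [h]), fun h => ha (by simp [h])⟩

theorem taylor3_mul13 {f : ℤ → ℤ → ℂ} {H : ℤ → ℤ → ℤ → W} (h : Fin13 f H) (j : ℕ) (t s : ℤ) :
    taylor3 j (mul13 f H) t s =
      ∑ ik ∈ Finset.HasAntidiagonal.antidiagonal j, smulFam (dd ik.1 f) (taylor3 ik.2 H) t s := by
  have hsupp : ∀ c : ℤ → ℤ × ℤ → ℂ, (Function.support fun a : ℤ × (ℤ × ℤ) =>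
      c a.1 a.2 • f a.2.1 a.2.2 • H (a.1 - a.2.1) (t + j - a.1) (s - a.2.2)).Finite := by
    intro c
    refine (h (t + j) s).subset ?_
    rintro ⟨m, a⟩ ha
    simp only [Function.mem_support] at ha
    exact ⟨fun h => ha (by simp [h]), fun h => ha (by simp [h])⟩
  have hterm : ∀ ik ∈ Finset.HasAntidiagonal.antidiagonal j,
      smulFam (dd ik.1 f) (taylor3 ik.2 H) t s =
      ∑ᶠ a : ℤ × (ℤ × ℤ), (binom a.2.1 ik.1 * binom (a.1 - a.2.1) ik.2) •
        f a.2.1 a.2.2 • H (a.1 - a.2.1) (t + j - a.1) (s - a.2.2) := by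
    intro ik hik
    have hj : (j : ℤ) = ik.1 + ik.2 := by
      rw [← Finset.HasAntidiagonal.mem_antidiagonal.1 hik]; push_cast; ring
    rw [finsum_curry _ (hsupp fun m a => binom a.1 ik.1 * binom (m - a.1) ik.2),
      finsum_comm_of_finite _ (hsupp fun m a => binom a.1 ik.1 * binom (m - a.1) ik.2),
      ← finsum_comp_equiv ((Equiv.addRight (ik.1 : ℤ)).prodCongr (Equiv.refl ℤ)), smulFam]
    refine finsum_congr fun a => ?_
    rw [taylor3, taylor, smul_finsum]
    conv_rhs => rw [← finsum_comp_equiv (Equiv.addRight (a.1 + ik.1 : ℤ))]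
    refine finsum_congr fun m => ?_
    simp only [dd, Equiv.prodCongr_apply, Equiv.coe_addRight, Equiv.coe_refl, Prod.map_fst,
      Prod.map_snd, id_eq, smul_smul, add_sub_cancel_right]
    congr 1
    · ring
    · congr 1
      rw [hj]; ring
  rw [Finset.sum_congr rfl hterm, ← finsum_sum_comm _
    (fun (a : ℤ × (ℤ × ℤ)) (x : ℕ × ℕ) => (binom a.2.1 x.1 * binom (a.1 - a.2.1) x.2) •
      f a.2.1 a.2.2 • H (a.1 - a.2.1) (t + j - a.1) (s - a.2.2))
    fun ik _ => hsupp fun m a => binom a.1 ik.1 * binom (m - a.1) ik.2]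
  simp only [← Finset.sum_smul, ← binom_add, add_sub_cancel]
  rw [finsum_curry _ (hsupp fun m _ => binom m j)]
  simp only [taylor3, taylor, mul13, smulFam, smul_finsum]

theorem taylor3_add {H H' : ℤ → ℤ → ℤ → W} (h : LinesFin H) (h' : LinesFin H') (j : ℕ)
    (t s : ℤ) : taylor3 j (fun m t s => H m t s + H' m t s) t s =
      taylor3 j H t s + taylor3 j H' t s := by
  simp only [taylor3, taylor, smul_add]
  refine finsum_add_distrib ((h (t + j) s).subset ?_) ((h' (t + j) s).subset ?_) <;>
  · intro m hm h0
    exact hm (by simp [h0])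

theorem taylor3_zero (j : ℕ) (t s : ℤ) : taylor3 j (fun _ _ _ => (0 : W)) t s = 0 := by
  simp [taylor3, taylor]

theorem mul12_mul23 {f : ℤ → ℤ → ℂ} {H : ℤ → ℤ → ℤ → W} (p : MvPolynomial (Fin 2) ℂ)
    (hH : ∀ m, FinPair f (H m)) : mul12 p (mul23 f H) = mul23 f (mul12 p H) := by
  funext m t s
  simp only [mul12, mul23, mulPoly, smulFam, smul_finsum]
  rw [← finsum_sum_comm]
  · refine finsum_congr fun δ => ?_
    rw [Finset.smul_sum]
    refine Finset.sum_congr rfl fun d _ => ?_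
    rw [smul_comm, sub_right_comm]
  · intro d _
    refine ((hH (m - d 0)).finite_support (t - d 1) s).subset ?_
    intro δ hδ h0
    exact hδ (by simp only [] at h0; simp [h0])

theorem mul12_mul13 {f : ℤ → ℤ → ℂ} {H : ℤ → ℤ → ℤ → W} (p : MvPolynomial (Fin 2) ℂ)
    (hH : ∀ t, FinPair f (fun m s => H m t s)) : mul12 p (mul13 f H) = mul13 f (mul12 p H) := by
  funext m t s
  simp only [mul12, mul13, mulPoly, smulFam, smul_finsum]
  rw [← finsum_sum_comm]
  · refine finsum_congr fun δ => ?_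
    rw [Finset.smul_sum]
    refine Finset.sum_congr rfl fun d _ => ?_
    rw [smul_comm, sub_right_comm]
  · intro d _
    refine ((hH (t - d 1)).finite_support (m - d 0) s).subset ?_
    intro δ hδ h0
    exact hδ (by simp only [] at h0; simp [h0])

end NVA

namespace NVA

variable {W : Type*} [AddCommGroup W] [Module ℂ W]

/-! ### Truncation conditions on three-variable families -/

theorem exists_of_smulFam_ne_zero {f : ℤ → ℤ → ℂ} {G : ℤ → ℤ → W} {m t : ℤ}
    (h : smulFam f G m t ≠ 0) : ∃ a b, f a b ≠ 0 ∧ G (m - a) (t - b) ≠ 0 := by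
  by_contra! hc
  apply h
  refine finsum_eq_zero_of_forall_eq_zero fun s => ?_
  by_cases hs : f s.1 s.2 = 0
  · rw [hs, zero_smul]
  · rw [hc _ _ hs, smul_zero]

theorem finite_of_finite_fibers {α β : Type*} {s : Set (α × β)} (u : Set α) (hu : u.Finite)
    (h1 : ∀ a ∈ s, a.1 ∈ u) (h2 : ∀ a, {b | (a, b) ∈ s}.Finite) : s.Finite := by
  refine (hu.biUnion (t := fun a => (fun b => (a, b)) '' {b | (a, b) ∈ s})
    fun a _ => (h2 a).image _).subset ?_
  rintro ⟨a, b⟩ hab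
  simp only [Set.mem_iUnion]
  exact ⟨a, h1 _ hab, b, hab, rfl⟩

theorem exists_lower_bound_Icc (g : ℤ → ℤ) (a b : ℤ) : ∃ N, ∀ i, a ≤ i → i ≤ b → N ≤ g i := by
  obtain ⟨N, hN⟩ := ((Set.finite_Icc a b).image g).bddBelow
  exact ⟨N, fun i h1 h2 => hN ⟨i, ⟨h1, h2⟩, rfl⟩⟩

theorem finite_of_bounds {s : Set ℤ} (a b : ℤ) (h : ∀ i ∈ s, a ≤ i ∧ i ≤ b) : s.Finite :=
  (Set.finite_Icc a b).subset h

/-- Jointly lower truncated in `y, x`, and lower truncated in `z` for given powers of `y, x`. -/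
def TruncYX (H : ℤ → ℤ → ℤ → W) : Prop :=
  (∃ N, ∀ m t s, H m t s ≠ 0 → N ≤ m ∧ N ≤ t) ∧ ∀ m t, ∃ N, ∀ s, H m t s ≠ 0 → N ≤ s

/-- Lower truncated in `z`, and jointly lower truncated in `y, x` for a given power of `z`. -/
def TruncZ (H : ℤ → ℤ → ℤ → W) : Prop :=
  (∃ N, ∀ m t s, H m t s ≠ 0 → N ≤ s) ∧ ∀ s, ∃ N, ∀ m t, H m t s ≠ 0 → N ≤ m ∧ N ≤ t

/-- `Tr21` with the roles of the two variables exchanged. -/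
def Tr12 (f : ℤ → ℤ → W) : Prop := Tr21 fun a b => f b a

/-- A class `B` of three-variable families, stable under multiplication by series from a
class `A`, on which the diagonal Taylor coefficients behave well. -/
structure TaylorClass (A : (ℤ → ℤ → ℂ) → Prop) (B : (ℤ → ℤ → ℤ → W) → Prop) : Prop where
  mul13_mem : ∀ f H, A f → B H → B (mul13 f H)
  mul23_mem : ∀ f H, A f → B H → B (mul23 f H)
  fin13 : ∀ f H, A f → B H → Fin13 f H
  fin23 : ∀ f H, A f → B H → Fin23 f H
  lines : ∀ H, B H → LinesFin H
  add_mem : ∀ H H', B H → B H' → B (fun m t s => H m t s + H' m t s)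
  zero_mem : B (fun _ _ _ => 0)

theorem taylorClass_truncYX : TaylorClass Tr21 (TruncYX (W := W)) where
  mul13_mem := by
    rintro f H ⟨⟨M, hM⟩, hM'⟩ ⟨⟨N, hN⟩, hN'⟩
    refine ⟨⟨min (M + N) N, fun m t s h => ?_⟩, fun m t => ?_⟩
    · obtain ⟨a, b, h1, h2⟩ := exists_of_smulFam_ne_zero h
      have := hM _ _ h1
      have := hN _ _ _ h2
      omega
    · choose g hg using hM'
      choose k hk using hN'
      obtain ⟨L, hL⟩ := exists_lower_bound_Icc (fun i => g i + k (m - i) t) M (m - N)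
      refine ⟨L, fun s h => ?_⟩
      obtain ⟨a, b, h1, h2⟩ := exists_of_smulFam_ne_zero h
      have := hM _ _ h1
      have := hN _ _ _ h2
      have := hL a (by omega) (by omega)
      have := hg _ _ h1
      have := hk _ _ _ h2
      omega
  mul23_mem := by
    rintro f H ⟨⟨M, hM⟩, hM'⟩ ⟨⟨N, hN⟩, hN'⟩
    refine ⟨⟨min (M + N) N, fun m t s h => ?_⟩, fun m t => ?_⟩
    · obtain ⟨a, b, h1, h2⟩ := exists_of_smulFam_ne_zero h
      have := hM _ _ h1
      have := hN _ _ _ h2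
      omega
    · choose g hg using hM'
      choose k hk using hN'
      obtain ⟨L, hL⟩ := exists_lower_bound_Icc (fun i => g i + k m (t - i)) M (t - N)
      refine ⟨L, fun s h => ?_⟩
      obtain ⟨a, b, h1, h2⟩ := exists_of_smulFam_ne_zero h
      have := hM _ _ h1
      have := hN _ _ _ h2
      have := hL a (by omega) (by omega)
      have := hg _ _ h1
      have := hk _ _ _ h2
      omega
  fin13 := by
    rintro f H ⟨⟨M, hM⟩, hM'⟩ ⟨⟨N, hN⟩, hN'⟩ t s
    refine finite_of_finite_fibers (Set.Icc (M + N) (t - N)) (Set.finite_Icc _ _) ?_ fun m => ?_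
    · rintro ⟨m, a, b⟩ ⟨h1, h2⟩
      have := hM _ _ h1
      have := hN _ _ _ h2
      simp only at *
      exact ⟨by omega, by omega⟩
    · refine finite_of_finite_fibers (Set.Icc M (m - N)) (Set.finite_Icc _ _) ?_ fun a => ?_
      · rintro ⟨a, b⟩ ⟨h1, h2⟩
        have := hM _ _ h1
        have := hN _ _ _ h2
        simp only at *
        exact ⟨by omega, by omega⟩
      · obtain ⟨L, hL⟩ := hM' a
        obtain ⟨K, hK⟩ := hN' (m - a) (t - m)
        refine finite_of_bounds L (s - K) ?_
        rintro b ⟨h1, h2⟩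
        have := hL _ h1
        have := hK _ h2
        simp only at *
        omega
  fin23 := by
    rintro f H ⟨⟨M, hM⟩, hM'⟩ ⟨⟨N, hN⟩, hN'⟩ t s
    refine finite_of_finite_fibers (Set.Icc N (t - N - M)) (Set.finite_Icc _ _) ?_ fun m => ?_
    · rintro ⟨m, a, b⟩ ⟨h1, h2⟩
      have := hM _ _ h1
      have := hN _ _ _ h2
      simp only at *
      exact ⟨by omega, by omega⟩
    · refine finite_of_finite_fibers (Set.Icc M (t - m - N)) (Set.finite_Icc _ _) ?_ fun a => ?_
      · rintro ⟨a, b⟩ ⟨h1, h2⟩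
        have := hM _ _ h1
        have := hN _ _ _ h2
        simp only at *
        exact ⟨by omega, by omega⟩
      · obtain ⟨L, hL⟩ := hM' a
        obtain ⟨K, hK⟩ := hN' m (t - m - a)
        refine finite_of_bounds L (s - K) ?_
        rintro b ⟨h1, h2⟩
        have := hL _ h1
        have := hK _ h2
        simp only at *
        omega
  lines := by
    rintro H ⟨⟨N, hN⟩, hN'⟩ t s
    refine finite_of_bounds N (t - N) fun m hm => ?_
    have := hN _ _ _ hm
    omega
  add_mem := by
    rintro H H' ⟨⟨N, hN⟩, hN'⟩ ⟨⟨M, hM⟩, hM'⟩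
    have key : ∀ m t s, H m t s + H' m t s ≠ 0 → H m t s ≠ 0 ∨ H' m t s ≠ 0 := by
      intro m t s h
      by_contra! hc
      exact h (by rw [hc.1, hc.2, add_zero])
    refine ⟨⟨min N M, fun m t s h => ?_⟩, fun m t => ?_⟩
    · rcases key _ _ _ h with h | h
      · have := hN _ _ _ h; omega
      · have := hM _ _ _ h; omega
    · obtain ⟨L, hL⟩ := hN' m t
      obtain ⟨K, hK⟩ := hM' m t
      refine ⟨min L K, fun s h => ?_⟩
      rcases key _ _ _ h with h | h
      · have := hL _ h; omega
      · have := hK _ h; omega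
  zero_mem := ⟨⟨0, fun _ _ _ h => absurd rfl h⟩, fun _ _ => ⟨0, fun _ h => absurd rfl h⟩⟩

theorem taylorClass_truncZ : TaylorClass Tr12 (TruncZ (W := W)) where
  mul13_mem := by
    rintro f H ⟨⟨M, hM⟩, hM'⟩ ⟨⟨N, hN⟩, hN'⟩
    refine ⟨⟨M + N, fun m t s h => ?_⟩, fun s => ?_⟩
    · obtain ⟨a, b, h1, h2⟩ := exists_of_smulFam_ne_zero h
      have := hM _ _ h1
      have := hN _ _ _ h2
      omega
    · choose g hg using hM'
      choose k hk using hN'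
      obtain ⟨L, hL⟩ := exists_lower_bound_Icc
        (fun i => min (g i + k (s - i)) (k (s - i))) M (s - N)
      refine ⟨L, fun m t h => ?_⟩
      obtain ⟨a, b, h1, h2⟩ := exists_of_smulFam_ne_zero h
      have := hM _ _ h1
      have := hN _ _ _ h2
      have := hL b (by omega) (by omega)
      have := hg _ _ h1
      have := hk _ _ _ h2
      omega
  mul23_mem := by
    rintro f H ⟨⟨M, hM⟩, hM'⟩ ⟨⟨N, hN⟩, hN'⟩
    refine ⟨⟨M + N, fun m t s h => ?_⟩, fun s => ?_⟩
    · obtain ⟨a, b, h1, h2⟩ := exists_of_smulFam_ne_zero h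
      have := hM _ _ h1
      have := hN _ _ _ h2
      omega
    · choose g hg using hM'
      choose k hk using hN'
      obtain ⟨L, hL⟩ := exists_lower_bound_Icc
        (fun i => min (g i + k (s - i)) (k (s - i))) M (s - N)
      refine ⟨L, fun m t h => ?_⟩
      obtain ⟨a, b, h1, h2⟩ := exists_of_smulFam_ne_zero h
      have := hM _ _ h1
      have := hN _ _ _ h2
      have := hL b (by omega) (by omega)
      have := hg _ _ h1
      have := hk _ _ _ h2
      omega
  fin13 := by
    rintro f H ⟨⟨M, hM⟩, hM'⟩ ⟨⟨N, hN⟩, hN'⟩ t s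
    suffices h : {a : ℤ × (ℤ × ℤ) | f a.2.2 a.1 ≠ 0 ∧
        H (a.2.1 - a.2.2) (t - a.2.1) (s - a.1) ≠ 0}.Finite by
      refine (h.image fun a => (a.2.1, a.2.2, a.1)).subset ?_
      rintro ⟨m, a, b⟩ h
      exact ⟨(b, m, a), h, rfl⟩
    refine finite_of_finite_fibers (Set.Icc M (s - N)) (Set.finite_Icc _ _) ?_ fun b => ?_
    · rintro ⟨b, m, a⟩ ⟨h1, h2⟩
      have := hM _ _ h1
      have := hN _ _ _ h2
      simp only at *
      exact ⟨by omega, by omega⟩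
    · obtain ⟨L, hL⟩ := hM' b
      obtain ⟨K, hK⟩ := hN' (s - b)
      refine finite_of_finite_fibers (Set.Icc (L + K) (t - K)) (Set.finite_Icc _ _) ?_ fun m => ?_
      · rintro ⟨m, a⟩ ⟨h1, h2⟩
        have := hL _ h1
        have := hK _ _ h2
        simp only at *
        exact ⟨by omega, by omega⟩
      · refine finite_of_bounds L (m - K) ?_
        rintro a ⟨h1, h2⟩
        have := hL _ h1
        have := hK _ _ h2
        simp only at *
        omega
  fin23 := by
    rintro f H ⟨⟨M, hM⟩, hM'⟩ ⟨⟨N, hN⟩, hN'⟩ t s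
    suffices h : {a : ℤ × (ℤ × ℤ) | f a.2.2 a.1 ≠ 0 ∧
        H a.2.1 (t - a.2.1 - a.2.2) (s - a.1) ≠ 0}.Finite by
      refine (h.image fun a => (a.2.1, a.2.2, a.1)).subset ?_
      rintro ⟨m, a, b⟩ h
      exact ⟨(b, m, a), h, rfl⟩
    refine finite_of_finite_fibers (Set.Icc M (s - N)) (Set.finite_Icc _ _) ?_ fun b => ?_
    · rintro ⟨b, m, a⟩ ⟨h1, h2⟩
      have := hM _ _ h1
      have := hN _ _ _ h2
      simp only at *
      exact ⟨by omega, by omega⟩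
    · obtain ⟨L, hL⟩ := hM' b
      obtain ⟨K, hK⟩ := hN' (s - b)
      refine finite_of_finite_fibers (Set.Icc K (t - K - L)) (Set.finite_Icc _ _) ?_ fun m => ?_
      · rintro ⟨m, a⟩ ⟨h1, h2⟩
        have := hL _ h1
        have := hK _ _ h2
        simp only at *
        exact ⟨by omega, by omega⟩
      · refine finite_of_bounds L (t - m - K) ?_
        rintro a ⟨h1, h2⟩
        have := hL _ h1
        have := hK _ _ h2
        simp only at *
        omega
  lines := by
    rintro H ⟨⟨N, hN⟩, hN'⟩ t s
    obtain ⟨K, hK⟩ := hN' s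
    refine finite_of_bounds K (t - K) fun m hm => ?_
    have := hK _ _ hm
    omega
  add_mem := by
    rintro H H' ⟨⟨N, hN⟩, hN'⟩ ⟨⟨M, hM⟩, hM'⟩
    have key : ∀ m t s, H m t s + H' m t s ≠ 0 → H m t s ≠ 0 ∨ H' m t s ≠ 0 := by
      intro m t s h
      by_contra! hc
      exact h (by rw [hc.1, hc.2, add_zero])
    refine ⟨⟨min N M, fun m t s h => ?_⟩, fun s => ?_⟩
    · rcases key _ _ _ h with h | h
      · have := hN _ _ _ h; omega
      · have := hM _ _ _ h; omega
    · obtain ⟨L, hL⟩ := hN' s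
      obtain ⟨K, hK⟩ := hM' s
      refine ⟨min L K, fun m t h => ?_⟩
      rcases key _ _ _ h with h | h
      · have := hL _ _ h; omega
      · have := hK _ _ h; omega
  zero_mem := ⟨⟨0, fun _ _ _ h => absurd rfl h⟩, fun _ => ⟨0, fun _ _ h => absurd rfl h⟩⟩

/-- Finitely supported two-variable series. -/
def FinSupp (f : ℤ → ℤ → ℂ) : Prop := {a : ℤ × ℤ | f a.1 a.2 ≠ 0}.Finite

theorem FinSupp.finPair {V : Type*} [AddCommGroup V] {f : ℤ → ℤ → ℂ} (hf : FinSupp f)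
    (F : ℤ → ℤ → V) : FinPair f F :=
  fun _ _ => hf.subset fun _ h => h.1

theorem FinSupp.dd {f : ℤ → ℤ → ℂ} (hf : FinSupp f) (k : ℕ) : FinSupp (dd k f) := by
  refine (hf.image fun a => (a.1 - (k : ℤ), a.2)).subset ?_
  rintro ⟨a, b⟩ h
  refine ⟨(a + k, b), fun h0 => h ?_, by simp⟩
  simp only at h0
  simp [NVA.dd, h0]

theorem taylorClass_linesFin : TaylorClass FinSupp (LinesFin (W := W)) where
  mul13_mem := by
    intro f H hf hH t s
    refine (hf.biUnion (t := fun a => (fun m => m + a.1) ''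
      {m | H m (t - a.1 - m) (s - a.2) ≠ 0}) fun a _ => (hH _ _).image _).subset ?_
    intro m hm
    obtain ⟨a, b, h1, h2⟩ := exists_of_smulFam_ne_zero hm
    simp only [Set.mem_iUnion]
    refine ⟨(a, b), h1, m - a, ?_, by simp⟩
    simp only [Set.mem_ofPred_eq]
    rwa [show t - a - (m - a) = t - m by ring]
  mul23_mem := by
    intro f H hf hH t s
    refine (hf.biUnion (t := fun a => {m | H m (t - a.1 - m) (s - a.2) ≠ 0})
      fun a _ => hH _ _).subset ?_
    intro m hm
    obtain ⟨a, b, h1, h2⟩ := exists_of_smulFam_ne_zero hm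
    simp only [Set.mem_iUnion]
    refine ⟨(a, b), h1, ?_⟩
    simp only [Set.mem_ofPred_eq]
    rwa [sub_right_comm]
  fin13 := by
    intro f H hf hH t s
    refine (hf.biUnion (t := fun a => (fun m => (m + a.1, a)) ''
      {m | H m (t - a.1 - m) (s - a.2) ≠ 0}) fun a _ => (hH _ _).image _).subset ?_
    rintro ⟨m, a, b⟩ ⟨h1, h2⟩
    simp only [Set.mem_iUnion]
    refine ⟨(a, b), h1, m - a, ?_, by simp⟩
    simp only [Set.mem_ofPred_eq]
    rwa [show t - a - (m - a) = t - m by ring]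
  fin23 := by
    intro f H hf hH t s
    refine (hf.biUnion (t := fun a => (fun m => (m, a)) ''
      {m | H m (t - a.1 - m) (s - a.2) ≠ 0}) fun a _ => (hH _ _).image _).subset ?_
    rintro ⟨m, a, b⟩ ⟨h1, h2⟩
    simp only [Set.mem_iUnion]
    refine ⟨(a, b), h1, m, ?_, rfl⟩
    simp only [Set.mem_ofPred_eq]
    rwa [sub_right_comm]
  lines := fun _ h => h
  add_mem := by
    intro H H' h h' t s
    refine ((h t s).union (h' t s)).subset fun m hm => ?_
    by_contra hc
    simp only [Set.mem_union, Set.mem_ofPred_eq, not_or, not_not] at hc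
    refine hm ?_
    change H m (t - m) s + H' m (t - m) s = 0
    rw [hc.1, hc.2, add_zero]
  zero_mem := by
    intro t s
    simp

end NVA

namespace NVA

variable {W : Type*} [AddCommGroup W] [Module ℂ W]

/-! ### The substitution `x₁ = x + x₀` -/

theorem IsLaurent2.mulPoly {G : ℤ → ℤ → W} (h : IsLaurent2 G) (p : MvPolynomial (Fin 2) ℂ) :
    IsLaurent2 (mulPoly p G) := by
  obtain ⟨N, hN⟩ := h
  refine ⟨N, fun m t hmt => Finset.sum_eq_zero fun d _ => ?_⟩
  rw [hN _ _ (by omega), smul_zero]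

theorem IsLaurent2.finite_line {V : Type*} [AddCommGroup V] {G : ℤ → ℤ → V}
    (h : IsLaurent2 G) (t : ℤ) :
    {m | G m (t - m) ≠ 0}.Finite := by
  obtain ⟨N, hN⟩ := h
  refine finite_of_bounds N (t - N) fun m hm => ?_
  by_contra hc
  exact hm (hN _ _ (by omega))

theorem taylor_finite_support {G : ℤ → ℤ → W} (h : IsLaurent2 G) (c : ℤ → ℂ) (t : ℤ) :
    (Function.support fun m => c m • G m (t - m)).Finite := by
  refine (h.finite_line t).subset fun m hm h0 => hm ?_
  simp only [h0, smul_zero]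

theorem taylor_add {G G' : ℤ → ℤ → W} (h : IsLaurent2 G) (h' : IsLaurent2 G') (j : ℕ) (t : ℤ) :
    taylor j (fun m t => G m t + G' m t) t = taylor j G t + taylor j G' t := by
  simp only [taylor, smul_add]
  exact finsum_add_distrib (taylor_finite_support h _ _) (taylor_finite_support h' _ _)

theorem taylor_smul (c : ℂ) (G : ℤ → ℤ → W) (j : ℕ) (t : ℤ) :
    taylor j (fun m t => c • G m t) t = c • taylor j G t := by
  simp only [taylor, smul_finsum]
  exact finsum_congr fun m => smul_comm _ _ _

/-- The coefficients of `G(x + x₀, x)`, the outer variable being `x₀`. -/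
def subst (G : ℤ → ℤ → W) (J T : ℤ) : W := if 0 ≤ J then taylor J.toNat G T else 0

theorem tr21_subst {G : ℤ → ℤ → W} (h : IsLaurent2 G) : Tr21 (subst G) := by
  refine ⟨⟨0, fun J T hJ => ?_⟩, fun J => ?_⟩
  · by_contra hc
    exact hJ (if_neg hc)
  · obtain ⟨N, hN⟩ := h
    refine ⟨2 * N - J.toNat, fun T hT => ?_⟩
    by_contra hc
    apply hT
    rw [subst]
    split_ifs
    · refine finsum_eq_zero_of_forall_eq_zero fun m => ?_
      rw [hN _ _ (by omega), smul_zero]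
    · rfl

theorem subst_mulPoly_X1 (G : ℤ → ℤ → W) (J T : ℤ) :
    subst (mulPoly (MvPolynomial.X 1) G) J T = subst G J (T - 1) := by
  have : ∀ m t, mulPoly (MvPolynomial.X 1) G m t = G m (t - 1) := fun m t => by
    rw [MvPolynomial.X, mulPoly_monomial]; simp
  simp only [subst, taylor, this]
  congr 1
  refine finsum_congr fun m => ?_
  congr 2; ring

theorem subst_mulPoly_X0 {G : ℤ → ℤ → W} (h : IsLaurent2 G) (J T : ℤ) :
    subst (mulPoly (MvPolynomial.X 0) G) J T = subst G (J - 1) T + subst G J (T - 1) := by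
  have hX : ∀ m t, mulPoly (MvPolynomial.X 0) G m t = G (m - 1) t := fun m t => by
    rw [MvPolynomial.X, mulPoly_monomial]; simp
  rcases lt_or_ge J 0 with hJ | hJ
  · rw [subst, subst, subst, if_neg (by omega), if_neg (by omega), if_neg (by omega), add_zero]
  obtain ⟨j, rfl⟩ := Int.eq_ofNat_of_zero_le hJ
  simp only [subst, taylor, hX, Nat.cast_nonneg, if_true, Int.toNat_natCast]
  rw [← finsum_comp_equiv (Equiv.addRight (1 : ℤ))]
  simp only [Equiv.coe_addRight, add_sub_cancel_right]
  cases j with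
  | zero =>
    rw [if_neg (by simp), zero_add]
    refine finsum_congr fun m => ?_
    rw [binom_zero_right, binom_zero_right]
    congr 2; simp; ring
  | succ j =>
    rw [if_pos (by simp), show (((j + 1 : ℕ) : ℤ) - 1).toNat = j by simp,
      ← finsum_add_distrib (taylor_finite_support h _ _) (taylor_finite_support h _ _)]
    refine finsum_congr fun m => ?_
    rw [binom_succ_left, add_comm, add_smul]
    push_cast
    congr 3 <;> ring

/-- `subst G` as an element of `W((x))((x₀))`. -/
def substHM (G : ℤ → ℤ → W) (h : IsLaurent2 G) : HM2 W := ofFam (subst G) (tr21_subst h)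

@[simp] theorem toFam_substHM (G : ℤ → ℤ → W) (h : IsLaurent2 G) (m t : ℤ) :
    toFam (substHM G h) m t = subst G m t := rfl

/-- The polynomial `p(x₀ + x, x)`. -/
def shiftPoly : MvPolynomial (Fin 2) ℂ →+* MvPolynomial (Fin 2) ℂ :=
  MvPolynomial.eval₂Hom MvPolynomial.C ![MvPolynomial.X 0 + MvPolynomial.X 1, MvPolynomial.X 1]

theorem shiftPoly_X0 : shiftPoly (MvPolynomial.X 0) = MvPolynomial.X 0 + MvPolynomial.X 1 := by
  simp [shiftPoly]

theorem shiftPoly_X1 : shiftPoly (MvPolynomial.X 1) = MvPolynomial.X 1 := by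
  simp [shiftPoly]

theorem shiftPoly_ne_zero {p : MvPolynomial (Fin 2) ℂ} (hp : p ≠ 0) : shiftPoly p ≠ 0 := by
  let unshift : MvPolynomial (Fin 2) ℂ →+* MvPolynomial (Fin 2) ℂ :=
    MvPolynomial.eval₂Hom MvPolynomial.C ![MvPolynomial.X 0 - MvPolynomial.X 1, MvPolynomial.X 1]
  have h : unshift.comp shiftPoly = RingHom.id _ := by
    apply MvPolynomial.ringHom_ext
    · intro r; simp [unshift, shiftPoly]
    · intro i; fin_cases i <;> simp [unshift, shiftPoly]
  intro h0
  apply hp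
  have := congrArg (fun f => f p) h
  simpa [h0] using this.symm

theorem algebraMap_hahnSeries {R : Type*} [CommRing R] [Algebra ℂ R] (c : ℂ) :
    algebraMap ℂ (HahnSeries ℤ R) c = HahnSeries.single 0 (algebraMap ℂ R c) := by
  rw [HahnSeries.algebraMap_apply', PowerSeries.algebraMap_apply, HahnSeries.ofPowerSeries_C]
  rfl

theorem qK_one_eq_evalK2 (p : MvPolynomial (Fin 2) ℂ) :
    qK p 1 = evalK2 (xOuter + xInner) xInner p := by
  unfold qK
  induction p using MvPolynomial.induction_on with
  | C a =>
    rw [MvPolynomial.aeval_C, evalK2, MvPolynomial.coe_eval₂Hom, MvPolynomial.eval₂_C,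
      constK2_apply, algebraMap_hahnSeries]
    congr 1
    exact algebraMap_hahnSeries a
  | add p q hp hq => rw [map_add, map_add, hp, hq]
  | mul_X p i hp =>
    rw [map_mul, map_mul, hp, MvPolynomial.aeval_X]
    fin_cases i <;> simp [evalK2]
    rfl

theorem qK_one (p : MvPolynomial (Fin 2) ℂ) : qK p 1 = polyEmbed (shiftPoly p) := by
  rw [qK_one_eq_evalK2, polyEmbed_eq_evalK2, ← RingHom.comp_apply]
  congr 1
  apply MvPolynomial.ringHom_ext
  · intro r
    simp [evalK2, shiftPoly]
  · intro i
    fin_cases i <;> simp [evalK2, shiftPoly]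

theorem mulPoly_shiftPoly_subst {G : ℤ → ℤ → W} (h : IsLaurent2 G)
    (p : MvPolynomial (Fin 2) ℂ) (J T : ℤ) :
    mulPoly (shiftPoly p) (subst G) J T = subst (mulPoly p G) J T := by
  induction p using MvPolynomial.induction_on generalizing J T with
  | C c =>
    have h1 : shiftPoly (MvPolynomial.C c) = MvPolynomial.monomial 0 c := by
      rw [shiftPoly, MvPolynomial.coe_eval₂Hom, MvPolynomial.eval₂_C, MvPolynomial.C_apply]
    have h2 : mulPoly (MvPolynomial.C c) G = fun m t => c • G m t := by
      funext m t
      rw [MvPolynomial.C_apply, mulPoly_monomial]; simp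
    rw [h1, mulPoly_monomial, h2, subst, subst]
    simp only [Finsupp.coe_zero, Pi.zero_apply, Nat.cast_zero, sub_zero, taylor_smul, smul_ite,
      smul_zero]
  | add p q hp hq =>
    have hpq : mulPoly (p + q) G = fun m t => mulPoly p G m t + mulPoly q G m t := by
      funext m t
      rw [mulPoly_add_left]
    rw [map_add, mulPoly_add_left, hp, hq, hpq, subst, subst, subst,
      taylor_add (h.mulPoly p) (h.mulPoly q)]
    split_ifs <;> simp
  | mul_X p i hp =>
    rw [map_mul, mul_comm, mul_comm p, mulPoly_mul]
    have hXp : mulPoly (MvPolynomial.X i * p) G =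
        mulPoly (MvPolynomial.X i) (mulPoly p G) := by
      funext m t
      rw [mulPoly_mul]
    have hp' : mulPoly (shiftPoly p) (subst G) = subst (mulPoly p G) := by
      funext m t; exact hp m t
    rw [hXp, hp']
    fin_cases i
    · simp only [Fin.zero_eta]
      rw [subst_mulPoly_X0 (h.mulPoly p), shiftPoly_X0, mulPoly_add_left, MvPolynomial.X,
        MvPolynomial.X, mulPoly_monomial, mulPoly_monomial]
      simp
    · simp only [Fin.mk_one]
      rw [subst_mulPoly_X1, shiftPoly_X1, MvPolynomial.X, mulPoly_monomial]
      simp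

theorem substHM_mulPoly {G : ℤ → ℤ → W} (h : IsLaurent2 G) (p : MvPolynomial (Fin 2) ℂ) :
    substHM (mulPoly p G) (h.mulPoly p) = qK p 1 • substHM G h := by
  apply toFam_injective
  intro J T
  rw [toFam_substHM, qK_one, ← mulPoly_toFam, ← mulPoly_shiftPoly_subst h]
  rfl

end NVA

namespace NVA

variable {W : Type*} [AddCommGroup W] [Module ℂ W]

/-! ### The operations `a(x)_n b(x)` -/

theorem mf_add_right (a : EW W) (w w' : W) (n : ℤ) : mf a (w + w') n = mf a w n + mf a w' n := by
  simp [mf]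

theorem mf_smul_right (a : EW W) (c : ℂ) (w : W) (n : ℤ) : mf a (c • w) n = c • mf a w n := by
  simp [mf]

theorem mf_zero_right (a : EW W) (n : ℤ) : mf a 0 n = 0 := by
  simp [mf]

theorem mf_add_left (a b : EW W) (w : W) (n : ℤ) : mf (a + b) w n = mf a w n + mf b w n := rfl

theorem mf_smul_left (c : ℂ) (a : EW W) (w : W) (n : ℤ) : mf (c • a) w n = c • mf a w n := rfl

theorem mf_zero_left (w : W) (n : ℤ) : mf (0 : EW W) w n = 0 := rfl

theorem mf_injective {a b : EW W} (h : ∀ w n, mf a w n = mf b w n) : a = b := by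
  apply Subtype.ext
  apply LinearMap.ext
  intro w
  funext n
  exact h w n

theorem exists_mf_eq_zero (a : EW W) (w : W) : ∃ N : ℤ, ∀ n, N ≤ n → mf a w n = 0 := a.2 w

theorem exists_EW {f : W → ℤ → W} (hadd : ∀ w w' n, f (w + w') n = f w n + f w' n)
    (hsmul : ∀ (c : ℂ) w n, f (c • w) n = c • f w n)
    (htr : ∀ w, ∃ N : ℤ, ∀ n, N ≤ n → f w n = 0) : ∃ c : EW W, ∀ w n, mf c w n = f w n :=
  ⟨⟨{ toFun := f
      map_add' := fun w w' => funext fun n => hadd w w' n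
      map_smul' := fun c w => funext fun n => hsmul c w n }, htr⟩, fun _ _ => rfl⟩

theorem Fab_add_w (a b : EW W) (w w' : W) (m t : ℤ) :
    Fab a b (w + w') m t = Fab a b w m t + Fab a b w' m t := by
  simp only [Fab, mf_add_right]

theorem Fab_smul_w (a b : EW W) (c : ℂ) (w : W) (m t : ℤ) :
    Fab a b (c • w) m t = c • Fab a b w m t := by
  simp only [Fab, mf_smul_right]

theorem substYE_one (p : MvPolynomial (Fin 2) ℂ) (a b : EW W) (w : W) (j : ℕ) (t : ℤ) :
    substYE 1 p a b w j t = taylor j (mulPoly p (Fab a b w)) t := by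
  rw [substYE, taylor]
  refine finsum_congr fun m => ?_
  rw [one_zpow, mul_one, show t - m + j = t + j - m by ring]

theorem fullYE_one (p : MvPolynomial (Fin 2) ℂ) (a b : EW W) (w : W)
    (h : IsLaurent2 (mulPoly p (Fab a b w))) (J T : ℤ) :
    fullYE 1 p a b w J T = toFam (qInv p 1 • substHM (mulPoly p (Fab a b w)) h) J T := by
  rw [← smulFam_toFam, fullYE, smulFam]
  refine finsum_congr fun s => ?_
  simp only [substYE_one]
  rfl

/-- The coefficients of `Y_ℰ(a(x), x₀) b(x) w`, as an element of `W((x))((x₀))`. -/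
def yHM (a b : EW W) (h : QCPair a b) (w : W) : HM2 W :=
  qInv h.choose 1 • substHM (mulPoly h.choose (Fab a b w)) (h.choose_spec.2 w)

theorem rawYE_one (a b : EW W) (h : QCPair a b) (n : ℤ) (w : W) (m : ℤ) :
    rawYE 1 a b n w m = toFam (yHM a b h w) (-n - 1) (-m - 1) := by
  rw [rawYE, dif_pos h, fullYE_one _ _ _ _ (h.choose_spec.2 w), yHM]

theorem yHM_add (a b : EW W) (h : QCPair a b) (w w' : W) :
    yHM a b h (w + w') = yHM a b h w + yHM a b h w' := by
  rw [yHM, yHM, yHM, ← k2_smul_add]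
  congr 1
  apply toFam_injective
  intro J T
  have : mulPoly h.choose (Fab a b (w + w')) = fun m t =>
      mulPoly h.choose (Fab a b w) m t + mulPoly h.choose (Fab a b w') m t := by
    funext m t
    rw [← mulPoly_add]
    congr 1
    funext m t
    exact Fab_add_w ..
  simp only [toFam_add, toFam_substHM, this, subst,
    taylor_add (h.choose_spec.2 w) (h.choose_spec.2 w')]
  split_ifs <;> simp

theorem toFam_yHM_smul (a b : EW W) (h : QCPair a b) (c : ℂ) (w : W) (J T : ℤ) :
    toFam (yHM a b h (c • w)) J T = c • toFam (yHM a b h w) J T := by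
  rw [yHM, yHM, ← smulFam_toFam, ← smulFam_toFam, smulFam, smulFam, smul_finsum]
  refine finsum_congr fun s => ?_
  rw [smul_comm c]
  congr 1
  have : mulPoly h.choose (Fab a b (c • w)) = fun m t =>
      c • mulPoly h.choose (Fab a b w) m t := by
    funext m t
    rw [← mulPoly_smul]
    congr 1
    funext m t
    exact Fab_smul_w ..
  simp only [toFam_substHM, this, subst, taylor_smul, smul_ite, smul_zero]

theorem mf_YE (a b : EW W) (h : QCPair a b) (n : ℤ) (w : W) (m : ℤ) :
    mf (YE a b n) w m = toFam (yHM a b h w) (-n - 1) (-m - 1) := by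
  have hex : ∃ c : EW W, ∀ w m, mf c w m = rawYE ((1 : ℂˣ) : ℂ) a b n w m := by
    simp only [Units.val_one, rawYE_one a b h]
    refine exists_EW (fun w w' m => ?_) (fun c w m => ?_) fun w => ?_
    · rw [yHM_add, toFam_add]
    · rw [toFam_yHM_smul]
    · obtain ⟨N, hN⟩ := (tr21_toFam (yHM a b h w)).2 (-n - 1)
      refine ⟨-N, fun m hm => ?_⟩
      by_contra hc
      have := hN _ hc
      omega
  have hYE : YE a b n = hex.choose := dif_pos hex
  rw [hYE, hex.choose_spec, Units.val_one, rawYE_one a b h]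

/-- The coefficients of `Y_ℰ(a(x), x₀) b(x) w`. -/
def yFam (a b : EW W) (w : W) (J T : ℤ) : W := mf (YE a b (-J - 1)) w (-T - 1)

theorem yFam_eq (a b : EW W) (h : QCPair a b) (w : W) : yFam a b w = toFam (yHM a b h w) := by
  funext J T
  rw [yFam, mf_YE a b h]
  congr 1 <;> ring

theorem mulPoly_shiftPoly_yFam (a b : EW W) (h : QCPair a b) (w : W)
    (p : MvPolynomial (Fin 2) ℂ) (hp : IsLaurent2 (mulPoly p (Fab a b w))) (J T : ℤ) :
    mulPoly (shiftPoly p) (yFam a b w) J T = subst (mulPoly p (Fab a b w)) J T := by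
  obtain ⟨hp0, hL⟩ := h.choose_spec
  set p0 := h.choose with hp0_def
  rw [yFam_eq a b h, mulPoly_toFam, ← toFam_substHM _ hp]
  have hq : qK p0 1 ≠ 0 := by
    rw [qK_one]
    exact polyEmbed_ne_zero (shiftPoly_ne_zero hp0)
  have h1 : qK p0 1 • yHM a b h w = substHM (mulPoly p0 (Fab a b w)) (hL w) := by
    rw [yHM, ← k2_mul_smul, qInv, mul_inv_cancel₀ (G₀ := K2) hq, k2_one_smul]
  have h2 : polyEmbed (shiftPoly p) • yHM a b h w = substHM (mulPoly p (Fab a b w)) hp := by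
    refine k2_smul_left_cancel hq ?_
    rw [← k2_mul_smul, mul_comm (G := K2), k2_mul_smul, h1, ← qK_one, ← substHM_mulPoly,
      ← substHM_mulPoly]
    apply toFam_injective
    intro m t
    rw [toFam_substHM, toFam_substHM]
    congr 1
    funext m t
    exact mulPoly_comm ..
  rw [h2]

theorem exists_YE_eq_zero (a b : EW W) (h : QCPair a b) : ∃ N : ℤ, ∀ n, N ≤ n → YE a b n = 0 := by
  set q := qInv h.choose 1 with hq
  obtain ⟨N, hN⟩ := exists_le_of_isPWO q.isPWO_support
  refine ⟨-N, fun n hn => mf_injective fun w m => ?_⟩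
  rw [mf_YE a b h, yHM, ← smulFam_toFam, mf_zero_left, smulFam]
  refine finsum_eq_zero_of_forall_eq_zero fun s => ?_
  by_cases hs : q.coeff s.1 = 0
  · rw [k2Fun, ← hq, hs]
    simp
  · have := hN _ hs
    rw [toFam_substHM, subst, if_neg (by omega), smul_zero]

end NVA

namespace NVA

variable {W : Type*} [AddCommGroup W] [Module ℂ W]

/-! ### Locality with respect to given polynomials and coefficient series -/

/-- The coefficient of `x₀^l` in `p(x₀ + x, x)`, as a polynomial in the variable `i`. -/
def shiftCoeff (p : MvPolynomial (Fin 2) ℂ) (i : Fin 2) (l : ℕ) : MvPolynomial (Fin 2) ℂ :=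
  ∑ d ∈ (shiftPoly p).support with d 0 = l,
    MvPolynomial.monomial (Finsupp.single i (d 1)) (MvPolynomial.coeff d (shiftPoly p))

/-- Admissible polynomials and coefficient series for a locality relation. -/
structure LocData where
  /-- The polynomials by which a product may be multiplied. -/
  P : Submonoid (MvPolynomial (Fin 2) ℂ)
  /-- The coefficient series allowed in a locality relation. -/
  Q : Subring K2
  ne_zero : ∀ p ∈ P, p ≠ 0
  embed_mem : ∀ p ∈ P, polyEmbed p ∈ Q
  const_mem : ∀ c, constK2 c ∈ Q
  dd_left : ∀ q ∈ Q, ∀ k, ∃ q' ∈ Q, k2Fun q' = dd k (k2Fun q)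
  dd_right : ∀ q ∈ Q, ∀ k, ∃ q' ∈ Q, (fun b a => k2Fun q' a b) = dd k (fun b a => k2Fun q a b)
  shiftCoeff_mem : ∀ p ∈ P, ∀ i l, polyEmbed (shiftCoeff p i l) ∈ Q
  shiftCoeff_lead : ∀ p ∈ P, ∀ i, ∃ l₀, shiftCoeff p i l₀ ∈ P ∧ ∀ l < l₀, shiftCoeff p i l = 0

theorem mulPoly_sum_left {ι : Type*} (s : Finset ι) (P : ι → MvPolynomial (Fin 2) ℂ)
    (F : ℤ → ℤ → W) (m t : ℤ) :
    mulPoly (∑ i ∈ s, P i) F m t = ∑ i ∈ s, mulPoly (P i) F m t := by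
  induction s using Finset.induction_on with
  | empty => simp [mulPoly]
  | insert a s ha ih => rw [Finset.sum_insert ha, Finset.sum_insert ha, mulPoly_add_left, ih]

theorem tr21_swap_Fab (u v : EW W) (w : W) : Tr21 fun m t => Fab u v w t m := by
  refine ⟨?_, fun m => ?_⟩
  · obtain ⟨N, hN⟩ := exists_mf_eq_zero v w
    refine ⟨-N, fun m t h => ?_⟩
    by_contra hc
    apply h
    simp only [Fab]
    rw [hN _ (by omega), mf_zero_right]
  · obtain ⟨N, hN⟩ := exists_mf_eq_zero u (mf v w (-m - 1))
    refine ⟨-N, fun t h => ?_⟩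
    by_contra hc
    exact h (hN _ (by omega))

/-- The series `u(x₂) v(x₁) w`. -/
def uv (u v : EW W) (w : W) : HM2 W := ofFam (fun m t => Fab u v w t m) (tr21_swap_Fab u v w)

@[simp] theorem toFam_uv (u v : EW W) (w : W) (m t : ℤ) :
    toFam (uv u v w) m t = Fab u v w t m := rfl

variable (D : LocData)

/-- The sums of series `q(x₁, x₂) u(x₂) v(x₁)` with `u ∈ Z` and `v ∈ X`. -/
def N2 (Z X : Set (EW W)) : AddSubmonoid (W → ℤ → ℤ → W) :=
  AddSubmonoid.closure
    {F | ∃ q ∈ D.Q, ∃ u ∈ Z, ∃ v ∈ X, F = fun w => toFam (q • uv u v w)}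

/-- A family which, multiplied by an admissible polynomial, is a sum of series
`q(x₁, x₂) u(x₂) v(x₁)` with `u ∈ Z` and `v ∈ X`. -/
def Good (Z X : Set (EW W)) (F : W → ℤ → ℤ → W) : Prop :=
  ∃ P ∈ D.P, (fun w => mulPoly P (F w)) ∈ N2 D Z X

variable {D} {Z X : Set (EW W)}

theorem mem_N2 {q : K2} (hq : q ∈ D.Q) {u v : EW W} (hu : u ∈ Z) (hv : v ∈ X) :
    (fun w => toFam (q • uv u v w)) ∈ N2 D Z X :=
  AddSubmonoid.subset_closure ⟨q, hq, u, hu, v, hv, rfl⟩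

theorem N2_mono {Z' X' : Set (EW W)} (hZ : Z ⊆ Z') (hX : X ⊆ X') : N2 D Z X ≤ N2 D Z' X' := by
  refine AddSubmonoid.closure_mono ?_
  rintro F ⟨q, hq, u, hu, v, hv, rfl⟩
  exact ⟨q, hq, u, hZ hu, v, hX hv, rfl⟩

theorem exists_toFam_of_mem_N2 {F : W → ℤ → ℤ → W} (hF : F ∈ N2 D Z X) :
    ∃ M : W → HM2 W, F = fun w => toFam (M w) := by
  induction hF using AddSubmonoid.closure_induction with
  | mem F h =>
    obtain ⟨q, hq, u, hu, v, hv, rfl⟩ := h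
    exact ⟨_, rfl⟩
  | zero => exact ⟨fun _ => 0, by funext w m t; simp⟩
  | add F F' _ _ h h' =>
    obtain ⟨M, rfl⟩ := h
    obtain ⟨M', rfl⟩ := h'
    exact ⟨fun w => M w + M' w, by funext w m t; simp⟩

theorem smulFam_zero (f : ℤ → ℤ → ℂ) : smulFam f (0 : ℤ → ℤ → W) = 0 := by
  funext m t
  simp [smulFam]

theorem smulFam_mem_N2 {q : K2} (hq : q ∈ D.Q) {F : W → ℤ → ℤ → W} (hF : F ∈ N2 D Z X) :
    (fun w => smulFam (k2Fun q) (F w)) ∈ N2 D Z X := by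
  induction hF using AddSubmonoid.closure_induction with
  | mem F h =>
    obtain ⟨q', hq', u, hu, v, hv, rfl⟩ := h
    have : (fun w => smulFam (k2Fun q) (toFam (q' • uv u v w))) =
        fun w => toFam ((q * q') • uv u v w) := by
      funext w m t
      rw [smulFam_toFam, k2_mul_smul]
    rw [this]
    exact mem_N2 (D.Q.mul_mem hq hq') hu hv
  | zero =>
    have : (fun w => smulFam (k2Fun q) ((0 : W → ℤ → ℤ → W) w)) = 0 := by
      funext w
      exact smulFam_zero _
    rw [this]
    exact zero_mem _
  | add F F' hF hF' h h' =>
    obtain ⟨M, rfl⟩ := exists_toFam_of_mem_N2 hF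
    obtain ⟨M', rfl⟩ := exists_toFam_of_mem_N2 hF'
    have : (fun w => smulFam (k2Fun q) (((fun w => toFam (M w)) + fun w => toFam (M' w)) w)) =
        (fun w => smulFam (k2Fun q) (toFam (M w))) +
          fun w => smulFam (k2Fun q) (toFam (M' w)) := by
      funext w m t
      have e : ((fun w => toFam (M w)) + fun w => toFam (M' w)) w = toFam (M w + M' w) := by
        funext m t
        simp
      rw [e, smulFam_toFam, k2_smul_add]
      simp [smulFam_toFam]
    rw [this]
    exact add_mem h h'

theorem mulPoly_mem_N2 {P : MvPolynomial (Fin 2) ℂ} (hP : polyEmbed P ∈ D.Q)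
    {F : W → ℤ → ℤ → W} (hF : F ∈ N2 D Z X) : (fun w => mulPoly P (F w)) ∈ N2 D Z X := by
  have : (fun w => mulPoly P (F w)) = fun w => smulFam (k2Fun (polyEmbed P)) (F w) := by
    funext w m t
    rw [mulPoly_eq_smulFam]
  rw [this]
  exact smulFam_mem_N2 hP hF

theorem Good.mono {Z' X' : Set (EW W)} (hZ : Z ⊆ Z') (hX : X ⊆ X') {F : W → ℤ → ℤ → W}
    (h : Good D Z X F) : Good D Z' X' F := by
  obtain ⟨P, hP, hF⟩ := h
  exact ⟨P, hP, N2_mono hZ hX hF⟩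

theorem good_of_mem_N2 {F : W → ℤ → ℤ → W} (h : F ∈ N2 D Z X) : Good D Z X F := by
  refine ⟨1, D.P.one_mem, ?_⟩
  convert h using 1
  funext w m t
  rw [mulPoly_one]

theorem Good.add {F F' : W → ℤ → ℤ → W} (h : Good D Z X F) (h' : Good D Z X F') :
    Good D Z X (F + F') := by
  obtain ⟨P, hP, hF⟩ := h
  obtain ⟨P', hP', hF'⟩ := h'
  refine ⟨P * P', D.P.mul_mem hP hP', ?_⟩
  convert add_mem (mulPoly_mem_N2 (D.embed_mem _ hP') hF) (mulPoly_mem_N2 (D.embed_mem _ hP) hF')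
    using 1
  funext w m t
  simp only [Pi.add_apply]
  rw [← mulPoly_mul, ← mulPoly_mul, mul_comm P' P, ← mulPoly_add]
  rfl

theorem good_zero : Good D Z X 0 := good_of_mem_N2 (zero_mem _)

theorem Good.sum {ι : Type*} (s : Finset ι) {F : ι → W → ℤ → ℤ → W}
    (h : ∀ i ∈ s, Good D Z X (F i)) : Good D Z X (∑ i ∈ s, F i) := by
  induction s using Finset.induction_on with
  | empty => exact good_zero
  | insert a s ha ih =>
    rw [Finset.sum_insert ha]
    exact (h a (by simp)).add (ih fun i hi => h i (by simp [hi]))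

theorem Good.mulPoly {κ : MvPolynomial (Fin 2) ℂ} (hκ : polyEmbed κ ∈ D.Q)
    {F : W → ℤ → ℤ → W} (h : Good D Z X F) : Good D Z X (fun w => mulPoly κ (F w)) := by
  obtain ⟨P, hP, hF⟩ := h
  refine ⟨P, hP, ?_⟩
  convert mulPoly_mem_N2 hκ hF using 1
  funext w m t
  exact mulPoly_comm ..

theorem Good.of_mulPoly {P : MvPolynomial (Fin 2) ℂ} (hP : P ∈ D.P)
    {F : W → ℤ → ℤ → W} (h : Good D Z X (fun w => NVA.mulPoly P (F w))) : Good D Z X F := by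
  obtain ⟨P', hP', hF⟩ := h
  refine ⟨P' * P, D.P.mul_mem hP' hP, ?_⟩
  convert hF using 1
  funext w m t
  rw [mulPoly_mul]

theorem polyEmbed_C (c : ℂ) : polyEmbed (MvPolynomial.C c) = constK2 c := by
  rw [polyEmbed_eq_evalK2, evalK2_C]

theorem Good.smul (c : ℂ) {F : W → ℤ → ℤ → W} (h : Good D Z X F) :
    Good D Z X (fun w m t => c • F w m t) := by
  have := h.mulPoly (κ := MvPolynomial.C c) (by rw [polyEmbed_C]; exact D.const_mem c)
  convert this using 1
  funext w m t
  rw [MvPolynomial.C_apply, mulPoly_monomial]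
  simp

theorem Good.neg {F : W → ℤ → ℤ → W} (h : Good D Z X F) : Good D Z X (-F) := by
  convert h.smul (-1) using 1
  funext w m t
  simp

theorem Good.sub {F F' : W → ℤ → ℤ → W} (h : Good D Z X F) (h' : Good D Z X F') :
    Good D Z X (F - F') := by
  rw [sub_eq_add_neg]
  exact h.add h'.neg

theorem smulFam_eq_sum {f : ℤ → ℤ → ℂ} (hf : FinSupp f) (F : ℤ → ℤ → W) (m t : ℤ) :
    smulFam f F m t = ∑ s ∈ hf.toFinset, f s.1 s.2 • F (m - s.1) (t - s.2) := by
  refine finsum_eq_sum_of_support_subset _ fun s hs => ?_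
  refine (Set.Finite.mem_toFinset hf).2 fun h => hs ?_
  simp only [h, zero_smul]

theorem Good.smulFam {q : K2} (hq : q ∈ D.Q) (hf : FinSupp (k2Fun q)) {F : W → ℤ → ℤ → W}
    (h : Good D Z X F) : Good D Z X (fun w => smulFam (k2Fun q) (F w)) := by
  obtain ⟨P, hP, hF⟩ := h
  refine ⟨P, hP, ?_⟩
  convert smulFam_mem_N2 hq hF using 1
  funext w m t
  have : NVA.smulFam (k2Fun q) (F w) = fun m t =>
      ∑ s ∈ Set.Finite.toFinset hf, k2Fun q s.1 s.2 • F w (m - s.1) (t - s.2) := by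
    funext m t
    exact smulFam_eq_sum hf _ _ _
  simp only [this]
  rw [mulPoly_sum, smulFam_eq_sum hf]
  refine Finset.sum_congr rfl fun s _ => ?_
  rw [mulPoly_smul]
  simp only [NVA.mulPoly]
  congr 1
  refine Finset.sum_congr rfl fun d _ => ?_
  congr 2 <;> ring

theorem good_of_leibniz {P P' : MvPolynomial (Fin 2) ℂ} (hP : P ∈ D.P) (hP' : P' ∈ D.P)
    {g : ℕ → K2} (hg : ∀ i, g i ∈ D.Q) (hfin : ∀ i, FinSupp (k2Fun (g i)))
    (hg0 : g 0 = polyEmbed P') {F : ℕ → W → ℤ → ℤ → W}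
    (h : ∀ j, Good D Z X fun w => NVA.mulPoly P fun m t =>
      ∑ ik ∈ Finset.HasAntidiagonal.antidiagonal j, NVA.smulFam (k2Fun (g ik.1)) (F ik.2 w) m t)
    (j : ℕ) : Good D Z X (F j) := by
  induction j using Nat.strong_induction_on with
  | _ j ih =>
    have h1 := (h j).of_mulPoly hP
    have h2 : Good D Z X (∑ ik ∈ (Finset.HasAntidiagonal.antidiagonal j).erase (0, j),
        fun w => NVA.smulFam (k2Fun (g ik.1)) (F ik.2 w)) := by
      refine Good.sum _ fun ik hik => Good.smulFam (hg _) (hfin _) (ih _ ?_)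
      rw [Finset.mem_erase, Finset.HasAntidiagonal.mem_antidiagonal] at hik
      by_contra hc
      apply hik.1
      ext <;> simp <;> omega
    refine Good.of_mulPoly hP' ?_
    convert h1.sub h2 using 1
    funext w m t
    have hmem : (0, j) ∈ Finset.HasAntidiagonal.antidiagonal j := by simp
    simp only [Pi.sub_apply, Finset.sum_apply]
    rw [← Finset.add_sum_erase _ _ hmem, add_sub_cancel_right, mulPoly_eq_smulFam, hg0]

theorem good_of_triangular {κ : ℕ → MvPolynomial (Fin 2) ℂ} (hκ : ∀ l, polyEmbed (κ l) ∈ D.Q)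
    {l₀ : ℕ} (h0 : κ l₀ ∈ D.P) (hlt : ∀ l < l₀, κ l = 0) {I : Finset ℕ} (hI : l₀ ∈ I)
    {A : ℤ → W → ℤ → ℤ → W} {N : ℤ} (hA : ∀ n, N ≤ n → A n = 0)
    (h : ∀ n, Good D Z X (∑ l ∈ I, fun w => NVA.mulPoly (κ l) (A (n + l) w))) (n : ℤ) :
    Good D Z X (A n) := by
  suffices H : ∀ k : ℕ, ∀ n, N - k ≤ n → Good D Z X (A n) from
    H (N - n).toNat n (by omega)
  intro k
  induction k with
  | zero =>
    intro n hn
    rw [hA n (by simpa using hn)]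
    exact good_zero
  | succ k ih =>
    intro n hn
    have h1 := h (n - l₀)
    have h2 : Good D Z X (∑ l ∈ I.erase l₀, fun w => NVA.mulPoly (κ l) (A (n - l₀ + l) w)) := by
      refine Good.sum _ fun l hl => ?_
      rcases lt_or_ge l l₀ with hl' | hl'
      · rw [hlt l hl']
        convert good_zero using 1
        funext w m t
        simp [NVA.mulPoly]
      · refine (ih _ ?_).mulPoly (hκ l)
        have := Finset.ne_of_mem_erase hl
        push_cast at hn
        omega
    refine Good.of_mulPoly h0 ?_
    convert h1.sub h2 using 1
    rw [← Finset.add_sum_erase _ _ hI, add_sub_cancel_right, sub_add_cancel]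

end NVA

namespace NVA

variable {W : Type*} [AddCommGroup W] [Module ℂ W]

theorem smulFam_add {f : ℤ → ℤ → ℂ} {F F' : ℤ → ℤ → W} (h : FinPair f F) (h' : FinPair f F') :
    smulFam f (fun m t => F m t + F' m t) = fun m t => smulFam f F m t + smulFam f F' m t := by
  funext m t
  simp only [smulFam, smul_add]
  exact finsum_add_distrib (h.finite_support m t) (h'.finite_support m t)

theorem smulFam_swap (f : ℤ → ℤ → ℂ) (F : ℤ → ℤ → W) (m t : ℤ) :
    smulFam (fun b a => f a b) (fun b a => F a b) t m = smulFam f F m t := by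
  rw [smulFam, smulFam, ← finsum_comp_equiv (Equiv.prodComm ℤ ℤ)]
  rfl

theorem FinPair.swap {V : Type*} [AddCommGroup V] {f : ℤ → ℤ → ℂ} {F : ℤ → ℤ → V}
    (h : FinPair f F) :
    FinPair (fun b a => f a b) (fun b a => F a b) := by
  intro m t
  exact (h t m).preimage (Equiv.prodComm ℤ ℤ).injective.injOn

theorem FinSupp.swap {f : ℤ → ℤ → ℂ} (h : FinSupp f) : FinSupp (fun b a => f a b) :=
  h.preimage (Equiv.prodComm ℤ ℤ).injective.injOn

theorem finPair_of_tr21 (q : K2) {F : ℤ → ℤ → W} (h : Tr21 F) : FinPair (k2Fun q) F := by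
  have h' : toFam (ofFam F h) = F := by
    funext m t
    exact toFam_ofFam F h m t
  rw [← h']
  exact finPair_k2Fun q _

theorem mf_sum_right {ι : Type*} (a : EW W) (s : Finset ι) (f : ι → W) (n : ℤ) :
    mf a (∑ i ∈ s, f i) n = ∑ i ∈ s, mf a (f i) n := by
  induction s using Finset.induction_on with
  | empty => simp [mf_zero_right]
  | insert i s hi ih => rw [Finset.sum_insert hi, Finset.sum_insert hi, mf_add_right, ih]

theorem mf_finsum {ι : Type*} (a : EW W) {f : ι → W} (hf : (Function.support f).Finite) (n : ℤ) :
    mf a (∑ᶠ i, f i) n = ∑ᶠ i, mf a (f i) n := by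
  rw [finsum_eq_sum_of_support_subset f (s := hf.toFinset) (by simp), mf_sum_right,
    finsum_eq_sum_of_support_subset _ (s := hf.toFinset)]
  intro i hi
  rw [Set.Finite.coe_toFinset]
  intro h0
  exact hi (by simp only [h0, mf_zero_right])

theorem mf_smulFam (a : EW W) {f : ℤ → ℤ → ℂ} {F : ℤ → ℤ → W} (h : FinPair f F) (m t n : ℤ) :
    mf a (smulFam f F m t) n = smulFam f (fun m t => mf a (F m t) n) m t := by
  rw [smulFam, mf_finsum a (h.finite_support m t)]
  simp only [mf_smul_right]
  rfl

theorem mf_mulPoly (a : EW W) (P : MvPolynomial (Fin 2) ℂ) (F : ℤ → ℤ → W) (m t n : ℤ) :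
    mf a (mulPoly P F m t) n = mulPoly P (fun m t => mf a (F m t) n) m t := by
  simp only [mulPoly, mf_sum_right, mf_smul_right]

theorem mf_taylor (a : EW W) {G : ℤ → ℤ → W} (h : IsLaurent2 G) (j : ℕ) (t n : ℤ) :
    mf a (taylor j G t) n = taylor j (fun m t => mf a (G m t) n) t := by
  rw [taylor, mf_finsum a]
  · simp only [mf_smul_right]
    rfl
  · exact (taylor_finite_support h (fun m => binom m j) (t + j))

theorem mul13_mul23 {f g : ℤ → ℤ → ℂ} {H : ℤ → ℤ → ℤ → W} (hf : FinSupp f)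
    (hg : ∀ m, FinPair g (H m)) : mul13 f (mul23 g H) = mul23 g (mul13 f H) := by
  funext m t s
  simp only [mul13, mul23]
  have h1 : ∀ t s, smulFam f (fun m s => H m t s) m s =
      ∑ a ∈ Set.Finite.toFinset hf, f a.1 a.2 • H (m - a.1) t (s - a.2) := fun t s =>
    smulFam_eq_sum hf _ _ _
  rw [smulFam_eq_sum hf]
  simp only [h1]
  simp only [smulFam, smul_finsum, Finset.smul_sum]
  rw [← finsum_sum_comm]
  · refine finsum_congr fun b => Finset.sum_congr rfl fun a _ => ?_
    rw [smul_comm]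
    congr 3; ring
  · intro a _
    refine ((hg (m - a.1)).finite_support t (s - a.2)).subset fun b hb h0 => hb ?_
    simp only at h0 ⊢
    rw [h0, smul_zero]

theorem mul23_mul13 {f g : ℤ → ℤ → ℂ} {H : ℤ → ℤ → ℤ → W} (hf : FinSupp f)
    (hg : ∀ t, FinPair g (fun m s => H m t s)) : mul23 f (mul13 g H) = mul13 g (mul23 f H) := by
  funext m t s
  simp only [mul13, mul23]
  have h1 : ∀ m s, smulFam f (fun t s => H m t s) t s =
      ∑ a ∈ Set.Finite.toFinset hf, f a.1 a.2 • H m (t - a.1) (s - a.2) := fun m s =>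
    smulFam_eq_sum hf _ _ _
  rw [smulFam_eq_sum hf]
  simp only [h1]
  simp only [smulFam, smul_finsum, Finset.smul_sum]
  rw [← finsum_sum_comm]
  · refine finsum_congr fun b => Finset.sum_congr rfl fun a _ => ?_
    rw [smul_comm]
    congr 3; ring
  · intro a _
    refine ((hg (t - a.1)).finite_support m (s - a.2)).subset fun b hb h0 => hb ?_
    simp only at h0 ⊢
    rw [h0, smul_zero]

/-! ### Three-variable families whose diagonal Taylor coefficients are controlled -/

/-- After multiplication by suitable admissible polynomials in `y, x`, the family lies in `B`
and its diagonal Taylor coefficients lie in `N`. -/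
def Adm (D : LocData) (B : (ℤ → ℤ → ℤ → W) → Prop) (N : AddSubmonoid (W → ℤ → ℤ → W))
    (H : W → ℤ → ℤ → ℤ → W) : Prop :=
  ∃ p₀ ∈ D.P, ∀ p ∈ D.P, (∀ w, B (mul12 (p * p₀) (H w))) ∧
    ∀ j, (fun w => taylor3 j (mul12 (p * p₀) (H w))) ∈ N

variable {D : LocData} {A : (ℤ → ℤ → ℂ) → Prop} {B : (ℤ → ℤ → ℤ → W) → Prop}
  {N : AddSubmonoid (W → ℤ → ℤ → W)}

theorem mul12_add (p : MvPolynomial (Fin 2) ℂ) (H H' : ℤ → ℤ → ℤ → W) :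
    mul12 p (fun m t s => H m t s + H' m t s) =
      fun m t s => mul12 p H m t s + mul12 p H' m t s := by
  funext m t s
  exact mulPoly_add ..

theorem Adm.zero (cls : TaylorClass A B) : Adm D B N (fun _ _ _ _ => 0) := by
  have h0 : ∀ p, mul12 p (fun _ _ _ => (0 : W)) = fun _ _ _ => 0 := fun p => by
    funext m t s
    exact mulPoly_zero ..
  refine ⟨1, D.P.one_mem, fun p _ => ⟨fun w => ?_, fun j => ?_⟩⟩
  · rw [h0]
    exact cls.zero_mem
  · convert zero_mem N using 1
    funext w t s
    rw [h0, taylor3_zero]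
    rfl

theorem Adm.add (cls : TaylorClass A B) {H H' : W → ℤ → ℤ → ℤ → W} (h : Adm D B N H)
    (h' : Adm D B N H') : Adm D B N (fun w m t s => H w m t s + H' w m t s) := by
  obtain ⟨p, hp, h⟩ := h
  obtain ⟨p', hp', h'⟩ := h'
  refine ⟨p * p', D.P.mul_mem hp hp', fun r hr => ?_⟩
  have h := h (r * p') (D.P.mul_mem hr hp')
  have h' := h' (r * p) (D.P.mul_mem hr hp)
  rw [show r * p' * p = r * (p * p') by ring] at h
  rw [mul_assoc] at h'
  refine ⟨fun w => ?_, fun j => ?_⟩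
  · rw [mul12_add]
    exact cls.add_mem _ _ (h.1 w) (h'.1 w)
  · convert add_mem (h.2 j) (h'.2 j) using 1
    funext w t s
    rw [mul12_add, taylor3_add (cls.lines _ (h.1 w)) (cls.lines _ (h'.1 w))]
    rfl

theorem Adm.mul23 (cls : TaylorClass A B) {H : W → ℤ → ℤ → ℤ → W} {f : ℤ → ℤ → ℂ} (hf : A f)
    (hN : ∀ F ∈ N, (fun w => smulFam f (F w)) ∈ N) (hH : ∀ w m, FinPair f (H w m))
    (h : Adm D B N H) : Adm D B N (fun w => mul23 f (H w)) := by
  obtain ⟨p, hp, h⟩ := h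
  refine ⟨p, hp, fun r hr => ⟨fun w => ?_, fun j => ?_⟩⟩
  · rw [mul12_mul23 _ (hH w)]
    exact cls.mul23_mem _ _ hf ((h r hr).1 w)
  · convert hN _ ((h r hr).2 j) using 1
    funext w t s
    rw [mul12_mul23 _ (hH w), taylor3_mul23 (cls.fin23 _ _ hf ((h r hr).1 w))]

theorem Adm.mul13 (cls : TaylorClass A B) {H : W → ℤ → ℤ → ℤ → W} {f : ℤ → ℤ → ℂ} (hf : A f)
    (hN : ∀ k, ∀ F ∈ N, (fun w => smulFam (dd k f) (F w)) ∈ N)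
    (hH : ∀ w t, FinPair f (fun m s => H w m t s))
    (h : Adm D B N H) : Adm D B N (fun w => mul13 f (H w)) := by
  obtain ⟨p, hp, h⟩ := h
  refine ⟨p, hp, fun r hr => ⟨fun w => ?_, fun j => ?_⟩⟩
  · rw [mul12_mul13 _ (hH w)]
    exact cls.mul13_mem _ _ hf ((h r hr).1 w)
  · convert AddSubmonoid.sum_mem N (t := Finset.HasAntidiagonal.antidiagonal j)
      (f := fun ik w => smulFam (dd ik.1 f) (taylor3 ik.2 (mul12 (r * p) (H w))))
      (fun ik _ => hN ik.1 _ ((h r hr).2 ik.2)) using 1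
    funext w t s
    rw [mul12_mul13 _ (hH w), taylor3_mul13 (cls.fin13 _ _ hf ((h r hr).1 w))]
    simp only [Finset.sum_apply]

/-! ### Expansions of the diagonal Taylor coefficients in terms of `a(x)_n b(x)` -/

/-- The powers of `x₀` occurring in `p(x₀ + x, x)`. -/
def shiftDegrees (p : MvPolynomial (Fin 2) ℂ) : Finset ℕ := (shiftPoly p).support.image fun d => d 0

theorem shiftCoeff_eq_zero {p : MvPolynomial (Fin 2) ℂ} {i : Fin 2} {l : ℕ}
    (hl : l ∉ shiftDegrees p) : shiftCoeff p i l = 0 := by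
  rw [shiftCoeff, Finset.filter_eq_empty_iff.2, Finset.sum_empty]
  intro d hd h
  exact hl (Finset.mem_image.2 ⟨d, hd, h⟩)

theorem mulPoly_shiftCoeff_zero (p : MvPolynomial (Fin 2) ℂ) (l : ℕ) (F : ℤ → ℤ → W) (m t : ℤ) :
    mulPoly (shiftCoeff p 0 l) F m t = ∑ d ∈ (shiftPoly p).support with d 0 = l,
      MvPolynomial.coeff d (shiftPoly p) • F (m - d 1) t := by
  rw [shiftCoeff, mulPoly_sum_left]
  refine Finset.sum_congr rfl fun d _ => ?_
  rw [mulPoly_monomial]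
  simp

theorem mulPoly_shiftCoeff_one (p : MvPolynomial (Fin 2) ℂ) (l : ℕ) (F : ℤ → ℤ → W) (m t : ℤ) :
    mulPoly (shiftCoeff p 1 l) F m t = ∑ d ∈ (shiftPoly p).support with d 0 = l,
      MvPolynomial.coeff d (shiftPoly p) • F m (t - d 1) := by
  rw [shiftCoeff, mulPoly_sum_left]
  refine Finset.sum_congr rfl fun d _ => ?_
  rw [mulPoly_monomial]
  simp

theorem mulPoly_shiftCoeff_swap (p : MvPolynomial (Fin 2) ℂ) (l : ℕ) (F : ℤ → ℤ → W) (m t : ℤ) :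
    mulPoly (shiftCoeff p 0 l) (fun t m => F m t) t m = mulPoly (shiftCoeff p 1 l) F m t := by
  rw [mulPoly_shiftCoeff_zero, mulPoly_shiftCoeff_one]

theorem sum_shiftDegrees {V : Type*} [AddCommMonoid V] (p : MvPolynomial (Fin 2) ℂ)
    (f : ℕ → (Fin 2 →₀ ℕ) → V) :
    ∑ l ∈ shiftDegrees p, ∑ d ∈ (shiftPoly p).support with d 0 = l, f l d =
      ∑ d ∈ (shiftPoly p).support, f (d 0) d := by
  rw [← Finset.sum_fiberwise_of_maps_to (s := (shiftPoly p).support) (t := shiftDegrees p)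
    (g := fun d => d 0) (fun d hd => Finset.mem_image_of_mem _ hd)]
  refine Finset.sum_congr rfl fun l _ => Finset.sum_congr rfl fun d hd => ?_
  rw [(Finset.mem_filter.1 hd).2]

theorem sum_shiftCoeff_left (p : MvPolynomial (Fin 2) ℂ) (a b c : EW W) (w : W) (n t s : ℤ) :
    ∑ l ∈ shiftDegrees p, mulPoly (shiftCoeff p 0 l) (Fab (YE a b (n + l)) c w) t s =
      mulPoly (shiftPoly p) (yFam a b (mf c w (-s - 1))) (-n - 1) t := by
  simp only [mulPoly_shiftCoeff_zero]
  rw [sum_shiftDegrees p fun l d => MvPolynomial.coeff d (shiftPoly p) •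
    Fab (YE a b (n + l)) c w (t - d 1) s]
  refine Finset.sum_congr rfl fun d _ => ?_
  rw [yFam, Fab, show -(-n - 1 - (d 0 : ℤ)) - 1 = n + (d 0 : ℤ) by ring]

theorem sum_shiftCoeff_right (p : MvPolynomial (Fin 2) ℂ) (a b c : EW W) (w : W) (n s t : ℤ) :
    ∑ l ∈ shiftDegrees p, mulPoly (shiftCoeff p 1 l) (Fab a (YE b c (n + l)) w) s t =
      mf a (mulPoly (shiftPoly p) (yFam b c w) (-n - 1) t) (-s - 1) := by
  simp only [mulPoly_shiftCoeff_one]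
  rw [sum_shiftDegrees p fun l d => MvPolynomial.coeff d (shiftPoly p) •
    Fab a (YE b c (n + l)) w s (t - d 1), mulPoly, mf_sum_right]
  refine Finset.sum_congr rfl fun d _ => ?_
  rw [yFam, Fab, mf_smul_right, show -(-n - 1 - (d 0 : ℤ)) - 1 = n + (d 0 : ℤ) by ring]

end NVA

namespace NVA

variable {W : Type*} [AddCommGroup W] [Module ℂ W]

theorem tr21_k2Fun (q : K2) : Tr21 (k2Fun q) := by
  constructor
  · obtain ⟨N, hN⟩ := exists_le_of_isPWO q.isPWO_support
    refine ⟨N, fun m t h => hN m ?_⟩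
    rw [HahnSeries.mem_support]
    intro h0
    exact h (by rw [k2Fun, h0, HahnSeries.coeff_zero])
  · intro m
    obtain ⟨N, hN⟩ := exists_le_of_isPWO (q.coeff m).isPWO_support
    exact ⟨N, fun t h => hN t h⟩

theorem finSupp_polyEmbed (P : MvPolynomial (Fin 2) ℂ) : FinSupp (k2Fun (polyEmbed P)) :=
  k2Fun_polyEmbed_support P

/-- Quasi compatibility of a pair with respect to a given class of polynomials. -/
def QCP (D : LocData) (a b : EW W) : Prop :=
  ∃ p ∈ D.P, ∀ w, IsLaurent2 (mulPoly p (Fab a b w))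

theorem taylor_mulPoly_Fab {a b : EW W} (h : QCPair a b) {w : W} {p : MvPolynomial (Fin 2) ℂ}
    (hp : IsLaurent2 (mulPoly p (Fab a b w))) (j : ℕ) (t : ℤ) :
    taylor j (mulPoly p (Fab a b w)) t = mulPoly (shiftPoly p) (yFam a b w) j t := by
  rw [mulPoly_shiftPoly_yFam a b h w p hp, subst, if_pos (by omega), Int.toNat_natCast]

theorem isLaurent2_mulPoly_mul {F : ℤ → ℤ → W} {p : MvPolynomial (Fin 2) ℂ}
    (h : IsLaurent2 (mulPoly p F)) (r : MvPolynomial (Fin 2) ℂ) :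
    IsLaurent2 (mulPoly (r * p) F) := by
  obtain ⟨N, hN⟩ := IsLaurent2.mulPoly h r
  exact ⟨N, fun m t hmt => by rw [mulPoly_mul, hN m t hmt]⟩

/-- `a(y)` applied on the left of a two-variable family in `x, z`. -/
def lft (a : EW W) (F : W → ℤ → ℤ → W) (w : W) (m t s : ℤ) : W := mf a (F w t s) (-m - 1)

/-- A two-variable family in `y, z` applied to `v(x)w`. -/
def rgt (F : W → ℤ → ℤ → W) (v : EW W) (w : W) (m t s : ℤ) : W := F (mf v w (-t - 1)) m s

variable {D : LocData} {A : (ℤ → ℤ → ℂ) → Prop} {B : (ℤ → ℤ → ℤ → W) → Prop}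
  {N : AddSubmonoid (W → ℤ → ℤ → W)} {Z X X' : Set (EW W)}

theorem Fab_trunc_right (u v : EW W) (w : W) : ∃ N, ∀ m t, Fab u v w m t ≠ 0 → N ≤ t := by
  obtain ⟨N, hN⟩ := (tr21_swap_Fab u v w).1
  exact ⟨N, fun m t h => hN t m h⟩

theorem Fab_zero_right (u v : EW W) (m t : ℤ) : Fab u v 0 m t = 0 := by
  rw [Fab, mf_zero_right, mf_zero_right]

theorem apply_zero_of_mem_N2 {F : W → ℤ → ℤ → W} (hF : F ∈ N2 D Z X) : F 0 = 0 := by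
  induction hF using AddSubmonoid.closure_induction with
  | mem F h =>
    obtain ⟨q, hq, u, hu, v, hv, rfl⟩ := h
    have : uv u v 0 = 0 := by
      apply toFam_injective
      intro m t
      simp [Fab_zero_right]
    funext m t
    simp only [this, k2_smul_zero, toFam_zero, Pi.zero_apply]
  | zero => rfl
  | add F F' _ _ h h' => rw [Pi.add_apply, h, h', add_zero]

theorem tr21_of_mem_N2 {F : W → ℤ → ℤ → W} (hF : F ∈ N2 D Z X) (w : W) : Tr21 (F w) := by
  obtain ⟨M, rfl⟩ := exists_toFam_of_mem_N2 hF
  exact tr21_toFam _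

theorem tr21_rgt {F : W → ℤ → ℤ → W} (hF : ∀ w, Tr21 (F w)) (h0 : F 0 = 0) (v : EW W) (w : W)
    (m : ℤ) : Tr21 (rgt F v w m) := by
  refine ⟨?_, fun t => (hF _).2 m⟩
  obtain ⟨N, hN⟩ := exists_mf_eq_zero v w
  refine ⟨-N, fun t s h => ?_⟩
  by_contra hc
  exact h (by rw [rgt, hN _ (by omega), h0]; rfl)

theorem tr21_lft (a : EW W) {F : W → ℤ → ℤ → W} (hF : ∀ w, Tr21 (F w)) (w : W) (m : ℤ) :
    Tr21 (lft a F w m) := by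
  have h : ∀ t s, lft a F w m t s ≠ 0 → F w t s ≠ 0 := fun t s h h0 =>
    h (by rw [lft, h0, mf_zero_right])
  obtain ⟨⟨N, hN⟩, hF'⟩ := hF w
  refine ⟨⟨N, fun t s h' => hN t s (h t s h')⟩, fun t => ?_⟩
  obtain ⟨N, hN⟩ := hF' t
  exact ⟨N, fun s h' => hN s (h t s h')⟩

theorem rgt_smulFam (F : W → ℤ → ℤ → W) (f : ℤ → ℤ → ℂ) (v : EW W) (w : W) :
    rgt (fun w => smulFam f (F w)) v w = mul13 f (rgt F v w) := rfl

theorem lft_smulFam (a : EW W) {F : W → ℤ → ℤ → W} {f : ℤ → ℤ → ℂ} (w : W)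
    (h : FinPair f (F w)) :
    lft a (fun w => smulFam f (F w)) w = mul23 f (lft a F w) := by
  funext m t s
  exact mf_smulFam a h t s _

/-! ### Left multiplication -/

theorem truncYX_mf {G : ℤ → ℤ → W} (hG : IsLaurent2 G) (u : EW W) :
    TruncYX fun m t s => mf u (G m t) (-s - 1) := by
  constructor
  · obtain ⟨N, hN⟩ := hG
    refine ⟨N, fun m t s h => ?_⟩
    by_contra hc
    exact h (by simp only [hN m t (by omega), mf_zero_right])
  · intro m t
    obtain ⟨N, hN⟩ := exists_mf_eq_zero u (G m t)
    refine ⟨-N, fun s h => ?_⟩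
    by_contra hc
    exact h (hN _ (by omega))

theorem mul12_mf (p : MvPolynomial (Fin 2) ℂ) (u : EW W) (F : ℤ → ℤ → W) :
    mul12 p (fun m t s => mf u (F m t) (-s - 1)) =
      fun m t s => mf u (mulPoly p F m t) (-s - 1) := by
  funext m t s
  exact (mf_mulPoly u p F m t _).symm

theorem mulPoly_shiftCoeff_Fab_mem_N2 {p : MvPolynomial (Fin 2) ℂ} (hp : p ∈ D.P) (l : ℕ)
    {u v : EW W} (hu : u ∈ Z) (hv : v ∈ X) :
    (fun w t s => mulPoly (shiftCoeff p 1 l) (Fab u v w) s t) ∈ N2 D Z X := by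
  convert mem_N2 (D.shiftCoeff_mem p hp 0 l) hu hv using 1
  funext w t s
  rw [← mulPoly_toFam, ← mulPoly_shiftCoeff_swap]
  rfl

theorem adm_rgt_uv (hX : ∀ n, ∀ v' ∈ X, ∀ v ∈ X, YE v' v n ∈ X') {u v' v : EW W} (hu : u ∈ Z)
    (hv' : v' ∈ X) (hv : v ∈ X) (hqc : QCP D v' v) :
    Adm D TruncYX (N2 D Z X') (rgt (fun w => toFam (uv u v' w)) v) := by
  have e : rgt (fun w => toFam (uv u v' w)) v =
      fun w m t s => mf u (Fab v' v w m t) (-s - 1) := rfl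
  rw [e]
  obtain ⟨p, hp, hL⟩ := hqc
  refine ⟨p, hp, fun r hr => ?_⟩
  have hL' : ∀ w, IsLaurent2 (mulPoly (r * p) (Fab v' v w)) :=
    fun w => isLaurent2_mulPoly_mul (hL w) r
  have hQ : QCPair v' v := ⟨p, D.ne_zero p hp, hL⟩
  refine ⟨fun w => ?_, fun j => ?_⟩
  · rw [mul12_mf]
    exact truncYX_mf (hL' w) u
  · convert sum_mem fun l (_ : l ∈ shiftDegrees (r * p)) =>
      mulPoly_shiftCoeff_Fab_mem_N2 (D.P.mul_mem hr hp) l hu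
        (hX (-(j : ℤ) - 1 + l) v' hv' v hv) using 1
    funext w t s
    simp only [Finset.sum_apply]
    rw [sum_shiftCoeff_right, mul12_mf, taylor3, ← mf_taylor u (hL' w),
      taylor_mulPoly_Fab hQ (hL' w)]
    congr 2
    ring

theorem adm_rgt (hqc : ∀ v' ∈ X, ∀ v ∈ X, QCP D v' v)
    (hX : ∀ n, ∀ v' ∈ X, ∀ v ∈ X, YE v' v n ∈ X') {v : EW W} (hv : v ∈ X)
    {F : W → ℤ → ℤ → W} (hF : F ∈ N2 D Z X) :
    Adm D TruncYX (N2 D Z X') (rgt F v) := by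
  induction hF using AddSubmonoid.closure_induction with
  | mem F h =>
    obtain ⟨q, hq, u, hu, v', hv', rfl⟩ := h
    have e : rgt (fun w => toFam (q • uv u v' w)) v =
        fun w => mul13 (k2Fun q) (rgt (fun w => toFam (uv u v' w)) v w) := by
      funext w
      rw [← rgt_smulFam]
      funext m t s
      simp only [rgt, smulFam_toFam]
    rw [e]
    refine Adm.mul13 taylorClass_truncYX (tr21_k2Fun q) (fun k F hF => ?_) (fun w t => ?_)
      (adm_rgt_uv hX hu hv' hv (hqc v' hv' v hv))
    · obtain ⟨q', hq', h⟩ := D.dd_left q hq k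
      rw [← h]
      exact smulFam_mem_N2 hq' hF
    · exact finPair_k2Fun q _
  | zero => exact Adm.zero taylorClass_truncYX
  | add F F' _ _ h h' => exact Adm.add taylorClass_truncYX h h'

theorem adm_lft (hqc : ∀ v' ∈ X, ∀ v ∈ X, QCP D v' v)
    (hX : ∀ n, ∀ v' ∈ X, ∀ v ∈ X, YE v' v n ∈ X') {a : EW W}
    (ha : ∀ u ∈ Z, Good D Z X (Fab a u)) {F : W → ℤ → ℤ → W} (hF : F ∈ N2 D Z X) :
    ∃ P ∈ D.P, ∀ R ∈ D.P,
      Adm D TruncYX (N2 D Z X') fun w => mul13 (k2Fun (polyEmbed (R * P))) (lft a F w) := by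
  induction hF using AddSubmonoid.closure_induction with
  | mem F h =>
    obtain ⟨q, hq, u, hu, v, hv, rfl⟩ := h
    obtain ⟨P, hP, hG⟩ := ha u hu
    refine ⟨P, hP, fun R hR => ?_⟩
    have hG' := mulPoly_mem_N2 (D.embed_mem R hR) hG
    have e : (fun w => mul13 (k2Fun (polyEmbed (R * P)))
        (lft a (fun w => toFam (q • uv u v w)) w)) =
        fun w => mul23 (k2Fun q) (rgt (fun w => mulPoly R (mulPoly P (Fab a u w))) v w) := by
      funext w
      have e1 : lft a (fun w => toFam (q • uv u v w)) w =
          mul23 (k2Fun q) (lft a (fun w => toFam (uv u v w)) w) := by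
        rw [← lft_smulFam a w (finPair_k2Fun q _)]
        funext m t s
        simp only [lft, smulFam_toFam]
      rw [e1, mul13_mul23 (finSupp_polyEmbed _) fun m =>
        finPair_of_tr21 q (tr21_lft a (fun w => tr21_toFam _) w m)]
      congr 1
      funext m t s
      rw [rgt, ← mulPoly_mul, mulPoly_eq_smulFam]
      rfl
    rw [e]
    exact Adm.mul23 taylorClass_truncYX (tr21_k2Fun q) (fun F hF => smulFam_mem_N2 hq hF)
      (fun w m => finPair_of_tr21 q
        (tr21_rgt (tr21_of_mem_N2 hG') (apply_zero_of_mem_N2 hG') v w m))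
      (adm_rgt hqc hX hv hG')
  | zero =>
    refine ⟨1, D.P.one_mem, fun R _ => ?_⟩
    convert Adm.zero taylorClass_truncYX using 1
    funext w m t s
    simp [mul13, lft, mf_zero_right, smulFam]
  | add F F' hF hF' h h' =>
    obtain ⟨P, hP, h⟩ := h
    obtain ⟨P', hP', h'⟩ := h'
    refine ⟨P * P', D.P.mul_mem hP hP', fun R hR => ?_⟩
    have h := h (R * P') (D.P.mul_mem hR hP')
    have h' := h' (R * P) (D.P.mul_mem hR hP)
    rw [show R * P' * P = R * (P * P') by ring] at h
    rw [mul_assoc] at h'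
    convert Adm.add taylorClass_truncYX h h' using 1
    funext w m t s
    have e : (fun m s => lft a (F + F') w m t s) =
        fun m s => lft a F w m t s + lft a F' w m t s := by
      funext m s
      simp only [lft, Pi.add_apply, mf_add_right]
    rw [mul13, e, smulFam_add ((finSupp_polyEmbed _).finPair _) ((finSupp_polyEmbed _).finPair _)]
    rfl

theorem linesFin_mul12 {p : MvPolynomial (Fin 2) ℂ} {H : ℤ → ℤ → ℤ → W}
    (h : ∀ s, IsLaurent2 (mulPoly p fun m t => H m t s)) : LinesFin (mul12 p H) :=
  fun t s => (h s).finite_line t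

theorem good_of_shiftPoly {A : ℤ → W → ℤ → ℤ → W} {p : MvPolynomial (Fin 2) ℂ} (hp : p ∈ D.P)
    {i : Fin 2} (hA : ∃ N, ∀ n, N ≤ n → A n = 0) {Z X : Set (EW W)}
    (hneg : ∀ n : ℤ, 0 ≤ n →
      (∑ l ∈ shiftDegrees p, fun w => mulPoly (shiftCoeff p i l) (A (n + l) w)) = 0)
    (h : ∀ j : ℕ, Good D Z X
      (∑ l ∈ shiftDegrees p, fun w => mulPoly (shiftCoeff p i l) (A (-(j : ℤ) - 1 + l) w)))
    (n : ℤ) : Good D Z X (A n) := by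
  obtain ⟨l₀, hl₀, hlt⟩ := D.shiftCoeff_lead p hp i
  obtain ⟨N, hN⟩ := hA
  refine good_of_triangular (D.shiftCoeff_mem p hp i) hl₀ hlt (I := shiftDegrees p) ?_ hN ?_ n
  · by_contra hc
    exact D.ne_zero _ hl₀ (shiftCoeff_eq_zero hc)
  · intro n
    rcases lt_or_ge n 0 with hn | hn
    · obtain ⟨j, rfl⟩ : ∃ j : ℕ, n = -(j : ℤ) - 1 := ⟨(-n - 1).toNat, by omega⟩
      exact h j
    · rw [hneg n hn]
      exact good_zero

theorem good_left (hqc : ∀ v' ∈ X, ∀ v ∈ X, QCP D v' v)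
    (hX : ∀ n, ∀ v' ∈ X, ∀ v ∈ X, YE v' v n ∈ X') (hg : ∀ v ∈ X, ∀ u ∈ Z, Good D Z X (Fab v u))
    {a b c : EW W} (ha : a ∈ X) (hb : b ∈ X) (hc : c ∈ Z) (n : ℤ) :
    Good D Z X' (Fab (YE a b n) c) := by
  obtain ⟨P₁, hP₁, hν⟩ := hg b hb c hc
  obtain ⟨P₂, hP₂, hadm⟩ := adm_lft hqc hX (hg a ha) hν
  obtain ⟨p₀, hp₀, hadm⟩ := hadm 1 D.P.one_mem
  obtain ⟨pa, hpa, hL⟩ := hqc a ha b hb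
  have hQ : QCPair a b := ⟨pa, D.ne_zero _ hpa, hL⟩
  have hT := (hadm pa hpa).2
  have hL' : ∀ w, IsLaurent2 (mulPoly (pa * p₀) (Fab a b w)) := fun w => by
    rw [mul_comm]
    exact isLaurent2_mulPoly_mul (hL w) p₀
  have hp : pa * p₀ ∈ D.P := D.P.mul_mem hpa hp₀
  set p := pa * p₀ with hp_def
  clear_value p
  rw [one_mul] at hT
  have hG : ∀ w, LinesFin (mul12 p (lft a (Fab b c) w)) := fun w =>
    linesFin_mul12 fun s => hL' (mf c w (-s - 1))
  have key : ∀ j w t s, taylor3 j (mul12 p (lft a (Fab b c) w)) t s =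
      ∑ l ∈ shiftDegrees p, mulPoly (shiftCoeff p 0 l)
        (Fab (YE a b (-(j : ℤ) - 1 + l)) c w) t s := fun j w t s => by
    rw [sum_shiftCoeff_left]
    refine (taylor_mulPoly_Fab hQ (hL' (mf c w (-s - 1))) j t).trans ?_
    congr 1
    ring
  refine good_of_shiftPoly hp (i := 0) (A := fun n => Fab (YE a b n) c) ?_ (fun n hn => ?_)
    (fun j => ?_) n
  · obtain ⟨N, hN⟩ := exists_YE_eq_zero a b hQ
    refine ⟨N, fun n hn => ?_⟩
    funext w m t
    rw [hN n hn]
    exact mf_zero_left ..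
  · funext w t s
    simp only [Finset.sum_apply]
    rw [sum_shiftCoeff_left, mulPoly_shiftPoly_yFam a b hQ _ _ (hL' _), subst,
      if_neg (by omega)]
    rfl
  · choose g hg hgd using D.dd_left _ (D.embed_mem P₂ hP₂)
    have hg0 : g 0 = polyEmbed P₂ := by
      apply k2Fun_injective
      rw [hgd]
      intro m t
      simp [dd, binom_zero_right]
    have := good_of_leibniz hP₁ hP₂ hg
      (fun i => by rw [hgd]; exact (finSupp_polyEmbed P₂).dd i) hg0
      (F := fun j w => taylor3 j (mul12 p (lft a (Fab b c) w))) (Z := Z) (X := X') (fun j => ?_) j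
    · convert this using 1
      funext w t s
      rw [key]
      simp only [Finset.sum_apply]
    · refine good_of_mem_N2 ?_
      convert hT j using 1
      funext w
      have e : lft a (fun w => mulPoly P₁ (Fab b c w)) w =
          mul23 (k2Fun (polyEmbed P₁)) (lft a (Fab b c) w) := by
        funext m t s
        rw [lft, mf_mulPoly, mulPoly_eq_smulFam]
        rfl
      have f1 := finSupp_polyEmbed P₁
      have f2 := finSupp_polyEmbed P₂
      beta_reduce
      rw [e, mul12_mul13 _ (fun t => f2.finPair _), mul12_mul23 _ (fun m => f1.finPair _),
        mul13_mul23 f2 (fun m => f1.finPair _)]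
      funext t s
      rw [taylor3_mul23 (taylorClass_linesFin.fin23 _ _ f1
        (taylorClass_linesFin.mul13_mem _ _ f2 (hG w))), mulPoly_eq_smulFam]
      congr 1
      funext t s
      rw [taylor3_mul13 (taylorClass_linesFin.fin13 _ _ f2 (hG w))]
      simp only [hgd]

end NVA

namespace NVA

variable {W : Type*} [AddCommGroup W] [Module ℂ W]

/-! ### Right multiplication -/

/-- Exchange of the two variables of a family. -/
def swapFam : (W → ℤ → ℤ → W) →+ (W → ℤ → ℤ → W) where
  toFun F w s t := F w t s
  map_zero' := rfl
  map_add' _ _ := rfl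

theorem swapFam_apply {V : Type*} [AddCommGroup V] (F : V → ℤ → ℤ → V) (w : V) (s t : ℤ) :
    swapFam F w s t = F w t s := rfl

/-- The coefficients of an element of `K2` with the variables exchanged. -/
def k2Swap (q : K2) (b a : ℤ) : ℂ := k2Fun q a b

theorem tr12_k2Swap (q : K2) : Tr12 (k2Swap q) := tr21_k2Fun q

theorem smulFam_k2Swap (q : K2) (F : W → ℤ → ℤ → W) (w : W) :
    smulFam (k2Swap q) (swapFam F w) = swapFam (fun w => smulFam (k2Fun q) (F w)) w := by
  funext t s
  exact smulFam_swap (k2Fun q) (F w) s t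

theorem finSupp_k2Swap_polyEmbed (P : MvPolynomial (Fin 2) ℂ) : FinSupp (k2Swap (polyEmbed P)) :=
  (finSupp_polyEmbed P).swap

theorem smulFam_k2Swap_polyEmbed (P : MvPolynomial (Fin 2) ℂ) (F : W → ℤ → ℤ → W) (w : W) :
    smulFam (k2Swap (polyEmbed P)) (swapFam F w) = swapFam (fun w => mulPoly P (F w)) w := by
  rw [smulFam_k2Swap]
  funext t s
  exact (mulPoly_eq_smulFam ..).symm

theorem finPair_k2Swap_of_tr21 (q : K2) {F : ℤ → ℤ → W} (h : Tr21 F) :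
    FinPair (k2Swap q) fun b a => F a b :=
  (finPair_of_tr21 q h).swap

variable {D : LocData} {Z Z' X : Set (EW W)}

theorem smulFam_k2Swap_mem {q : K2} (hq : q ∈ D.Q) {F : W → ℤ → ℤ → W}
    (hF : F ∈ (N2 D Z X).comap swapFam) :
    (fun w => smulFam (k2Swap q) (F w)) ∈ (N2 D Z X).comap swapFam := by
  have h := smulFam_mem_N2 hq hF
  rw [AddSubmonoid.mem_comap]
  convert h using 1
  funext w s t
  exact congrFun (congrFun (smulFam_k2Swap q (swapFam F) w) t) s

theorem lft_swapFam_add (u : EW W) (F F' : W → ℤ → ℤ → W) :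
    lft u (swapFam (F + F')) =
      fun w m t s => lft u (swapFam F) w m t s + lft u (swapFam F') w m t s := by
  funext w m t s
  exact mf_add_right ..

theorem lft_swapFam_smulFam (u : EW W) {F : W → ℤ → ℤ → W} (hF : ∀ w, Tr21 (F w)) (q : K2) :
    lft u (swapFam fun w => smulFam (k2Fun q) (F w)) =
      fun w => mul23 (k2Swap q) (lft u (swapFam F) w) := by
  funext w
  rw [← lft_smulFam u w (finPair_k2Swap_of_tr21 q (hF w))]
  funext m t s
  rw [lft, lft, smulFam_k2Swap]

theorem rgt_swapFam_smulFam (v : EW W) (F : W → ℤ → ℤ → W) (q : K2) :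
    rgt (swapFam fun w => smulFam (k2Fun q) (F w)) v =
      fun w => mul13 (k2Swap q) (rgt (swapFam F) v w) := by
  funext w
  rw [← rgt_smulFam]
  funext m t s
  rw [rgt, rgt, smulFam_k2Swap]

theorem isLaurent2_zero_mf {p : MvPolynomial (Fin 2) ℂ} (u u' : EW W) (m t : ℤ) :
    mulPoly p (Fab u u' 0) m t = 0 := by
  have : Fab u u' 0 = fun _ _ => 0 := by
    funext m t
    exact Fab_zero_right ..
  rw [this, mulPoly_zero]

theorem truncZ_mf {p : MvPolynomial (Fin 2) ℂ} {u u' : EW W}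
    (h : ∀ w, IsLaurent2 (mulPoly p (Fab u u' w))) (v : EW W) (w : W) :
    TruncZ fun m t s => mulPoly p (Fab u u' (mf v w (-s - 1))) m t := by
  constructor
  · obtain ⟨N, hN⟩ := exists_mf_eq_zero v w
    refine ⟨-N, fun m t s h0 => ?_⟩
    by_contra hc
    exact h0 (by simp only [hN _ (show N ≤ -s - 1 by omega), isLaurent2_zero_mf])
  · intro s
    obtain ⟨N, hN⟩ := h (mf v w (-s - 1))
    refine ⟨N, fun m t h0 => ?_⟩
    by_contra hc
    exact h0 (hN m t (by omega))

theorem mulPoly_shiftCoeff_zero_mem {p : MvPolynomial (Fin 2) ℂ} (hp : p ∈ D.P) (l : ℕ)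
    {u v : EW W} (hu : u ∈ Z) (hv : v ∈ X) :
    (fun w => mulPoly (shiftCoeff p 0 l) (Fab u v w)) ∈ (N2 D Z X).comap swapFam := by
  rw [AddSubmonoid.mem_comap]
  convert mem_N2 (D.shiftCoeff_mem p hp 1 l) hu hv using 1
  funext w s t
  rw [← mulPoly_toFam, ← mulPoly_shiftCoeff_swap]
  rfl

theorem adm_lft_uv (hZ : ∀ n, ∀ v' ∈ Z, ∀ v ∈ Z, YE v' v n ∈ Z') {u u' v : EW W} (hu : u ∈ Z)
    (hu' : u' ∈ Z) (hv : v ∈ X) (hqc : QCP D u u') :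
    Adm D TruncZ ((N2 D Z' X).comap swapFam) (lft u (swapFam fun w => toFam (uv u' v w))) := by
  have e : lft u (swapFam fun w => toFam (uv u' v w)) =
      fun w m t s => Fab u u' (mf v w (-s - 1)) m t := rfl
  rw [e]
  obtain ⟨p, hp, hL⟩ := hqc
  refine ⟨p, hp, fun r hr => ?_⟩
  have hL' : ∀ w, IsLaurent2 (mulPoly (r * p) (Fab u u' w)) := fun w =>
    isLaurent2_mulPoly_mul (hL w) r
  have hQ : QCPair u u' := ⟨p, D.ne_zero p hp, hL⟩
  refine ⟨fun w => truncZ_mf hL' v w, fun j => ?_⟩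
  convert sum_mem fun l (_ : l ∈ shiftDegrees (r * p)) =>
    mulPoly_shiftCoeff_zero_mem (D.P.mul_mem hr hp) l
      (hZ (-(j : ℤ) - 1 + l) u hu u' hu') hv using 1
  funext w t s
  simp only [Finset.sum_apply]
  rw [sum_shiftCoeff_left]
  refine (taylor_mulPoly_Fab hQ (hL' (mf v w (-s - 1))) j t).trans ?_
  congr 1
  ring

theorem adm_lft_swapFam (hqc : ∀ u' ∈ Z, ∀ u ∈ Z, QCP D u' u)
    (hZ : ∀ n, ∀ u' ∈ Z, ∀ u ∈ Z, YE u' u n ∈ Z') {u : EW W} (hu : u ∈ Z)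
    {F : W → ℤ → ℤ → W} (hF : F ∈ N2 D Z X) :
    Adm D TruncZ ((N2 D Z' X).comap swapFam) (lft u (swapFam F)) := by
  induction hF using AddSubmonoid.closure_induction with
  | mem F h =>
    obtain ⟨q, hq, u', hu', v, hv, rfl⟩ := h
    have e : (fun w => toFam (q • uv u' v w)) =
        fun w => smulFam (k2Fun q) (toFam (uv u' v w)) := by
      funext w m t
      exact (smulFam_toFam ..).symm
    rw [e, lft_swapFam_smulFam u (fun w => tr21_toFam _)]
    refine Adm.mul23 taylorClass_truncZ (tr12_k2Swap q) (fun F hF => smulFam_k2Swap_mem hq hF)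
      (fun w m => ?_) (adm_lft_uv hZ hu hu' hv (hqc u hu u' hu'))
    exact finPair_k2Swap_of_tr21 q
      (tr21_lft u (F := fun w => toFam (uv u' v w)) (fun w => tr21_toFam _) w m)
  | zero =>
    convert Adm.zero taylorClass_truncZ using 1
    funext w m t s
    exact mf_zero_right ..
  | add F F' _ _ h h' =>
    rw [lft_swapFam_add]
    exact Adm.add taylorClass_truncZ h h'

theorem adm_rgt_swapFam (hqc : ∀ u' ∈ Z, ∀ u ∈ Z, QCP D u' u)
    (hZ : ∀ n, ∀ u' ∈ Z, ∀ u ∈ Z, YE u' u n ∈ Z') {d : EW W}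
    (hd : ∀ v ∈ X, Good D Z X (Fab v d)) {F : W → ℤ → ℤ → W} (hF : F ∈ N2 D Z X) :
    ∃ P ∈ D.P, ∀ R ∈ D.P, Adm D TruncZ ((N2 D Z' X).comap swapFam)
      fun w => mul23 (k2Swap (polyEmbed (R * P))) (rgt (swapFam F) d w) := by
  induction hF using AddSubmonoid.closure_induction with
  | mem F h =>
    obtain ⟨q, hq, u, hu, v, hv, rfl⟩ := h
    obtain ⟨P, hP, hG⟩ := hd v hv
    refine ⟨P, hP, fun R hR => ?_⟩
    have hG' := mulPoly_mem_N2 (D.embed_mem R hR) hG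
    have e : (fun w => toFam (q • uv u v w)) =
        fun w => smulFam (k2Fun q) (toFam (uv u v w)) := by
      funext w m t
      exact (smulFam_toFam ..).symm
    have e' : (fun w => mul23 (k2Swap (polyEmbed (R * P)))
        (rgt (swapFam fun w => toFam (q • uv u v w)) d w)) =
        fun w => mul13 (k2Swap q)
          (lft u (swapFam fun w => mulPoly R (mulPoly P (Fab v d w))) w) := by
      funext w
      rw [e, rgt_swapFam_smulFam]
      beta_reduce
      rw [mul23_mul13 (H := rgt (swapFam fun w => toFam (uv u v w)) d w)
        (finSupp_k2Swap_polyEmbed _) fun t =>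
        finPair_k2Swap_of_tr21 q (tr21_toFam (uv u v (mf d w (-t - 1))))]
      congr 1
      have e1 : rgt (swapFam fun w => toFam (uv u v w)) d = lft u (swapFam fun w => Fab v d w) :=
        rfl
      rw [e1, ← lft_smulFam u w ((finSupp_k2Swap_polyEmbed _).finPair _)]
      funext m t s
      rw [lft, lft, smulFam_k2Swap_polyEmbed, swapFam_apply, swapFam_apply, mulPoly_mul]
    rw [e']
    refine Adm.mul13 taylorClass_truncZ (tr12_k2Swap q) (fun k F hF => ?_) (fun w t => ?_)
      (adm_lft_swapFam hqc hZ hu hG')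
    · obtain ⟨q', hq', h⟩ := D.dd_right q hq k
      have := smulFam_k2Swap_mem hq' hF
      rwa [show k2Swap q' = dd k (k2Swap q) from h] at this
    · refine finPair_k2Swap_of_tr21 q
        (F := fun s m => mf u (mulPoly R (mulPoly P (Fab v d w)) s t) (-m - 1)) ⟨?_, fun s => ?_⟩
      · obtain ⟨N, hN⟩ := (tr21_of_mem_N2 hG' w).1
        exact ⟨N, fun s m h => hN s t fun h0 => h (by simp only [h0, mf_zero_right])⟩
      · obtain ⟨N, hN⟩ := exists_mf_eq_zero u (mulPoly R (mulPoly P (Fab v d w)) s t)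
        refine ⟨-N, fun m h => ?_⟩
        by_contra hc
        exact h (hN _ (by omega))
  | zero =>
    refine ⟨1, D.P.one_mem, fun R _ => ?_⟩
    convert Adm.zero taylorClass_truncZ using 1
    funext w m t s
    simp [mul23, rgt, smulFam]
  | add F F' hF hF' h h' =>
    obtain ⟨P, hP, h⟩ := h
    obtain ⟨P', hP', h'⟩ := h'
    refine ⟨P * P', D.P.mul_mem hP hP', fun R hR => ?_⟩
    have h := h (R * P') (D.P.mul_mem hR hP')
    have h' := h' (R * P) (D.P.mul_mem hR hP)
    rw [show R * P' * P = R * (P * P') by ring] at h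
    rw [mul_assoc] at h'
    convert Adm.add taylorClass_truncZ h h' using 1
    funext w m t s
    have e : (fun t s => rgt (swapFam (F + F')) d w m t s) =
        fun t s => rgt (swapFam F) d w m t s + rgt (swapFam F') d w m t s := rfl
    rw [mul23, e, smulFam_add ((finSupp_k2Swap_polyEmbed _).finPair _)
      ((finSupp_k2Swap_polyEmbed _).finPair _)]
    rfl

theorem good_right (hqc : ∀ u' ∈ Z, ∀ u ∈ Z, QCP D u' u)
    (hZ : ∀ n, ∀ u' ∈ Z, ∀ u ∈ Z, YE u' u n ∈ Z') (hg : ∀ v ∈ X, ∀ u ∈ Z, Good D Z X (Fab v u))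
    {a b d : EW W} (ha : a ∈ X) (hb : b ∈ Z) (hd : d ∈ Z) (n : ℤ) :
    Good D Z' X (Fab a (YE b d n)) := by
  obtain ⟨P₁, hP₁, hν⟩ := hg a ha b hb
  obtain ⟨P₂, hP₂, hadm⟩ := adm_rgt_swapFam hqc hZ (fun v hv => hg v hv d hd) hν
  obtain ⟨p₀, hp₀, hadm⟩ := hadm 1 D.P.one_mem
  obtain ⟨pa, hpa, hL⟩ := hqc b hb d hd
  have hQ : QCPair b d := ⟨pa, D.ne_zero _ hpa, hL⟩
  have hT := (hadm pa hpa).2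
  have hL' : ∀ w, IsLaurent2 (mulPoly (pa * p₀) (Fab b d w)) := fun w => by
    rw [mul_comm]
    exact isLaurent2_mulPoly_mul (hL w) p₀
  have hp : pa * p₀ ∈ D.P := D.P.mul_mem hpa hp₀
  set p := pa * p₀ with hp_def
  clear_value p
  rw [one_mul] at hT
  have hH : ∀ w, rgt (swapFam (Fab a b)) d w = fun m t s => mf a (Fab b d w m t) (-s - 1) :=
    fun w => rfl
  have hG : ∀ w, LinesFin (mul12 p (rgt (swapFam (Fab a b)) d w)) := fun w t s => by
    rw [hH, mul12_mf]
    refine ((hL' w).finite_line t).subset fun m h h0 => h ?_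
    simp only [h0, mf_zero_right]
  have key : ∀ j w t s, taylor3 j (mul12 p (rgt (swapFam (Fab a b)) d w)) t s =
      ∑ l ∈ shiftDegrees p, mulPoly (shiftCoeff p 1 l)
        (Fab a (YE b d (-(j : ℤ) - 1 + l)) w) s t := fun j w t s => by
    rw [sum_shiftCoeff_right, hH, mul12_mf, taylor3, ← mf_taylor a (hL' w),
      taylor_mulPoly_Fab hQ (hL' w)]
    congr 2
    ring
  refine good_of_shiftPoly hp (i := 1) (A := fun n => Fab a (YE b d n)) ?_ (fun n hn => ?_)
    (fun j => ?_) n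
  · obtain ⟨N, hN⟩ := exists_YE_eq_zero b d hQ
    refine ⟨N, fun n hn => ?_⟩
    funext w m t
    rw [hN n hn, Fab, mf_zero_left, mf_zero_right]
    rfl
  · funext w s t
    simp only [Finset.sum_apply]
    rw [sum_shiftCoeff_right, mulPoly_shiftPoly_yFam b d hQ _ _ (hL' _), subst,
      if_neg (by omega), mf_zero_right]
    rfl
  · choose g hg hgd using D.dd_right _ (D.embed_mem P₁ hP₁)
    have hgd' : ∀ i, k2Swap (g i) = dd i (k2Swap (polyEmbed P₁)) := hgd
    have hg0 : g 0 = polyEmbed P₁ := by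
      apply k2Fun_injective
      intro m t
      have := congrFun (congrFun (hgd' 0) t) m
      simp only [dd, binom_zero_right, one_mul, Nat.cast_zero, add_zero] at this
      exact this
    have := good_of_leibniz hP₂ hP₁ hg
      (fun i => by
        have := (finSupp_k2Swap_polyEmbed P₁).dd i
        rw [← hgd'] at this
        exact this.swap) hg0
      (F := fun j => swapFam fun w => taylor3 j (mul12 p (rgt (swapFam (Fab a b)) d w)))
      (Z := Z') (X := X) (fun j => ?_) j
    · convert this using 1
      funext w s t
      rw [swapFam_apply, key]
      simp only [Finset.sum_apply]
    · refine good_of_mem_N2 ?_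
      convert AddSubmonoid.mem_comap.1 (hT j) using 1
      funext w
      have f1 := finSupp_k2Swap_polyEmbed P₁
      have f2 := finSupp_k2Swap_polyEmbed P₂
      have e : rgt (swapFam fun w => mulPoly P₁ (Fab a b w)) d w =
          mul13 (k2Swap (polyEmbed P₁)) (rgt (swapFam (Fab a b)) d w) := by
        rw [← rgt_smulFam]
        funext m t s
        rw [rgt, rgt, smulFam_k2Swap_polyEmbed]
      funext s t
      beta_reduce
      rw [swapFam_apply, e, mul12_mul23 _ (fun m => f2.finPair _),
        mul12_mul13 _ (fun t => f1.finPair _), taylor3_mul23 (taylorClass_linesFin.fin23 _ _ f2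
        (taylorClass_linesFin.mul13_mem _ _ f1 (hG w)))]
      have e2 : taylor3 j (mul13 (k2Swap (polyEmbed P₁))
          (mul12 p (rgt (swapFam (Fab a b)) d w))) = fun t s =>
          ∑ ik ∈ Finset.HasAntidiagonal.antidiagonal j, smulFam (k2Fun (g ik.1))
            (swapFam (fun w => taylor3 ik.2 (mul12 p (rgt (swapFam (Fab a b)) d w))) w) s t := by
        funext t s
        rw [taylor3_mul13 (taylorClass_linesFin.fin13 _ _ f1 (hG w))]
        refine Finset.sum_congr rfl fun ik _ => ?_
        rw [← hgd']
        exact smulFam_swap (k2Fun (g ik.1)) _ _ _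
      rw [e2]
      exact (congrFun (congrFun (smulFam_k2Swap_polyEmbed P₂ (fun w s t =>
        ∑ ik ∈ Finset.HasAntidiagonal.antidiagonal j, smulFam (k2Fun (g ik.1))
          (swapFam (fun w => taylor3 ik.2 (mul12 p (rgt (swapFam (Fab a b)) d w))) w) s t)
          w) t) s).symm

end NVA

namespace NVA

variable {W : Type*} [AddCommGroup W] [Module ℂ W]
variable {D : LocData} {Z Z' X X' : Set (EW W)}

/-! ### The generated nonlocal vertex algebra -/

theorem qcp_of_good {a b : EW W} (h : Good D Z X (Fab a b)) : QCP D a b := by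
  obtain ⟨P, hP, hF⟩ := h
  refine ⟨P, hP, fun w => ?_⟩
  obtain ⟨N, hN⟩ := (tr21_of_mem_N2 hF w).1
  obtain ⟨M, hM⟩ := Fab_trunc_right a b w
  refine ⟨min N M, fun m t hmt => ?_⟩
  by_contra hc
  have h1 := hN m t hc
  obtain ⟨d, -, hd⟩ := Finset.exists_ne_zero_of_sum_ne_zero hc
  have h2 := hM (m - d 0) (t - d 1) fun h0 => hd (by rw [h0, smul_zero])
  omega

theorem Fab_add_left (a a' b : EW W) : Fab (a + a') b = Fab a b + Fab a' b := by
  funext w m t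
  exact mf_add_left ..

theorem Fab_smul_left (c : ℂ) (a b : EW W) : Fab (c • a) b = fun w m t => c • Fab a b w m t := by
  funext w m t
  exact mf_smul_left ..

theorem Fab_zero_left (b : EW W) : Fab 0 b = 0 := by
  funext w m t
  exact mf_zero_left ..

theorem Fab_add_snd (a b b' : EW W) : Fab a (b + b') = Fab a b + Fab a b' := by
  funext w m t
  simp only [Fab, mf_add_left, mf_add_right, Pi.add_apply]

theorem Fab_smul_snd (c : ℂ) (a b : EW W) : Fab a (c • b) = fun w m t => c • Fab a b w m t := by
  funext w m t
  simp only [Fab, mf_smul_left, mf_smul_right]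

theorem Fab_zero_snd (a : EW W) : Fab a 0 = 0 := by
  funext w m t
  simp only [Fab, mf_zero_left, mf_zero_right, Pi.zero_apply]

theorem good_span {S T : Set (EW W)} (h : ∀ a ∈ S, ∀ b ∈ T, Good D Z X (Fab a b)) {a b : EW W}
    (ha : a ∈ Submodule.span ℂ S) (hb : b ∈ Submodule.span ℂ T) : Good D Z X (Fab a b) := by
  induction hb using Submodule.span_induction with
  | mem b hb =>
    induction ha using Submodule.span_induction with
    | mem a ha => exact h a ha b hb
    | zero => rw [Fab_zero_left]; exact good_zero
    | add a a' _ _ h h' => rw [Fab_add_left]; exact h.add h'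
    | smul c a _ h => rw [Fab_smul_left]; exact h.smul c
  | zero => rw [Fab_zero_snd]; exact good_zero
  | add b b' _ _ h h' => rw [Fab_add_snd]; exact h.add h'
  | smul c b _ h => rw [Fab_smul_snd]; exact h.smul c

theorem Fab_oneE (a : EW W) (w : W) (m t : ℤ) : Fab oneE a w m t = Fab a oneE w t m := by
  have h : ∀ (w : W) n, mf oneE w n = if n = -1 then w else 0 := fun w n => rfl
  rw [Fab, Fab, h, h]
  split_ifs
  · rfl
  · rw [mf_zero_right]

theorem good_of_swap {a b : EW W} (h : ∀ w m t, Fab a b w m t = Fab b a w t m) (hb : b ∈ Z)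
    (ha : a ∈ X) : Good D Z X (Fab a b) := by
  refine good_of_mem_N2 ?_
  convert mem_N2 D.Q.one_mem hb ha using 1
  funext w m t
  rw [k2_one_smul, toFam_uv, h]

theorem good_insert_oneE {S : Set (EW W)} (h : ∀ a ∈ S, ∀ b ∈ S, Good D S S (Fab a b))
    {T : Set (EW W)} (hT : insert oneE S ⊆ T) :
    ∀ a ∈ insert oneE S, ∀ b ∈ insert oneE S, Good D T T (Fab a b) := by
  intro a ha b hb
  rcases ha with rfl | ha'
  · exact good_of_swap (Fab_oneE b) (hT hb) (hT (Set.mem_insert _ _))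
  · rcases hb with rfl | hb'
    · exact good_of_swap (fun w m t => (Fab_oneE a w t m).symm) (hT (Set.mem_insert _ _))
        (hT (Set.mem_insert_of_mem _ ha'))
    · exact (h a ha' b hb').mono ((Set.subset_insert _ _).trans hT)
        ((Set.subset_insert _ _).trans hT)

/-- The elements of `K` together with all products `a(x)_n b(x)`. -/
def withProducts (K : Set (EW W)) : Set (EW W) :=
  K ∪ {c | ∃ a ∈ K, ∃ b ∈ K, ∃ n, c = YE a b n}

theorem good_withProducts {K : Set (EW W)} (h : ∀ a ∈ K, ∀ b ∈ K, Good D K K (Fab a b)) :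
    ∀ a ∈ Submodule.span ℂ (withProducts K), ∀ b ∈ Submodule.span ℂ (withProducts K),
      Good D (Submodule.span ℂ (withProducts K)) (Submodule.span ℂ (withProducts K))
        (Fab a b) := by
  set K' := Submodule.span ℂ (withProducts K) with hK'
  have hK : K ⊆ K' := Set.subset_union_left.trans Submodule.subset_span
  have hY : ∀ n, ∀ a ∈ K, ∀ b ∈ K, YE a b n ∈ (K' : Set (EW W)) := fun n a ha b hb =>
    Submodule.subset_span (Or.inr ⟨a, ha, b, hb, n, rfl⟩)
  have hqc : ∀ a ∈ K, ∀ b ∈ K, QCP D a b := fun a ha b hb => qcp_of_good (h a ha b hb)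
  have h1 : ∀ a ∈ (K' : Set (EW W)), ∀ c ∈ K, Good D K K' (Fab a c) := by
    intro a ha c hc
    refine good_span (T := K) (fun a ha c hc => ?_) ha (Submodule.subset_span hc)
    rcases ha with ha | ⟨a, ha, b, hb, n, rfl⟩
    · exact (h a ha c hc).mono subset_rfl hK
    · exact good_left hqc hY h ha hb hc n
  intro a ha b hb
  refine good_span (S := K') (fun a ha c hc => ?_) (Submodule.subset_span ha) hb
  rcases hc with hc | ⟨b, hb, d, hd, n, rfl⟩
  · exact (h1 a ha c hc).mono hK subset_rfl
  · exact good_right hqc hY h1 ha hb hd n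

/-- The filtration of `⟨S⟩` by iterated products. -/
def genStep (S : Set (EW W)) : ℕ → Submodule ℂ (EW W)
  | 0 => Submodule.span ℂ (insert oneE S)
  | n + 1 => Submodule.span ℂ (withProducts (genStep S n))

theorem genStep_mono (S : Set (EW W)) : Monotone (genStep S) :=
  monotone_nat_of_le_succ fun _ => Set.subset_union_left.trans Submodule.subset_span

theorem good_genStep {S : Set (EW W)} (h : ∀ a ∈ S, ∀ b ∈ S, Good D S S (Fab a b)) (n : ℕ) :
    ∀ a ∈ genStep S n, ∀ b ∈ genStep S n, Good D (genStep S n) (genStep S n) (Fab a b) := by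
  induction n with
  | zero =>
    intro a ha b hb
    exact good_span (good_insert_oneE h Submodule.subset_span) ha hb
  | succ n ih => exact good_withProducts ih

theorem mem_iSup_genStep {S : Set (EW W)} {a : EW W} :
    a ∈ ⨆ n, genStep S n ↔ ∃ n, a ∈ genStep S n :=
  Submodule.mem_iSup_of_directed _ (genStep_mono S).directed_le

theorem genStep_le {S : Set (EW W)} {U : Submodule ℂ (EW W)} (hU : IsGenVA S U) (n : ℕ) :
    genStep S n ≤ U := by
  obtain ⟨-, hcl, h1, hS, -⟩ := hU
  induction n with
  | zero => exact Submodule.span_le.2 (Set.insert_subset h1 hS)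
  | succ n ih =>
    refine Submodule.span_le.2 (Set.union_subset ih ?_)
    rintro _ ⟨a, ha, b, hb, k, rfl⟩
    exact hcl a (ih ha) b (ih hb) k

theorem IsGenVA.le_iSup_genStep {S : Set (EW W)} {U : Submodule ℂ (EW W)} (hU : IsGenVA S U) :
    U ≤ ⨆ n, genStep S n := by
  have h0 : (insert oneE S : Set (EW W)) ⊆ genStep S 0 := Submodule.subset_span
  refine hU.2.2.2.2 _ ⟨?_, ?_, ?_, ?_⟩
  · intro r ψ hψ
    exact hU.1 r ψ fun i => iSup_le (genStep_le hU) (hψ i)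
  · intro a ha b hb n
    obtain ⟨i, hi⟩ := mem_iSup_genStep.1 ha
    obtain ⟨j, hj⟩ := mem_iSup_genStep.1 hb
    exact mem_iSup_genStep.2 ⟨max i j + 1, Submodule.subset_span (Or.inr
      ⟨a, genStep_mono S (le_max_left _ _) hi, b, genStep_mono S (le_max_right _ _) hj, n, rfl⟩)⟩
  · exact mem_iSup_genStep.2 ⟨0, h0 (Set.mem_insert _ _)⟩
  · exact fun a ha => mem_iSup_genStep.2 ⟨0, h0 (Set.mem_insert_of_mem _ ha)⟩

theorem IsGenVA.good {S : Set (EW W)} {U : Submodule ℂ (EW W)} (hU : IsGenVA S U)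
    (h : ∀ a ∈ S, ∀ b ∈ S, Good D S S (Fab a b)) :
    ∀ a ∈ U, ∀ b ∈ U, Good D U U (Fab a b) := by
  intro a ha b hb
  obtain ⟨i, hi⟩ := mem_iSup_genStep.1 (hU.le_iSup_genStep ha)
  obtain ⟨j, hj⟩ := mem_iSup_genStep.1 (hU.le_iSup_genStep hb)
  exact (good_genStep h (max i j) a (genStep_mono S (le_max_left _ _) hi) b
    (genStep_mono S (le_max_right _ _) hj)).mono (genStep_le hU _) (genStep_le hU _)

end NVA

namespace NVA

variable {W : Type*} [AddCommGroup W] [Module ℂ W]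

/-! ### Derivatives of coefficient series -/

/-- The element of `ℂ((x₂))((x₁))` with given coefficients. -/
def ofK2 (F : ℤ → ℤ → ℂ) (h : Tr21 F) : K2 where
  coeff m :=
    { coeff := F m
      isPWO_support' := isPWO_of_forall_le (h.2 m).choose_spec }
  isPWO_support' := by
    refine isPWO_of_forall_le (N := h.1.choose) ?_
    intro m hm
    by_contra hlt
    apply hm
    ext t
    by_contra ht
    exact hlt (h.1.choose_spec m t ht)

@[simp] theorem k2Fun_ofK2 (F : ℤ → ℤ → ℂ) (h : Tr21 F) : k2Fun (ofK2 F h) = F := rfl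

/-- The partial derivative of a two-variable series in the variable `i`. -/
def pd (i : Fin 2) (F : ℤ → ℤ → ℂ) (m t : ℤ) : ℂ :=
  ((![m, t] i : ℤ) + 1) * F (m + ![1, 0] i) (t + ![0, 1] i)

theorem tr21_pd (i : Fin 2) {F : ℤ → ℤ → ℂ} (h : Tr21 F) : Tr21 (pd i F) := by
  obtain ⟨⟨N, hN⟩, h2⟩ := h
  refine ⟨⟨N - ![1, 0] i, fun m t hmt => ?_⟩, fun m => ?_⟩
  · have := hN _ _ (right_ne_zero_of_mul hmt)
    omega
  · obtain ⟨N', hN'⟩ := h2 (m + ![1, 0] i)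
    refine ⟨N' - ![0, 1] i, fun t hmt => ?_⟩
    have := hN' _ (right_ne_zero_of_mul hmt)
    omega

/-- The partial derivative in the variable `i` on `ℂ((x₂))((x₁))`. -/
def pdK2 (i : Fin 2) (q : K2) : K2 := ofK2 (pd i (k2Fun q)) (tr21_pd i (tr21_k2Fun q))

@[simp] theorem k2Fun_pdK2 (i : Fin 2) (q : K2) : k2Fun (pdK2 i q) = pd i (k2Fun q) := rfl

theorem k2Fun_constK2_mul (c : ℂ) (q : K2) (m t : ℤ) :
    k2Fun (constK2 c * q) m t = c * k2Fun q m t := by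
  rw [k2Fun, constK2_apply, HahnSeries.coeff_single_mul, HahnSeries.coeff_single_mul]
  simp [k2Fun]

theorem k2Fun_polyEmbed_mul (P : MvPolynomial (Fin 2) ℂ) (q : K2) (m t : ℤ) :
    k2Fun (polyEmbed P * q) m t = mulPoly P (k2Fun q) m t := by
  induction P using MvPolynomial.induction_on' with
  | add P Q hP hQ =>
    have h : (polyEmbed P + polyEmbed Q) * q = polyEmbed P * q + polyEmbed Q * q := by ring
    rw [polyEmbed_add, h, k2Fun_add, hP, hQ, mulPoly_add_left]
  | monomial d c =>
    rw [polyEmbed_monomial, mulPoly_monomial, k2Fun, HahnSeries.coeff_single_mul,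
      HahnSeries.coeff_single_mul]
    rfl

theorem pd_mulPoly (i : Fin 2) (P : MvPolynomial (Fin 2) ℂ) (F : ℤ → ℤ → ℂ) (m t : ℤ) :
    pd i (mulPoly P F) m t = mulPoly P (pd i F) m t + mulPoly (MvPolynomial.pderiv i P) F m t := by
  induction P using MvPolynomial.induction_on' with
  | add P Q hP hQ =>
    rw [map_add, mulPoly_add_left, mulPoly_add_left, add_add_add_comm, ← hP, ← hQ]
    simp only [pd, mulPoly_add_left, mul_add]
  | monomial d c =>
    simp only [pd, MvPolynomial.pderiv_monomial, mulPoly_monomial, smul_eq_mul]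
    by_cases hd : d i = 0
    · fin_cases i <;> simp at hd <;> simp [hd] <;> ring_nf
    · fin_cases i <;>
      · simp only [Fin.zero_eta, Fin.mk_one, Fin.isValue] at hd
        simp [Nat.cast_sub (Nat.one_le_iff_ne_zero.2 hd)]
        ring_nf

theorem pdK2_polyEmbed_mul (i : Fin 2) (P : MvPolynomial (Fin 2) ℂ) (q : K2) :
    pdK2 i (polyEmbed P * q) =
      polyEmbed P * pdK2 i q + polyEmbed (MvPolynomial.pderiv i P) * q := by
  apply k2Fun_injective
  intro m t
  have h : k2Fun (polyEmbed P * q) = mulPoly P (k2Fun q) := by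
    funext m t
    exact k2Fun_polyEmbed_mul ..
  rw [k2Fun_add, k2Fun_pdK2, h, pd_mulPoly, k2Fun_polyEmbed_mul, k2Fun_polyEmbed_mul, k2Fun_pdK2]

theorem dd_zero (f : ℤ → ℤ → ℂ) : dd 0 f = f := by
  funext m t
  simp [dd]

theorem dd_succ (k : ℕ) (f : ℤ → ℤ → ℂ) (m t : ℤ) :
    dd (k + 1) f m t = ((k : ℂ) + 1)⁻¹ * ((m + 1) * dd k f (m + 1) t) := by
  have h := binom_mul_sub (m + (k + 1)) k
  have hk : (k : ℂ) + 1 ≠ 0 := by exact_mod_cast k.succ_ne_zero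
  simp only [dd]
  push_cast at h ⊢
  rw [show m + 1 + (k : ℤ) = m + (k + 1) by ring]
  field_simp
  linear_combination f (m + (k + 1)) t * h

variable {Q : Subring K2}

theorem exists_dd_left (hc : ∀ c, constK2 c ∈ Q) (hd : ∀ q ∈ Q, pdK2 0 q ∈ Q) {q : K2}
    (hq : q ∈ Q) (k : ℕ) : ∃ q' ∈ Q, k2Fun q' = dd k (k2Fun q) := by
  induction k with
  | zero => exact ⟨q, hq, (dd_zero _).symm⟩
  | succ k ih =>
    obtain ⟨q', hq', h⟩ := ih
    refine ⟨constK2 ((k : ℂ) + 1)⁻¹ * pdK2 0 q', Q.mul_mem (hc _) (hd _ hq'), ?_⟩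
    funext m t
    rw [k2Fun_constK2_mul, dd_succ, k2Fun_pdK2, h]
    simp [pd]

theorem exists_dd_right (hc : ∀ c, constK2 c ∈ Q) (hd : ∀ q ∈ Q, pdK2 1 q ∈ Q) {q : K2}
    (hq : q ∈ Q) (k : ℕ) :
    ∃ q' ∈ Q, (fun b a => k2Fun q' a b) = dd k (fun b a => k2Fun q a b) := by
  induction k with
  | zero => exact ⟨q, hq, (dd_zero _).symm⟩
  | succ k ih =>
    obtain ⟨q', hq', h⟩ := ih
    refine ⟨constK2 ((k : ℂ) + 1)⁻¹ * pdK2 1 q', Q.mul_mem (hc _) (hd _ hq'), ?_⟩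
    funext m t
    rw [k2Fun_constK2_mul, dd_succ, k2Fun_pdK2, ← h]
    simp [pd]

/-- The membership of a sum `∑ q(x₁, x₂) u(x₂) v(x₁)`, with an explicit indexing. -/
theorem exists_sum_of_mem_N2 {D : LocData} {Z X : Set (EW W)} {F : W → ℤ → ℤ → W}
    (h : F ∈ N2 D Z X) : ∃ (r : ℕ) (q : Fin r → K2) (u v : Fin r → EW W),
      (∀ i, q i ∈ D.Q) ∧ (∀ i, u i ∈ Z) ∧ (∀ i, v i ∈ X) ∧
      ∀ w m t, F w m t = ∑ i, toFam (q i • uv (u i) (v i) w) m t := by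
  induction h using AddSubmonoid.closure_induction with
  | mem F h =>
    obtain ⟨q, hq, u, hu, v, hv, rfl⟩ := h
    exact ⟨1, fun _ => q, fun _ => u, fun _ => v, fun _ => hq, fun _ => hu, fun _ => hv,
      by simp⟩
  | zero => exact ⟨0, Fin.elim0, Fin.elim0, Fin.elim0, by simp⟩
  | add F F' _ _ h h' =>
    obtain ⟨r, q, u, v, hq, hu, hv, hF⟩ := h
    obtain ⟨r', q', u', v', hq', hu', hv', hF'⟩ := h'
    refine ⟨r + r', Fin.append q q', Fin.append u u', Fin.append v v', ?_, ?_, ?_, ?_⟩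
    · exact fun i => Fin.addCases (by simpa using hq) (by simpa using hq') i
    · exact fun i => Fin.addCases (by simpa using hu) (by simpa using hu') i
    · exact fun i => Fin.addCases (by simpa using hv) (by simpa using hv') i
    · intro w m t
      simp [Fin.sum_univ_add, hF, hF']

theorem sum_mem_N2 {D : LocData} {Z X : Set (EW W)} {r : ℕ} {q : Fin r → K2} {u v : Fin r → EW W}
    (hq : ∀ i, q i ∈ D.Q) (hu : ∀ i, u i ∈ Z) (hv : ∀ i, v i ∈ X) {F : W → ℤ → ℤ → W}
    (h : ∀ w m t, F w m t = ∑ i, toFam (q i • uv (u i) (v i) w) m t) : F ∈ N2 D Z X := by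
  convert sum_mem fun i (_ : i ∈ Finset.univ) => mem_N2 (hq i) (hu i) (hv i) using 1
  funext w m t
  simp only [h, Finset.sum_apply]

end NVA

namespace NVA

variable {W : Type*} [AddCommGroup W] [Module ℂ W]

/-! ### Pseudo-locality -/

/-- The embedding of `ℂ[[x₂]][[x₁]]` into `ℂ((x₂))((x₁))`. -/
def psHom : PowerSeries (PowerSeries ℂ) →+* K2 :=
  (HahnSeries.ofPowerSeries ℤ LC).comp (PowerSeries.map (HahnSeries.ofPowerSeries ℤ ℂ))

theorem psEmbed_eq (F : ℕ → ℕ → ℂ) :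
    psEmbed F = psHom (PowerSeries.mk fun m => PowerSeries.mk (F m)) := by
  rw [psEmbed, psHom, RingHom.comp_apply]
  congr 1

theorem mem_range_psHom {q : K2} : q ∈ psHom.range ↔ ∃ F, q = psEmbed F := by
  constructor
  · rintro ⟨f, rfl⟩
    refine ⟨fun m t => PowerSeries.coeff t (PowerSeries.coeff m f), ?_⟩
    rw [psEmbed_eq]
    congr 1
    ext m t
    simp
  · rintro ⟨F, rfl⟩
    exact ⟨_, (psEmbed_eq F).symm⟩

theorem polyEmbed_mem_range (P : MvPolynomial (Fin 2) ℂ) : polyEmbed P ∈ psHom.range :=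
  mem_range_psHom.2 ⟨_, rfl⟩

theorem pdK2_mem_range (i : Fin 2) {q : K2} (hq : q ∈ psHom.range) : pdK2 i q ∈ psHom.range := by
  obtain ⟨F, rfl⟩ := mem_range_psHom.1 hq
  refine mem_range_psHom.2 ⟨fun m t => ((![m, t] i : ℕ) + 1) * F (m + ![1, 0] i) (t + ![0, 1] i),
    k2Fun_injective fun m t => ?_⟩
  rw [k2Fun_pdK2, k2Fun_psEmbed]
  by_cases h : 0 ≤ m ∧ 0 ≤ t
  · obtain ⟨m, rfl⟩ := Int.eq_ofNat_of_zero_le h.1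
    obtain ⟨t, rfl⟩ := Int.eq_ofNat_of_zero_le h.2
    rw [if_pos h]
    fin_cases i <;> simp only [pd, k2Fun_psEmbed] <;> rw [if_pos (by simp; omega)] <;> rfl
  · rw [if_neg h]
    fin_cases i
    · by_cases hm : m = -1
      · simp [pd, hm]
      · simp only [pd, k2Fun_psEmbed]
        rw [if_neg (by simp; omega), mul_zero]
    · by_cases ht : t = -1
      · simp [pd, ht]
      · simp only [pd, k2Fun_psEmbed]
        rw [if_neg (by simp; omega), mul_zero]

theorem polyEmbed_one_mul (q : K2) : polyEmbed 1 * q = q := by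
  rw [polyEmbed_one]
  ring

/-- The quotients of power series by nonzero polynomials. -/
def pseudoRing : Subring K2 where
  carrier := {q | ∃ g : MvPolynomial (Fin 2) ℂ, g ≠ 0 ∧ polyEmbed g * q ∈ psHom.range}
  mul_mem' := by
    rintro q q' ⟨g, hg, h⟩ ⟨g', hg', h'⟩
    refine ⟨g * g', mul_ne_zero hg hg', ?_⟩
    convert psHom.range.mul_mem h h' using 1
    rw [polyEmbed_mul]
    ring
  one_mem' := ⟨1, one_ne_zero, by rw [polyEmbed_one_mul]; exact one_mem _⟩
  add_mem' := by
    rintro q q' ⟨g, hg, h⟩ ⟨g', hg', h'⟩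
    refine ⟨g * g', mul_ne_zero hg hg', ?_⟩
    convert psHom.range.add_mem (psHom.range.mul_mem (polyEmbed_mem_range g') h)
      (psHom.range.mul_mem (polyEmbed_mem_range g) h') using 1
    rw [polyEmbed_mul]
    ring
  zero_mem' := ⟨1, one_ne_zero, by rw [polyEmbed_one_mul]; exact zero_mem _⟩
  neg_mem' := by
    rintro q ⟨g, hg, h⟩
    refine ⟨g, hg, ?_⟩
    convert psHom.range.neg_mem h using 1
    ring

theorem mem_pseudoRing {q : K2} : q ∈ pseudoRing ↔
    ∃ (F : ℕ → ℕ → ℂ) (g : MvPolynomial (Fin 2) ℂ), g ≠ 0 ∧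
      q = psEmbed F * (polyEmbed g)⁻¹ := by
  constructor
  · rintro ⟨g, hg, h⟩
    obtain ⟨F, hF⟩ := mem_range_psHom.1 h
    refine ⟨F, g, hg, ?_⟩
    rw [← hF, mul_comm (G := K2), ← mul_assoc (G := K2), k2_inv_mul_cancel (polyEmbed_ne_zero hg)]
    ring
  · rintro ⟨F, g, hg, rfl⟩
    refine ⟨g, hg, mem_range_psHom.2 ⟨F, ?_⟩⟩
    have h := k2_inv_mul_cancel (polyEmbed_ne_zero hg)
    calc polyEmbed g * (psEmbed F * (polyEmbed g)⁻¹)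
        = psEmbed F * ((polyEmbed g)⁻¹ * polyEmbed g) := by ring
      _ = psEmbed F := by rw [h]; ring

theorem polyEmbed_mem_pseudoRing (P : MvPolynomial (Fin 2) ℂ) : polyEmbed P ∈ pseudoRing :=
  ⟨1, one_ne_zero, by rw [polyEmbed_one_mul]; exact polyEmbed_mem_range P⟩

theorem constK2_mem_pseudoRing (c : ℂ) : constK2 c ∈ pseudoRing := by
  rw [← polyEmbed_C]
  exact polyEmbed_mem_pseudoRing _

theorem pdK2_mem_pseudoRing (i : Fin 2) {q : K2} (hq : q ∈ pseudoRing) : pdK2 i q ∈ pseudoRing := by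
  obtain ⟨g, hg, h⟩ := hq
  refine ⟨g * g, mul_ne_zero hg hg, ?_⟩
  convert psHom.range.sub_mem
    (psHom.range.mul_mem (polyEmbed_mem_range g) (pdK2_mem_range i h))
    (psHom.range.mul_mem (polyEmbed_mem_range (MvPolynomial.pderiv i g)) h) using 1
  rw [polyEmbed_mul, pdK2_polyEmbed_mul]
  ring

theorem exists_shiftCoeff_lead {p : MvPolynomial (Fin 2) ℂ} (hp : p ≠ 0) (i : Fin 2) :
    ∃ l₀, shiftCoeff p i l₀ ≠ 0 ∧ ∀ l < l₀, shiftCoeff p i l = 0 := by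
  have hne : (shiftDegrees p).Nonempty := by
    rw [shiftDegrees, Finset.image_nonempty, MvPolynomial.support_nonempty]
    exact shiftPoly_ne_zero hp
  refine ⟨(shiftDegrees p).min' hne, fun h0 => ?_, fun l hl => shiftCoeff_eq_zero fun h =>
    absurd (Finset.min'_le _ _ h) (not_le.2 hl)⟩
  obtain ⟨d, hd, hdl⟩ := Finset.mem_image.1 ((shiftDegrees p).min'_mem hne)
  have := congrArg (MvPolynomial.coeff (Finsupp.single i (d 1))) h0
  rw [shiftCoeff, MvPolynomial.coeff_sum, Finset.sum_eq_single d] at this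
  · rw [MvPolynomial.coeff_monomial, if_pos rfl, MvPolynomial.coeff_zero] at this
    exact (MvPolynomial.mem_support_iff.1 hd) this
  · intro d' hd' hne'
    rw [MvPolynomial.coeff_monomial, if_neg]
    intro h1
    apply hne'
    have h2 := Finsupp.single_injective i h1
    have h3 := (Finset.mem_filter.1 hd').2
    ext j
    fin_cases j
    · exact h3.trans hdl.symm
    · exact h2
  · intro h
    exact absurd (Finset.mem_filter.2 ⟨hd, hdl⟩) h

/-- The polynomials and coefficient series of pseudo-locality. -/
def pseudoData : LocData where
  P := nonZeroDivisors _
  Q := pseudoRing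
  ne_zero _ hp := nonZeroDivisors.ne_zero hp
  embed_mem _ _ := polyEmbed_mem_pseudoRing _
  const_mem := constK2_mem_pseudoRing
  dd_left _ hq := exists_dd_left constK2_mem_pseudoRing (fun _ => pdK2_mem_pseudoRing 0) hq
  dd_right _ hq := exists_dd_right constK2_mem_pseudoRing (fun _ => pdK2_mem_pseudoRing 1) hq
  shiftCoeff_mem _ _ _ _ := polyEmbed_mem_pseudoRing _
  shiftCoeff_lead p hp i := by
    obtain ⟨l, h, h'⟩ := exists_shiftCoeff_lead (nonZeroDivisors.ne_zero hp) i
    exact ⟨l, mem_nonZeroDivisors_of_ne_zero h, h'⟩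

/-- Exponents of monomials as exponents of Laurent monomials. -/
def exponentEmb : (Fin 2 →₀ ℕ) ↪ ℤ × ℤ where
  toFun d := (d 0, d 1)
  inj' d d' h := by
    ext i
    fin_cases i
    · exact Nat.cast_injective (congrArg Prod.fst h)
    · exact Nat.cast_injective (congrArg Prod.snd h)

theorem exists_mulLPoly_eq_mulPoly {P : MvPolynomial (Fin 2) ℂ} (hP : P ≠ 0) :
    ∃ p : (ℤ × ℤ) →₀ ℂ, p ≠ 0 ∧ ∀ (F : ℤ → ℤ → W) m t, mulLPoly p F m t = mulPoly P F m t := by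
  refine ⟨(AddMonoidAlgebra.coeff P).embDomain exponentEmb, ?_, fun F m t => ?_⟩
  · rw [Ne, Finsupp.embDomain_eq_zero]
    intro h
    apply hP
    ext d
    exact congrArg (fun f => f d) h
  · rw [mulPoly_eq_sum]
    exact Finsupp.sum_embDomain (g := fun (d : ℤ × ℤ) (c : ℂ) => c • F (m - d.1) (t - d.2))

theorem exists_mulPoly_eq_mulLPoly {p : (ℤ × ℤ) →₀ ℂ} (hp : p ≠ 0) :
    ∃ (N : ℕ) (P : MvPolynomial (Fin 2) ℂ), P ≠ 0 ∧
      ∀ (F : ℤ → ℤ → W) m t, mulPoly P F m t = mulLPoly p F (m - N) (t - N) := by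
  obtain ⟨N, hN⟩ : ∃ N : ℕ, ∀ d ∈ p.support, 0 ≤ d.1 + N ∧ 0 ≤ d.2 + N := by
    refine ⟨p.support.sup fun d => d.1.natAbs + d.2.natAbs, fun d hd => ?_⟩
    have := Finset.le_sup (f := fun d : ℤ × ℤ => d.1.natAbs + d.2.natAbs) hd
    omega
  let e : ℤ × ℤ → (Fin 2 →₀ ℕ) := fun d =>
    Finsupp.single 0 (d.1 + N).toNat + Finsupp.single 1 (d.2 + N).toNat
  have e0 : ∀ d, e d 0 = (d.1 + N).toNat := fun d => by simp [e]
  have e1 : ∀ d, e d 1 = (d.2 + N).toNat := fun d => by simp [e]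
  refine ⟨N, ∑ d ∈ p.support, MvPolynomial.monomial (e d) (p d), fun h0 => ?_, fun F m t => ?_⟩
  · obtain ⟨d, hd⟩ := Finsupp.support_nonempty_iff.2 hp
    have := congrArg (MvPolynomial.coeff (e d)) h0
    rw [MvPolynomial.coeff_sum, Finset.sum_eq_single d] at this
    · rw [MvPolynomial.coeff_monomial, if_pos rfl, MvPolynomial.coeff_zero] at this
      exact (Finsupp.mem_support_iff.1 hd) this
    · intro d' hd' hne
      rw [MvPolynomial.coeff_monomial, if_neg]
      intro h
      apply hne
      have h1 := congrArg (fun f => f 0) h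
      have h2 := congrArg (fun f => f 1) h
      simp only [e0, e1] at h1 h2
      have := hN d hd
      have := hN d' hd'
      ext <;> omega
    · intro h
      exact absurd hd h
  · rw [mulPoly_sum_left, mulLPoly]
    refine Finset.sum_congr rfl fun d hd => ?_
    have := hN d hd
    rw [mulPoly_monomial, e0, e1]
    congr 2 <;> omega

theorem good_pseudoData_iff {S : Set (EW W)} {a b : EW W} : Good pseudoData S S (Fab a b) ↔
    ∃ p : (ℤ × ℤ) →₀ ℂ, p ≠ 0 ∧
      ∃ (r : ℕ) (F : Fin r → (ℕ → ℕ → ℂ)) (g : Fin r → MvPolynomial (Fin 2) ℂ)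
        (u v : Fin r → EW W),
        (∀ i, g i ≠ 0) ∧ (∀ i, u i ∈ S) ∧ (∀ i, v i ∈ S) ∧
        ∀ (w : W) (m t : ℤ),
          mulLPoly p (Fab a b w) m t =
            ∑ i, smulFam (k2Fun (psEmbed (F i) * (polyEmbed (g i))⁻¹))
              (fun m' t' => Fab (u i) (v i) w t' m') m t := by
  have key : ∀ (q : K2) (u v : EW W) (w : W) (m t : ℤ),
      smulFam (k2Fun q) (fun m' t' => Fab u v w t' m') m t = toFam (q • uv u v w) m t :=
    fun q u v w m t => smulFam_toFam q (uv u v w) m t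
  constructor
  · rintro ⟨P, hP, h⟩
    obtain ⟨p, hp, hpP⟩ := exists_mulLPoly_eq_mulPoly (W := W) (nonZeroDivisors.ne_zero hP)
    obtain ⟨r, q, u, v, hq, hu, hv, h⟩ := exists_sum_of_mem_N2 h
    choose F g hg hqF using fun i => mem_pseudoRing.1 (hq i)
    refine ⟨p, hp, r, F, g, u, v, hg, hu, hv, fun w m t => ?_⟩
    rw [hpP, h]
    simp only [key, ← hqF]
  · rintro ⟨p, hp, r, F, g, u, v, hg, hu, hv, h⟩
    obtain ⟨N, P, hP, hpP⟩ := exists_mulPoly_eq_mulLPoly (W := W) hp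
    let μ : MvPolynomial (Fin 2) ℂ :=
      MvPolynomial.monomial (Finsupp.single 0 N + Finsupp.single 1 N) 1
    refine ⟨P, mem_nonZeroDivisors_of_ne_zero hP, sum_mem_N2
      (q := fun i => polyEmbed μ * (psEmbed (F i) * (polyEmbed (g i))⁻¹))
      (fun i => pseudoRing.mul_mem (polyEmbed_mem_pseudoRing _)
        (mem_pseudoRing.2 ⟨_, _, hg i, rfl⟩))
      hu hv fun w m t => ?_⟩
    rw [hpP, h]
    refine Finset.sum_congr rfl fun i _ => ?_
    rw [key, k2_mul_smul (polyEmbed μ), ← mulPoly_toFam, mulPoly_monomial]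
    simp

theorem pseudoLocal_iff {S : Set (EW W)} :
    PseudoLocal S ↔ ∀ a ∈ S, ∀ b ∈ S, Good pseudoData S S (Fab a b) := by
  simp only [good_pseudoData_iff, PseudoLocal]

end NVA

namespace NVA

variable {W : Type*} [AddCommGroup W] [Module ℂ W]

/-! ### `𝒮`-locality -/

theorem binom_succ_mul (n : ℤ) (m : ℕ) : binom (n + 1) (m + 1) * (m + 1) = binom n m * (n + 1) := by
  rw [binom_succ_left, add_mul, binom_mul_sub]
  ring

theorem tr21_expandSub (f : LC) : Tr21 (expandSub f) := by
  obtain ⟨N, hN⟩ := exists_le_of_isPWO f.isPWO_support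
  refine ⟨⟨0, fun m t h => ?_⟩, fun m => ⟨N - m, fun t h => ?_⟩⟩
  · by_contra hm
    exact h (if_neg hm)
  · have h1 : f.coeff (t + m) ≠ 0 := by
      intro h0
      apply h
      simp [expandSub, h0]
    have := hN _ h1
    omega

theorem expandSub_natCast (f : LC) (m : ℕ) (t : ℤ) :
    expandSub f m t = (-1) ^ m * binom (t + m) m * f.coeff (t + m) := by
  rw [expandSub, if_pos (by omega), Int.toNat_natCast]

theorem expandSub_of_neg (f : LC) {m : ℤ} (hm : m < 0) (t : ℤ) : expandSub f m t = 0 :=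
  if_neg (by omega)

theorem expandSub_mul (f g : LC) (m t : ℤ) : expandSub (f * g) m t =
    k2Fun (ofK2 (expandSub f) (tr21_expandSub f) * ofK2 (expandSub g) (tr21_expandSub g)) m t := by
  have hneg : ∀ (f : LC) (i : ℤ), i < 0 → (ofK2 (expandSub f) (tr21_expandSub f)).coeff i = 0 := by
    intro f i hi
    ext t
    exact expandSub_of_neg f hi t
  rw [k2Fun, hahnSeries_coeff_mul]
  rcases lt_or_ge m 0 with hm | hm
  · rw [expandSub_of_neg _ hm, finsum_eq_zero_of_forall_eq_zero, HahnSeries.coeff_zero]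
    intro i
    rcases lt_or_ge i 0 with hi | hi
    · rw [hneg _ _ hi, zero_mul]
    · rw [hneg _ (m - i) (by omega), mul_zero]
  obtain ⟨n, rfl⟩ := Int.eq_ofNat_of_zero_le hm
  have hinj : Function.Injective (Nat.cast : ℕ → ℤ) := Nat.cast_injective
  rw [finsum_eq_sum_of_support_subset (s := (Finset.range (n + 1)).image Nat.cast),
    Finset.sum_image hinj.injOn, HahnSeries.coeff_sum]
  swap
  · intro i hi
    have h1 : 0 ≤ i := by
      by_contra h
      exact hi (by beta_reduce; rw [hneg _ _ (by omega), zero_mul])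
    have h2 : 0 ≤ (n : ℤ) - i := by
      by_contra h
      exact hi (by beta_reduce; rw [hneg _ ((n : ℤ) - i) (by omega), mul_zero])
    rw [Finset.coe_image]
    exact ⟨i.toNat, by simp; omega, by simp [h1]⟩
  have hterm : ∀ i ∈ Finset.range (n + 1),
      ((ofK2 (expandSub f) (tr21_expandSub f)).coeff (i : ℤ) *
        (ofK2 (expandSub g) (tr21_expandSub g)).coeff ((n : ℤ) - i)).coeff t =
      ∑ᶠ a : ℤ, (-1) ^ n * (binom a i * binom (t + n - a) (n - i)) *
        (f.coeff a * g.coeff (t + n - a)) := by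
    intro i hi
    have hin : i ≤ n := by simpa [Nat.lt_succ_iff] using hi
    rw [hahnSeries_coeff_mul, ← finsum_comp_equiv (Equiv.subRight (i : ℤ))]
    refine finsum_congr fun a => ?_
    change expandSub f i (a - i) * expandSub g ((n : ℤ) - i) (t - (a - i)) = _
    rw [← Nat.cast_sub hin, expandSub_natCast, expandSub_natCast, Nat.cast_sub hin,
      show t - (a - (i : ℤ)) + (n - i) = t + n - a by ring, sub_add_cancel,
      ← Nat.add_sub_cancel' hin, pow_add]
    simp only [Nat.add_sub_cancel_left, Nat.cast_add]
    ring
  rw [Finset.sum_congr rfl hterm, ← finsum_sum_comm, expandSub_natCast, hahnSeries_coeff_mul,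
    mul_finsum]
  · refine finsum_congr fun a => ?_
    have h := binom_add a (t + n - a) n
    rw [add_sub_cancel, Finset.Nat.sum_antidiagonal_eq_sum_range_succ
      (fun i j => binom a i * binom (t + n - a) j)] at h
    rw [← Finset.sum_mul, ← Finset.mul_sum, ← h]
  · intro i _
    exact (finite_hahn_conv f g (t + n)).subset fun a ha =>
      ⟨fun h => ha (by simp [h]), fun h => ha (by simp [h])⟩

theorem expandSub_single_zero (c : ℂ) (m t : ℤ) :
    expandSub (HahnSeries.single 0 c) m t = k2Fun (constK2 c) m t := by
  rw [constK2_apply, k2Fun_single_single]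
  rcases lt_or_ge m 0 with hm | hm
  · rw [expandSub_of_neg _ hm, if_neg (by omega)]
  obtain ⟨n, rfl⟩ := Int.eq_ofNat_of_zero_le hm
  rw [expandSub_natCast, HahnSeries.coeff_single]
  by_cases h : t + n = 0
  · rw [if_pos h, h]
    rcases n with _ | n
    · simp at h
      simp [h]
    · have : binom 0 (n + 1) = 0 := by
        have := binom_natCast 0 (n + 1)
        simpa using this
      rw [this, if_neg (by push_cast; omega)]
      simp
  · rw [if_neg h, if_neg (by omega), mul_zero]

/-- The substitution `f(x) ↦ ι_{x₂,x₁} f(x₂ - x₁)`. -/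
def expandHom : LC →+* K2 where
  toFun f := ofK2 (expandSub f) (tr21_expandSub f)
  map_zero' := k2Fun_injective fun m t => by simp [expandSub]
  map_one' := by
    rw [← map_one constK2]
    exact k2Fun_injective fun m t => expandSub_single_zero 1 m t
  map_add' f g := k2Fun_injective fun m t => by
    simp only [k2Fun_add, k2Fun_ofK2, expandSub, HahnSeries.coeff_add]
    split_ifs <;> ring
  map_mul' f g := k2Fun_injective fun m t => expandSub_mul f g m t

@[simp] theorem k2Fun_expandHom (f : LC) : k2Fun (expandHom f) = expandSub f := rfl

theorem constK2_eq_expandHom (c : ℂ) : constK2 c = expandHom (HahnSeries.single 0 c) :=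
  k2Fun_injective fun m t => (expandSub_single_zero c m t).symm

theorem polyEmbed_sub_eq_expandHom :
    polyEmbed (MvPolynomial.X 0 - MvPolynomial.X 1) = expandHom (HahnSeries.single 1 (-1)) := by
  apply k2Fun_injective
  intro m t
  have h : k2Fun (polyEmbed (MvPolynomial.X 0 - MvPolynomial.X 1)) m t =
      k2Fun xOuter m t - k2Fun xInner m t := by
    rw [polyEmbed_eq_evalK2, map_sub, evalK2_X0, evalK2_X1]
    rfl
  have h1 : k2Fun xOuter m t = if m = 1 ∧ t = 0 then 1 else 0 := k2Fun_single_single 1 0 1 m t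
  have h2 : k2Fun xInner m t = if m = 0 ∧ t = 1 then 1 else 0 := k2Fun_single_single 0 1 1 m t
  rw [h, h1, h2, k2Fun_expandHom]
  rcases lt_or_ge m 0 with hm | hm
  · rw [expandSub_of_neg _ hm, if_neg (by omega), if_neg (by omega), sub_zero]
  obtain ⟨n, rfl⟩ := Int.eq_ofNat_of_zero_le hm
  rw [expandSub_natCast, HahnSeries.coeff_single]
  by_cases h : t + n = 1
  · rw [if_pos h, h]
    have hb := binom_natCast 1 n
    obtain rfl : t = 1 - n := by omega
    rcases n with _ | _ | n
    · simp
    · rw [Nat.cast_one] at hb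
      simp [hb]
    · rw [Nat.cast_one, Nat.choose_eq_zero_of_lt (by omega), Nat.cast_zero] at hb
      rw [hb, if_neg (by push_cast; omega), if_neg (by push_cast; omega)]
      simp
  · rw [if_neg h, if_neg (by omega), if_neg (by omega)]
    simp

theorem coeff_hasseDeriv_one (f : LC) (n : ℤ) :
    (LaurentSeries.hasseDeriv ℂ 1 f).coeff n = (n + 1) * f.coeff (n + 1) := by
  rw [LaurentSeries.hasseDeriv_coeff, Ring.choose_one_right]
  simp

theorem pdK2_zero_expandHom (f : LC) :
    pdK2 0 (expandHom f) = expandHom (-LaurentSeries.hasseDeriv ℂ 1 f) := by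
  apply k2Fun_injective
  intro m t
  simp only [k2Fun_pdK2, k2Fun_expandHom, pd]
  simp only [Matrix.cons_val_zero, add_zero]
  rcases lt_or_ge m 0 with hm | hm
  · rw [expandSub_of_neg _ hm]
    rcases lt_or_ge (m + 1) 0 with hm' | hm'
    · rw [expandSub_of_neg _ hm', mul_zero]
    · obtain rfl : m = -1 := by omega
      simp
  obtain ⟨n, rfl⟩ := Int.eq_ofNat_of_zero_le hm
  have h := binom_succ_mul (t + n) n
  have h1 := expandSub_natCast f (n + 1) t
  push_cast at h h1 ⊢
  rw [h1, expandSub_natCast, HahnSeries.coeff_neg, coeff_hasseDeriv_one, ← add_assoc]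
  push_cast
  linear_combination (-(-1) ^ n * f.coeff (t + n + 1)) * h

theorem pdK2_one_expandHom (f : LC) :
    pdK2 1 (expandHom f) = expandHom (LaurentSeries.hasseDeriv ℂ 1 f) := by
  apply k2Fun_injective
  intro m t
  simp only [k2Fun_pdK2, k2Fun_expandHom, pd]
  change ((t : ℂ) + 1) * expandSub f (m + 0) (t + 1) = expandSub _ m t
  rw [add_zero]
  rcases lt_or_ge m 0 with hm | hm
  · rw [expandSub_of_neg _ hm, expandSub_of_neg _ hm, mul_zero]
  obtain ⟨n, rfl⟩ := Int.eq_ofNat_of_zero_le hm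
  have h := binom_succ_mul (t + n) n
  rw [binom_mul_sub] at h
  rw [expandSub_natCast, expandSub_natCast, coeff_hasseDeriv_one, add_right_comm]
  push_cast at h ⊢
  linear_combination ((-1) ^ n * f.coeff (t + n + 1)) * h

theorem shiftCoeff_pow (k : ℕ) (i : Fin 2) (l : ℕ) :
    shiftCoeff ((MvPolynomial.X 0 - MvPolynomial.X 1) ^ k) i l = if l = k then 1 else 0 := by
  have h : shiftPoly ((MvPolynomial.X 0 - MvPolynomial.X 1) ^ k) =
      MvPolynomial.monomial (Finsupp.single 0 k) 1 := by
    rw [map_pow, map_sub, shiftPoly_X0, shiftPoly_X1, add_sub_cancel_right,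
      MvPolynomial.X_pow_eq_monomial]
  rw [shiftCoeff, h, MvPolynomial.support_monomial, if_neg one_ne_zero, Finset.filter_singleton,
    Finsupp.single_eq_same]
  by_cases hl : l = k
  · rw [if_pos hl, if_pos hl.symm, Finset.sum_singleton]
    simp
  · rw [if_neg hl, if_neg (Ne.symm hl), Finset.sum_empty]

theorem X_sub_X_ne_zero : (MvPolynomial.X 0 - MvPolynomial.X 1 : MvPolynomial (Fin 2) ℂ) ≠ 0 := by
  rw [sub_ne_zero, Ne, MvPolynomial.X_inj]
  exact Fin.zero_ne_one

theorem polyEmbed_pow_eq_expandHom (k : ℕ) :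
    polyEmbed ((MvPolynomial.X 0 - MvPolynomial.X 1) ^ k) =
      expandHom (HahnSeries.single 1 (-1) ^ k) := by
  rw [map_pow, ← polyEmbed_sub_eq_expandHom, polyEmbed_eq_evalK2, polyEmbed_eq_evalK2, map_pow]

theorem constK2_mem_expandHom_range (c : ℂ) : constK2 c ∈ expandHom.range :=
  RingHom.mem_range.2 ⟨_, (constK2_eq_expandHom c).symm⟩

theorem pdK2_zero_mem_expandHom_range {q : K2} (hq : q ∈ expandHom.range) :
    pdK2 0 q ∈ expandHom.range := by
  obtain ⟨f, rfl⟩ := RingHom.mem_range.1 hq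
  exact RingHom.mem_range.2 ⟨_, (pdK2_zero_expandHom f).symm⟩

theorem pdK2_one_mem_expandHom_range {q : K2} (hq : q ∈ expandHom.range) :
    pdK2 1 q ∈ expandHom.range := by
  obtain ⟨f, rfl⟩ := RingHom.mem_range.1 hq
  exact RingHom.mem_range.2 ⟨_, (pdK2_one_expandHom f).symm⟩

theorem exists_dd_left_expandHom {q : K2} (hq : q ∈ expandHom.range) (k : ℕ) :
    ∃ q' ∈ expandHom.range, k2Fun q' = dd k (k2Fun q) :=
  exists_dd_left constK2_mem_expandHom_range (fun _ h => pdK2_zero_mem_expandHom_range h) hq k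

theorem exists_dd_right_expandHom {q : K2} (hq : q ∈ expandHom.range) (k : ℕ) :
    ∃ q' ∈ expandHom.range, (fun b a => k2Fun q' a b) = dd k (fun b a => k2Fun q a b) :=
  exists_dd_right constK2_mem_expandHom_range (fun _ h => pdK2_one_mem_expandHom_range h) hq k

theorem polyEmbed_pow_mem_expandHom_range (k : ℕ) :
    polyEmbed ((MvPolynomial.X 0 - MvPolynomial.X 1) ^ k) ∈ expandHom.range :=
  RingHom.mem_range.2 ⟨_, (polyEmbed_pow_eq_expandHom k).symm⟩

theorem polyEmbed_shiftCoeff_pow_mem (k : ℕ) (i : Fin 2) (l : ℕ) :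
    polyEmbed (shiftCoeff ((MvPolynomial.X 0 - MvPolynomial.X 1) ^ k) i l) ∈
      expandHom.range := by
  rw [shiftCoeff_pow]
  split_ifs
  · rw [polyEmbed_one]
    exact one_mem _
  · rw [polyEmbed_zero]
    exact zero_mem _

theorem shiftCoeff_pow_lead (k : ℕ) (i : Fin 2) :
    ∃ l₀, shiftCoeff ((MvPolynomial.X 0 - MvPolynomial.X 1) ^ k) i l₀ ∈
        Submonoid.powers (MvPolynomial.X 0 - MvPolynomial.X 1 : MvPolynomial (Fin 2) ℂ) ∧
      ∀ l < l₀, shiftCoeff ((MvPolynomial.X 0 - MvPolynomial.X 1) ^ k) i l = 0 := by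
  refine ⟨k, ?_, fun l hl => ?_⟩
  · rw [shiftCoeff_pow, if_pos rfl]
    exact one_mem _
  · rw [shiftCoeff_pow, if_neg hl.ne]

/-- The polynomials and coefficient series of `𝒮`-locality. -/
def sLocalData : LocData where
  P := Submonoid.powers (MvPolynomial.X 0 - MvPolynomial.X 1)
  Q := expandHom.range
  ne_zero := by
    rintro p ⟨k, rfl⟩
    exact pow_ne_zero k X_sub_X_ne_zero
  embed_mem := by
    rintro p ⟨k, rfl⟩
    exact polyEmbed_pow_mem_expandHom_range k
  const_mem := constK2_mem_expandHom_range
  dd_left _ := exists_dd_left_expandHom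
  dd_right _ := exists_dd_right_expandHom
  shiftCoeff_mem := by
    rintro p ⟨k, rfl⟩ i l
    exact polyEmbed_shiftCoeff_pow_mem k i l
  shiftCoeff_lead := by
    rintro p ⟨k, rfl⟩ i
    exact shiftCoeff_pow_lead k i

theorem mem_sLocalData_P {p : MvPolynomial (Fin 2) ℂ} :
    p ∈ sLocalData.P ↔ ∃ k : ℕ, (MvPolynomial.X 0 - MvPolynomial.X 1) ^ k = p :=
  Submonoid.mem_powers_iff _ _

theorem mem_sLocalData_Q {q : K2} : q ∈ sLocalData.Q ↔ ∃ f, expandHom f = q :=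
  RingHom.mem_range

theorem good_sLocalData_iff {S : Set (EW W)} {a b : EW W} : Good sLocalData S S (Fab a b) ↔
    ∃ (k : ℕ) (r : ℕ) (f : Fin r → LC) (u v : Fin r → EW W),
      (∀ i, u i ∈ S) ∧ (∀ i, v i ∈ S) ∧
      ∀ (w : W) (m t : ℤ),
        mulPoly ((MvPolynomial.X 0 - MvPolynomial.X 1) ^ k) (Fab a b w) m t =
          ∑ i, mulPoly ((MvPolynomial.X 0 - MvPolynomial.X 1) ^ k)
            (smulFam (expandSub (f i)) (fun m' t' => Fab (u i) (v i) w t' m')) m t := by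
  have key : ∀ (k : ℕ) (f : LC) (u v : EW W) (w : W) (m t : ℤ),
      mulPoly ((MvPolynomial.X 0 - MvPolynomial.X 1) ^ k)
        (smulFam (expandSub f) (fun m' t' => Fab u v w t' m')) m t =
      toFam (expandHom (HahnSeries.single 1 (-1) ^ k * f) • uv u v w) m t := by
    intro k f u v w m t
    have h : smulFam (expandSub f) (fun m' t' => Fab u v w t' m') =
        toFam (expandHom f • uv u v w) := by
      funext m t
      exact smulFam_toFam (expandHom f) (uv u v w) m t
    rw [h, mulPoly_toFam, polyEmbed_pow_eq_expandHom, map_mul, k2_mul_smul]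
  constructor
  · rintro ⟨p, hp, h⟩
    obtain ⟨k, rfl⟩ := mem_sLocalData_P.1 hp
    obtain ⟨r, q, u, v, hq, hu, hv, h⟩ := exists_sum_of_mem_N2 h
    choose f hf using fun i => mem_sLocalData_Q.1 (hq i)
    have hs : (HahnSeries.single 1 (-1) ^ k : LC) ≠ 0 :=
      pow_ne_zero k (HahnSeries.single_ne_zero (neg_ne_zero.2 one_ne_zero))
    refine ⟨k, r, fun i => (HahnSeries.single 1 (-1) ^ k)⁻¹ * f i, u, v, hu, hv, fun w m t => ?_⟩
    simp only [key, mul_inv_cancel_left₀ hs, hf]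
    exact h w m t
  · rintro ⟨k, r, f, u, v, hu, hv, h⟩
    refine ⟨_, mem_sLocalData_P.2 ⟨k, rfl⟩,
      sum_mem_N2 (q := fun i => expandHom (HahnSeries.single 1 (-1) ^ k * f i))
        (fun i => mem_sLocalData_Q.2 ⟨_, rfl⟩) hu hv fun w m t => ?_⟩
    exact (h w m t).trans (Finset.sum_congr rfl fun i _ => key k (f i) (u i) (v i) w m t)

theorem sLocal_iff {S : Set (EW W)} :
    SLocal S ↔ ∀ a ∈ S, ∀ b ∈ S, Good sLocalData S S (Fab a b) := by
  simp only [good_sLocalData_iff, SLocal]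

end NVA

namespace NVA

/-- cf. Proposition 3.9 / `pgeneral-locality-key`.  If `S` is a
pseudo-local subset of `ℰ(W)` then the nonlocal vertex algebra `⟨S⟩` generated by
`S` (the smallest closed quasi compatible subspace containing `S ∪ {1_W}`) is also
pseudo-local, and if `S` is `𝒮`-local then `⟨S⟩` is `𝒮`-local. -/
theorem statement11 {W : Type*} [AddCommGroup W] [Module ℂ W]
    (S : Set (EW W)) (U : Submodule ℂ (EW W)) (hU : IsGenVA S U) :
    (PseudoLocal S → PseudoLocal (U : Set (EW W))) ∧
    (SLocal S → SLocal (U : Set (EW W))) := by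
  exact ⟨fun h => pseudoLocal_iff.2 (hU.good (pseudoLocal_iff.1 h)),
    fun h => sLocal_iff.2 (hU.good (sLocal_iff.1 h))⟩

end NVA
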